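/- Let r, s ≥ 1 be integers. For Weil generic (q,t), i.e. for all (q,t) ∈ C^2 outside some countable union of proper Zariski-closed subsets of C^2 (in particular q, t not roots of unity), the algebra Λ_{r,s,a} with a_i = (q^i − 1)/(1 − t^i) is Cohen–Macaulay — equivalently, it is a free module of finite rank over its polynomial subalgebra C[Q_1,...,Q_{r+s}] — and its Hilbert series equals h_{r,s}(u) = (1/(u;u)_r) · Σ_{i=0}^{s} u^{i(r+1)}/(u;u)_i. -/

import Mathlib

open MvPolynomial

set_option synthInstance.maxHeartbeats 1000000
set_option maxHeartbeats 1000000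

noncomputable section

/-- The polynomial ring `ℂ[y_1,...,y_r,z_1,...,z_s]`, with `y_j = X (inl j)`,
`z_l = X (inr l)`. -/
abbrev Rrs (r s : ℕ) := MvPolynomial (Fin r ⊕ Fin s) ℂ

/-- The generalized power sum `Q_i = a_i (y_1^i + ... + y_r^i) + z_1^i + ... + z_s^i`. -/
def Qrs (r s : ℕ) (a : ℕ → ℂ) (i : ℕ) : Rrs r s :=
  C (a i) * ∑ j : Fin r, X (Sum.inl j) ^ i + ∑ l : Fin s, X (Sum.inr l) ^ i

/-- The algebra `Λ_{r,s,a}` generated by the `Q_i`, `i ≥ 1`. -/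
def LamRS (r s : ℕ) (a : ℕ → ℂ) : Subalgebra ℂ (Rrs r s) :=
  Algebra.adjoin ℂ {f : Rrs r s | ∃ i : ℕ, 1 ≤ i ∧ f = Qrs r s a i}

/-- The subalgebra `ℂ[Q_1,...,Q_{r+s}]`. -/
def BRS (r s : ℕ) (a : ℕ → ℂ) : Subalgebra ℂ (Rrs r s) :=
  Algebra.adjoin ℂ {f : Rrs r s | ∃ i : ℕ, 1 ≤ i ∧ i ≤ r + s ∧ f = Qrs r s a i}

/-- `Λ_{r,s,a}` viewed as a module over `ℂ[Q_1,...,Q_{r+s}]` (as the span of `Λ_{r,s,a}`,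
which coincides with it since the generators `Q_1,...,Q_{r+s}` lie in `Λ_{r,s,a}`). -/
def LamRSMod (r s : ℕ) (a : ℕ → ℂ) : Submodule ↥(BRS r s a) (Rrs r s) :=
  Submodule.span (BRS r s a) (LamRS r s a : Set (Rrs r s))

/-- The degree-`n` homogeneous component of a graded subspace. -/
def compRS (r s : ℕ) (M : Submodule ℂ (Rrs r s)) (n : ℕ) : Submodule ℂ (Rrs r s) :=
  M ⊓ homogeneousSubmodule (Fin r ⊕ Fin s) ℂ n

/-- The Hilbert series of a graded subspace, as a power series over `ℚ`. -/
def hilbRS (r s : ℕ) (M : Submodule ℂ (Rrs r s)) : PowerSeries ℚ :=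
  PowerSeries.mk fun n => (Module.finrank ℂ (compRS r s M n) : ℚ)

/-- The `q`-Pochhammer factor `(u;u)_m = (1-u)(1-u^2)⋯(1-u^m)` as a power series. -/
def uu (m : ℕ) : PowerSeries ℚ :=
  ∏ k ∈ Finset.range m, (1 - PowerSeries.X ^ (k + 1))

/-- Linear independence at one specialization of a polynomial family of vectors is an open
condition. -/
theorem exists_linearIndependent_specialization {P : Type*} [CommRing P] [Algebra ℂ P]
    {ι : Type*} [Finite ι] {V : Type*} [AddCommGroup V] [Module ℂ V]
    (v : ι → (P →ₐ[ℂ] ℂ) → V)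
    (hv : ∀ i, ∀ l : Module.Dual ℂ V, ∃ p : P, ∀ x, l (v i x) = x p)
    (x₀ : P →ₐ[ℂ] ℂ) (h : LinearIndependent ℂ fun i => v i x₀) :
    ∃ p : P, x₀ p ≠ 0 ∧ ∀ x : P →ₐ[ℂ] ℂ, x p ≠ 0 → LinearIndependent ℂ fun i => v i x := by
  classical
  cases nonempty_fintype ι
  have hl : ∀ j : ι, ∃ l : Module.Dual ℂ V, ∀ i, l (v i x₀) = if i = j then 1 else 0 := by
    intro j
    obtain ⟨l, hl⟩ := LinearMap.exists_extend ((Finsupp.lapply j) ∘ₗ h.repr)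
    refine ⟨l, fun i => ?_⟩
    have h1 := LinearMap.congr_fun hl ⟨v i x₀, Submodule.subset_span ⟨i, rfl⟩⟩
    simp only [LinearMap.comp_apply, Submodule.subtype_apply] at h1
    rw [h1]
    have h2 : h.repr ⟨v i x₀, Submodule.subset_span ⟨i, rfl⟩⟩ = Finsupp.single i 1 :=
      h.repr_eq_single i _ rfl
    simp [h2, Finsupp.single_apply]
  choose l hl using hl
  choose p hp using hv
  let M : Matrix ι ι P := fun i j => p i (l j)
  have hM : ∀ x : P →ₐ[ℂ] ℂ, x M.det = Matrix.det (fun i j => l j (v i x)) := by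
    intro x
    rw [AlgHom.map_det]
    congr 1
    ext i j
    change x (p i (l j)) = _
    rw [hp]
  refine ⟨M.det, ?_, fun x hx => ?_⟩
  · rw [hM]
    have : (fun i j => l j (v i x₀)) = (1 : Matrix ι ι ℂ) := by
      ext i j
      simp [hl, Matrix.one_apply]
    rw [this, Matrix.det_one]
    exact one_ne_zero
  · rw [Fintype.linearIndependent_iff]
    intro c hc
    rw [hM] at hx
    have := Matrix.eq_zero_of_vecMul_eq_zero hx (v := c) (by
      ext j
      have := congrArg (l j) hc
      simpa [Matrix.vecMul, dotProduct] using this)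
    exact fun i => congrFun this i

theorem dual_map_eq {P : Type*} [CommRing P] [Algebra ℂ P] {σ : Type*}
    (F : MvPolynomial σ P) (l : Module.Dual ℂ (MvPolynomial σ ℂ)) :
    ∃ p : P, ∀ x : P →ₐ[ℂ] ℂ, l (map (x : P →+* ℂ) F) = x p := by
  refine ⟨∑ d ∈ F.support, l (monomial d 1) • coeff d F, fun x => ?_⟩
  conv_lhs => rw [F.as_sum]
  simp only [map_sum, map_monomial, map_smul]
  refine Finset.sum_congr rfl fun d _ => ?_
  have : (monomial d ((x : P →+* ℂ) (coeff d F)) : MvPolynomial σ ℂ) =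
      x (coeff d F) • monomial d 1 := by
    simp [smul_monomial]
  rw [this, map_smul, smul_eq_mul, smul_eq_mul, mul_comm]

/-- A family of polynomials over a parameter algebra which is independent at one specialization
is independent at all specializations outside a hypersurface. -/
theorem exists_linearIndependent_map {P : Type*} [CommRing P] [Algebra ℂ P]
    {ι σ : Type*} [Finite ι] (F : ι → MvPolynomial σ P) (x₀ : P →ₐ[ℂ] ℂ)
    (h : LinearIndependent ℂ fun i => map (x₀ : P →+* ℂ) (F i)) :
    ∃ p : P, x₀ p ≠ 0 ∧ ∀ x : P →ₐ[ℂ] ℂ, x p ≠ 0 →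
      LinearIndependent ℂ fun i => map (x : P →+* ℂ) (F i) := by
  have hv : ∀ i, ∀ l : Module.Dual ℂ (MvPolynomial σ ℂ), ∃ p : P, ∀ x : P →ₐ[ℂ] ℂ,
      l (map (x : P →+* ℂ) (F i)) = x p := fun i l => dual_map_eq (F i) l
  have := exists_linearIndependent_specialization
    (v := fun (i : ι) (x : P →ₐ[ℂ] ℂ) => (map (x : P →+* ℂ) (F i) : MvPolynomial σ ℂ))
    hv x₀ h
  exact this

/-- The generating series counting the elements of a weighted set. -/
def wtSeries {I : Type*} (wt : I → ℕ) : PowerSeries ℚ :=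
  PowerSeries.mk fun n => (Nat.card {i // wt i = n} : ℚ)

theorem coeff_wtSeries {I : Type*} (wt : I → ℕ) (n : ℕ) :
    PowerSeries.coeff n (wtSeries wt) = (Nat.card {i // wt i = n} : ℚ) :=
  PowerSeries.coeff_mk _ _

theorem wtSeries_equiv {I J : Type*} (e : I ≃ J) {a : I → ℕ} {b : J → ℕ}
    (h : ∀ i, b (e i) = a i) : wtSeries a = wtSeries b := by
  ext n
  rw [coeff_wtSeries, coeff_wtSeries]
  congr 1
  exact Nat.card_congr (e.subtypeEquiv fun i => by rw [h])

/-- Elements of weight `n` of a product are pairs of elements whose weights add up to `n`. -/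
def prodFiberEquiv {I J : Type*} (a : I → ℕ) (b : J → ℕ) (n : ℕ) :
    {p : I × J // a p.1 + b p.2 = n} ≃
      Σ x : Finset.HasAntidiagonal.antidiagonal n, {i // a i = x.1.1} × {j // b j = x.1.2} where
  toFun p := ⟨⟨(a p.1.1, b p.1.2), Finset.HasAntidiagonal.mem_antidiagonal.2 p.2⟩,
    ⟨p.1.1, rfl⟩, ⟨p.1.2, rfl⟩⟩
  invFun x := ⟨(x.2.1.1, x.2.2.1), by
    rw [x.2.1.2, x.2.2.2]; exact Finset.HasAntidiagonal.mem_antidiagonal.1 x.1.2⟩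
  left_inv p := rfl
  right_inv x := by
    obtain ⟨⟨⟨m, k⟩, h⟩, ⟨i, hi⟩, ⟨j, hj⟩⟩ := x
    change a i = m at hi
    change b j = k at hj
    subst hi hj
    rfl

theorem finite_prodFiber {I J : Type*} {a : I → ℕ} {b : J → ℕ}
    (ha : ∀ n, Finite {i // a i = n}) (hb : ∀ n, Finite {j // b j = n}) (n : ℕ) :
    Finite {p : I × J // a p.1 + b p.2 = n} :=
  Finite.of_equiv _ (prodFiberEquiv a b n).symm

theorem wtSeries_prod {I J : Type*} {a : I → ℕ} {b : J → ℕ}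
    (ha : ∀ n, Finite {i // a i = n}) (hb : ∀ n, Finite {j // b j = n}) :
    wtSeries (fun p : I × J => a p.1 + b p.2) = wtSeries a * wtSeries b := by
  ext n
  rw [PowerSeries.coeff_mul, coeff_wtSeries, Nat.card_congr (prodFiberEquiv a b n), Nat.card_sigma,
    ← Finset.sum_coe_sort (Finset.HasAntidiagonal.antidiagonal n)]
  simp [coeff_wtSeries, Nat.card_prod]

theorem finite_mulFiber {w : ℕ} (hw : 0 < w) (n : ℕ) : Finite {μ : ℕ // w * μ = n} :=
  have : Subsingleton {μ : ℕ // w * μ = n} := ⟨fun x y => Subtype.ext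
    (Nat.eq_of_mul_eq_mul_left hw (x.2.trans y.2.symm))⟩
  inferInstance

theorem wtSeries_nat {w : ℕ} (hw : 0 < w) :
    wtSeries (fun μ : ℕ => w * μ) * (1 - PowerSeries.X ^ w) = 1 := by
  have hc : ∀ n, PowerSeries.coeff n (wtSeries (fun μ : ℕ => w * μ)) = if w ∣ n then 1 else 0 := by
    intro n
    rw [coeff_wtSeries]
    split_ifs with h
    · obtain ⟨k, rfl⟩ := h
      have h1 : Subsingleton {μ : ℕ // w * μ = w * k} := ⟨fun x y => Subtype.ext
        (Nat.eq_of_mul_eq_mul_left hw (x.2.trans y.2.symm))⟩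
      have h2 : Nonempty {μ : ℕ // w * μ = w * k} := ⟨⟨k, rfl⟩⟩
      rw [Nat.card_eq_one_iff_unique.2 ⟨h1, h2⟩, Nat.cast_one]
    · have : IsEmpty {μ : ℕ // w * μ = n} := ⟨fun x => h ⟨x.1, x.2.symm⟩⟩
      simp
  ext n
  rw [mul_sub, mul_one, map_sub, PowerSeries.coeff_mul_X_pow', hc, PowerSeries.coeff_one]
  by_cases hn : n = 0
  · subst hn; simp [hw.ne']
  · by_cases hwn : w ≤ n
    · rw [if_pos hwn, hc, if_neg hn]
      have : w ∣ n - w ↔ w ∣ n := by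
        rw [Nat.dvd_sub_self_right]
        exact ⟨fun h => h.elim id fun h => by rw [le_antisymm hwn h], Or.inl⟩
      simp [this]
    · rw [if_neg hwn, if_neg hn, if_neg fun h => hwn (Nat.le_of_dvd (by omega) h), sub_zero]

theorem finite_sumFiber_and_wtSeries {k : ℕ} (w : Fin k → ℕ) (hw : ∀ i, 0 < w i) :
    (∀ n, Finite {μ : Fin k → ℕ // ∑ i, w i * μ i = n}) ∧
    wtSeries (fun μ : Fin k → ℕ => ∑ i, w i * μ i) * ∏ i, (1 - PowerSeries.X ^ w i) = 1 := by
  induction k with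
  | zero =>
    refine ⟨fun n => inferInstance, ?_⟩
    ext n
    simp only [Finset.univ_eq_empty, Finset.sum_empty, Finset.prod_empty, mul_one, coeff_wtSeries,
      PowerSeries.coeff_one]
    by_cases hn : n = 0
    · subst hn; simp
    · have : IsEmpty {μ : Fin 0 → ℕ // 0 = n} := ⟨fun x => hn x.2.symm⟩
      simp [hn]
  | succ k ih =>
    obtain ⟨h1, h2⟩ := ih (fun i => w i.succ) fun i => hw _
    have e : ∀ μ : ℕ × (Fin k → ℕ), ∑ i, w i * (Fin.consEquiv fun _ => ℕ) μ i
        = w 0 * μ.1 + ∑ i : Fin k, w i.succ * μ.2 i := by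
      intro μ; simp [Fin.sum_univ_succ]
    have hf := finite_prodFiber (finite_mulFiber (hw 0)) h1
    refine ⟨fun n => ?_, ?_⟩
    · exact Finite.of_equiv _ ((Fin.consEquiv fun _ => ℕ).subtypeEquiv (p := fun μ : ℕ × (Fin k → ℕ)
        => w 0 * μ.1 + ∑ i : Fin k, w i.succ * μ.2 i = n) (fun μ => by rw [← e]))
    · rw [← wtSeries_equiv (Fin.consEquiv fun _ => ℕ) e, wtSeries_prod (finite_mulFiber (hw 0)) h1,
        Fin.prod_univ_succ, mul_mul_mul_comm, wtSeries_nat (hw 0), one_mul, h2]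

theorem finite_sumFiber {k : ℕ} (w : Fin k → ℕ) (hw : ∀ i, 0 < w i) (n : ℕ) :
    Finite {μ : Fin k → ℕ // ∑ i, w i * μ i = n} := (finite_sumFiber_and_wtSeries w hw).1 n

theorem wtSeries_sum_mul {k : ℕ} (w : Fin k → ℕ) (hw : ∀ i, 0 < w i) :
    wtSeries (fun μ : Fin k → ℕ => ∑ i, w i * μ i) * ∏ i, (1 - PowerSeries.X ^ w i) = 1 :=
  (finite_sumFiber_and_wtSeries w hw).2

/-- The Hilbert series of the ring of symmetric polynomials in `k` variables. -/
def symSeries (k : ℕ) : PowerSeries ℚ :=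
  wtSeries fun μ : Fin k → ℕ => ∑ i : Fin k, ((i : ℕ) + 1) * μ i

theorem symSeries_mul_uu (k : ℕ) : symSeries k * uu k = 1 := by
  rw [uu, ← Fin.prod_univ_eq_prod_range (fun i => 1 - (PowerSeries.X : PowerSeries ℚ) ^ (i + 1)) k]
  exact wtSeries_sum_mul (fun i : Fin k => (i : ℕ) + 1) fun i => Nat.succ_pos _

theorem uu_ne_zero (k : ℕ) : uu k ≠ 0 := right_ne_zero_of_mul_eq_one (symSeries_mul_uu k)

/-- The sum `Σ_{i ≤ s} u^{i(r+1)}/(u;u)_i`. -/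
def dSeries (r s : ℕ) : PowerSeries ℚ :=
  ∑ i ∈ Finset.range (s + 1), PowerSeries.X ^ (i * (r + 1)) * symSeries i

theorem uu_eq_mul_Ico {i s : ℕ} (h : i ≤ s) :
    uu s = uu i * ∏ k ∈ Finset.Ico i s, (1 - PowerSeries.X ^ (k + 1)) := by
  rw [uu, uu, Finset.prod_range_mul_prod_Ico _ h]

theorem symSeries_mul_dSeries_mul (r s : ℕ) :
    symSeries r * dSeries r s * (uu r * uu s) =
      ∑ i ∈ Finset.range (s + 1), PowerSeries.X ^ (i * (r + 1)) *
        ∏ k ∈ Finset.Ico i s, (1 - PowerSeries.X ^ (k + 1)) := by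
  have : symSeries r * dSeries r s * (uu r * uu s) =
    (symSeries r * uu r) * (dSeries r s * uu s) := by ring
  rw [this, symSeries_mul_uu, one_mul, dSeries, Finset.sum_mul]
  refine Finset.sum_congr rfl fun i hi => ?_
  rw [uu_eq_mul_Ico (Nat.lt_succ_iff.1 (Finset.mem_range.1 hi))]
  linear_combination PowerSeries.X ^ (i * (r + 1)) *
        (∏ k ∈ Finset.Ico i s, (1 - PowerSeries.X ^ (k + 1))) * symSeries_mul_uu i

/-- Gaussian binomial coefficients are polynomials. -/
theorem exists_uu_add (i n : ℕ) : ∃ p : Polynomial ℚ, uu (n + i) = uu i * uu n * p := by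
  induction i generalizing n with
  | zero => exact ⟨1, by simp [uu]⟩
  | succ i ihi =>
    induction n with
    | zero => exact ⟨1, by simp [uu]⟩
    | succ n ihn =>
      obtain ⟨p, hp⟩ := ihi (n + 1)
      obtain ⟨q, hq⟩ := ihn
      refine ⟨p + Polynomial.X ^ (i + 1) * q, ?_⟩
      have e1 : uu (n + 1 + (i + 1)) = uu (n + 1 + i) * (1 - PowerSeries.X ^ (n + 1 + i + 1)) := by
        rw [← add_assoc, uu, Finset.prod_range_succ, ← uu]
      have e2 : uu (i + 1) = uu i * (1 - PowerSeries.X ^ (i + 1)) := by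
        rw [uu, Finset.prod_range_succ, ← uu]
      have e3 : uu (n + 1) = uu n * (1 - PowerSeries.X ^ (n + 1)) := by
        rw [uu, Finset.prod_range_succ, ← uu]
      have e4 : n + (i + 1) = n + 1 + i := by ring
      rw [e4] at hq
      push_cast
      rw [e1]
      have : (1 - PowerSeries.X ^ (n + 1 + i + 1) : PowerSeries ℚ) = (1 - PowerSeries.X ^ (i + 1)) +
        PowerSeries.X ^ (i + 1) * (1 - PowerSeries.X ^ (n + 1)) := by ring
      rw [this, mul_add]
      nth_rewrite 1 [hp]
      rw [hq, e2, e3]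
      ring

/-- The series `dSeries r s` becomes a polynomial after multiplication with
`∏_{k<s} (1 - u^{r+1+k})`. -/
theorem exists_dSeries_mul (r s : ℕ) : ∃ p : Polynomial ℚ,
    dSeries r s * ∏ k ∈ Finset.range s, (1 - PowerSeries.X ^ (r + 1 + k)) = p := by
  have h : ∀ i ∈ Finset.range (s + 1), ∃ p : Polynomial ℚ, symSeries i *
      ∏ k ∈ Finset.range s, (1 - PowerSeries.X ^ (r + 1 + k)) = p := by
    intro i hi
    have hi : i ≤ s := Nat.lt_succ_iff.1 (Finset.mem_range.1 hi)
    obtain ⟨p, hp⟩ := exists_uu_add i r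
    refine ⟨p * ∏ k ∈ Finset.Ico (r + i) (r + s), (1 - Polynomial.X ^ (k + 1)), ?_⟩
    have h1 : uu (r + s) = uu r * ∏ k ∈ Finset.range s, (1 - PowerSeries.X ^ (r + 1 + k)) := by
      rw [uu, Finset.prod_range_add, ← uu]
      congr 1
      refine Finset.prod_congr rfl fun k _ => ?_
      rw [add_right_comm]
    have h2 := uu_eq_mul_Ico (show r + i ≤ r + s by omega)
    refine mul_left_cancel₀ (uu_ne_zero r) ?_
    have h3 : ((p * ∏ k ∈ Finset.Ico (r + i) (r + s), (1 - Polynomial.X ^ (k + 1)) :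
        Polynomial ℚ) : PowerSeries ℚ) = p * ∏ k ∈ Finset.Ico (r + i) (r + s),
          (1 - PowerSeries.X ^ (k + 1)) := by
      rw [← Polynomial.coeToPowerSeries.ringHom_apply, map_mul, map_prod]
      simp
    rw [h3, mul_left_comm, ← h1, h2, hp]
    linear_combination (uu r * p * ∏ k ∈ Finset.Ico (r + i) (r + s),
          (1 - PowerSeries.X ^ (k + 1))) * symSeries_mul_uu i
  choose! p hp using h
  refine ⟨∑ i ∈ Finset.range (s + 1), Polynomial.X ^ (i * (r + 1)) * p i, ?_⟩
  rw [dSeries, Finset.sum_mul, ← Polynomial.coeToPowerSeries.ringHom_apply, map_sum]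
  refine Finset.sum_congr rfl fun i hi => ?_
  rw [mul_assoc, hp i hi]
  simp

section RegularSequences

variable {σ : Type*}

attribute [local instance] MvPolynomial.gradedAlgebra

/-- The elements `f a, ..., f (a + k - 1)` form a weakly regular sequence modulo the ideal `I`. -/
def RegIdeal (f : ℕ → MvPolynomial σ ℂ) : Ideal (MvPolynomial σ ℂ) → ℕ → ℕ → Prop
  | _, _, 0 => True
  | I, a, k + 1 => (∀ g, f a * g ∈ I → g ∈ I) ∧ RegIdeal f (I ⊔ Ideal.span {f a}) (a + 1) k

/-- The ideal generated by `I` and `f a, ..., f (a + k - 1)`. -/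
def addSeq (f : ℕ → MvPolynomial σ ℂ) :
    Ideal (MvPolynomial σ ℂ) → ℕ → ℕ → Ideal (MvPolynomial σ ℂ)
  | I, _, 0 => I
  | I, a, k + 1 => addSeq f (I ⊔ Ideal.span {f a}) (a + 1) k

theorem le_addSeq (f : ℕ → MvPolynomial σ ℂ) (I : Ideal (MvPolynomial σ ℂ)) (a k : ℕ) :
    I ≤ addSeq f I a k := by
  induction k generalizing I a with
  | zero => exact le_rfl
  | succ k ih => exact le_sup_left.trans (ih _ _)

theorem mem_addSeq (f : ℕ → MvPolynomial σ ℂ) (I : Ideal (MvPolynomial σ ℂ)) (a k i : ℕ)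
    (hi : i < k) : f (a + i) ∈ addSeq f I a k := by
  induction k generalizing I a i with
  | zero => omega
  | succ k ih =>
    rcases i with _ | i
    · exact le_addSeq f (I ⊔ Ideal.span {f a}) (a + 1) k
        (Ideal.mem_sup_right (Ideal.mem_span_singleton_self _))
    · have := ih (I ⊔ Ideal.span {f a}) (a + 1) i (by omega)
      rwa [add_assoc, add_comm 1] at this

theorem RegIdeal.append {f : ℕ → MvPolynomial σ ℂ} {I : Ideal (MvPolynomial σ ℂ)} {a k : ℕ}
    (h : RegIdeal f I a k) (h' : ∀ g, f (a + k) * g ∈ addSeq f I a k → g ∈ addSeq f I a k) :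
    RegIdeal f I a (k + 1) := by
  induction k generalizing I a with
  | zero => exact ⟨h', trivial⟩
  | succ k ih =>
    refine ⟨h.1, ih h.2 ?_⟩
    rwa [add_assoc, add_comm 1]

theorem mem_sup_span_singleton' {I : Ideal (MvPolynomial σ ℂ)} {x g : MvPolynomial σ ℂ} :
    g ∈ I ⊔ Ideal.span {x} ↔ ∃ i ∈ I, ∃ h, g = i + x * h := by
  rw [Submodule.mem_sup]
  constructor
  · rintro ⟨i, hi, y, hy, rfl⟩
    obtain ⟨h, rfl⟩ := Ideal.mem_span_singleton'.1 hy
    exact ⟨i, hi, h, by rw [mul_comm]⟩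
  · rintro ⟨i, hi, h, rfl⟩
    exact ⟨i, hi, x * h, Ideal.mul_mem_right _ _ (Ideal.mem_span_singleton_self x), rfl⟩

theorem isHomogeneous_sup_span {I : Ideal (MvPolynomial σ ℂ)}
    (hI : I.IsHomogeneous (homogeneousSubmodule σ ℂ)) {y : MvPolynomial σ ℂ} {e : ℕ}
    (hy : y.IsHomogeneous e) :
    (I ⊔ Ideal.span {y}).IsHomogeneous (homogeneousSubmodule σ ℂ) := by
  refine hI.sup (Ideal.homogeneous_span _ _ ?_)
  rintro x rfl
  exact ⟨e, hy⟩

theorem homogeneousComponent_pow_mul {x : MvPolynomial σ ℂ} {e : ℕ} (he : 0 < e)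
    (hx : x.IsHomogeneous e) (h : MvPolynomial σ ℂ) {n d : ℕ} (hd : d < n) :
    homogeneousComponent d (x ^ n * h) = 0 := by
  rw [← sum_homogeneousComponent h, Finset.mul_sum, map_sum]
  refine Finset.sum_eq_zero fun i _ => ?_
  have h1 : (x ^ n * homogeneousComponent i h).IsHomogeneous (e * n + i) :=
    (hx.pow n).mul (homogeneousComponent_isHomogeneous i h)
  rw [homogeneousComponent_of_mem h1, if_neg]
  nlinarith

/-- A weak form of Krull's intersection theorem for graded ideals. -/
theorem mem_of_forall_mem_sup_pow {I : Ideal (MvPolynomial σ ℂ)}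
    (hI : I.IsHomogeneous (homogeneousSubmodule σ ℂ)) {x : MvPolynomial σ ℂ} {e : ℕ} (he : 0 < e)
    (hx : x.IsHomogeneous e) {g : MvPolynomial σ ℂ} (hg : ∀ n, g ∈ I ⊔ Ideal.span {x ^ n}) :
    g ∈ I := by
  rw [← sum_homogeneousComponent g]
  refine Ideal.sum_mem _ fun d _ => ?_
  obtain ⟨i, hi, h, rfl⟩ := mem_sup_span_singleton'.1 (hg (d + 1))
  rw [map_add, homogeneousComponent_pow_mul he hx _ (Nat.lt_succ_self d), add_zero]
  exact homogeneousComponent_mem_of_mem hI hi _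

theorem swap_nonZeroDivisor {I : Ideal (MvPolynomial σ ℂ)}
    (hI : I.IsHomogeneous (homogeneousSubmodule σ ℂ)) {x y : MvPolynomial σ ℂ} {e : ℕ}
    (he : 0 < e) (hx : x.IsHomogeneous e) (h1 : ∀ g, x * g ∈ I → g ∈ I)
    (h2 : ∀ g, y * g ∈ I ⊔ Ideal.span {x} → g ∈ I ⊔ Ideal.span {x}) :
    (∀ g, y * g ∈ I → g ∈ I) ∧
      ∀ g, x * g ∈ I ⊔ Ideal.span {y} → g ∈ I ⊔ Ideal.span {y} := by
  have hy : ∀ g, y * g ∈ I → g ∈ I := by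
    intro g hg
    refine mem_of_forall_mem_sup_pow hI he hx fun n => ?_
    induction n generalizing g with
    | zero => simp
    | succ n ih =>
      obtain ⟨i, hi, h, rfl⟩ := mem_sup_span_singleton'.1 (h2 g (Ideal.mem_sup_left hg))
      have h3 : y * h ∈ I := h1 _ (by
        have : x * (y * h) = y * (i + x * h) - y * i := by ring
        rw [this]
        exact I.sub_mem hg (I.mul_mem_left _ hi))
      obtain ⟨i', hi', h', e'⟩ := mem_sup_span_singleton'.1 (ih h h3)
      exact mem_sup_span_singleton'.2 ⟨i + x * i', I.add_mem hi (I.mul_mem_left _ hi'), h', by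
        rw [e']; ring⟩
  refine ⟨hy, fun g hg => ?_⟩
  obtain ⟨i, hi, h, e1⟩ := mem_sup_span_singleton'.1 hg
  have h3 : h ∈ I ⊔ Ideal.span {x} := h2 _ (mem_sup_span_singleton'.2 ⟨-i, I.neg_mem hi, g, by
    rw [e1]; ring⟩)
  obtain ⟨i', hi', h', rfl⟩ := mem_sup_span_singleton'.1 h3
  refine mem_sup_span_singleton'.2 ⟨g - y * h', h1 _ ?_, h', by ring⟩
  have : x * (g - y * h') = i + y * i' := by linear_combination e1
  rw [this]
  exact I.add_mem hi (I.mul_mem_left _ hi')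

theorem RegIdeal.rotate {f : ℕ → MvPolynomial σ ℂ} {I : Ideal (MvPolynomial σ ℂ)} {a k : ℕ}
    (hI : I.IsHomogeneous (homogeneousSubmodule σ ℂ)) (hf : ∀ n, (f n).IsHomogeneous n)
    {x : MvPolynomial σ ℂ} {e : ℕ} (he : 0 < e) (hx : x.IsHomogeneous e)
    (h1 : ∀ g, x * g ∈ I → g ∈ I) (h2 : RegIdeal f (I ⊔ Ideal.span {x}) a k) :
    RegIdeal f I a k ∧ ∀ g, x * g ∈ addSeq f I a k → g ∈ addSeq f I a k := by
  induction k generalizing I a with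
  | zero => exact ⟨trivial, h1⟩
  | succ k ih =>
    obtain ⟨h3, h4⟩ := swap_nonZeroDivisor hI he hx h1 h2.1
    have := h2.2
    rw [sup_right_comm] at this
    obtain ⟨h5, h6⟩ := ih (isHomogeneous_sup_span hI (hf a)) h4 this
    exact ⟨⟨h3, h5⟩, h6⟩

theorem RegIdeal.congr {f f' : ℕ → MvPolynomial σ ℂ} {I : Ideal (MvPolynomial σ ℂ)} {a k : ℕ}
    (hf : ∀ n, a ≤ n → f' n - f n ∈ I) (h : RegIdeal f I a k) : RegIdeal f' I a k := by
  induction k generalizing I a with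
  | zero => trivial
  | succ k ih =>
    have ha := hf a le_rfl
    refine ⟨fun g hg => h.1 g ?_, ?_⟩
    · have : f a * g = f' a * g - (f' a - f a) * g := by ring
      rw [this]
      exact I.sub_mem hg (I.mul_mem_right _ ha)
    · have e : I ⊔ Ideal.span {f' a} = I ⊔ Ideal.span {f a} := by
        refine le_antisymm (sup_le le_sup_left ?_) (sup_le le_sup_left ?_)
        · rw [Ideal.span_singleton_le_iff_mem]
          exact mem_sup_span_singleton'.2 ⟨_, ha, 1, by ring⟩
        · rw [Ideal.span_singleton_le_iff_mem]
          exact mem_sup_span_singleton'.2 ⟨_, I.neg_mem ha, 1, by ring⟩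
      rw [e]
      exact ih (fun n hn => Ideal.mem_sup_left (hf n (by omega))) h.2

open Classical in
/-- The substitution `X j ↦ 0`. -/
def killVar (j : σ) : MvPolynomial σ ℂ →ₐ[ℂ] MvPolynomial σ ℂ :=
  aeval fun i => if i = j then 0 else X i

theorem sub_killVar_mem (j : σ) (g : MvPolynomial σ ℂ) : g - killVar j g ∈ Ideal.span {X j} := by
  rw [← Ideal.Quotient.eq]
  have : (Ideal.Quotient.mkₐ ℂ (Ideal.span {(X j : MvPolynomial σ ℂ)})) =
      (Ideal.Quotient.mkₐ ℂ (Ideal.span {(X j : MvPolynomial σ ℂ)})).comp (killVar j) := by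
    ext i
    simp only [AlgHom.comp_apply, killVar, aeval_X]
    split_ifs with h
    · subst h
      rw [map_zero]
      exact Ideal.Quotient.eq_zero_iff_mem.2 (Ideal.mem_span_singleton_self _)
    · rfl
  exact DFunLike.congr_fun this g

theorem RegIdeal.sup_span_X {f : ℕ → MvPolynomial σ ℂ} {I : Ideal (MvPolynomial σ ℂ)} {a k : ℕ}
    (j : σ) (hf : ∀ n, killVar j (f n) = f n) (hI : ∀ g ∈ I, killVar j g ∈ I)
    (h : RegIdeal f I a k) : RegIdeal f (I ⊔ Ideal.span {X j}) a k := by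
  induction k generalizing I a with
  | zero => trivial
  | succ k ih =>
    refine ⟨fun g hg => ?_, ?_⟩
    · obtain ⟨i, hi, u, e⟩ := mem_sup_span_singleton'.1 hg
      have e2 := congrArg (killVar j) e
      rw [map_mul, map_add, map_mul, hf] at e2
      have hX : killVar j (X j : MvPolynomial σ ℂ) = 0 := by simp [killVar]
      rw [hX, zero_mul, add_zero] at e2
      have h3 : killVar j g ∈ I := h.1 _ (e2 ▸ hI i hi)
      have : g = killVar j g + (g - killVar j g) := by ring
      rw [this]
      exact Ideal.add_mem _ (Ideal.mem_sup_left h3) (Ideal.mem_sup_right (sub_killVar_mem j g))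
    · rw [sup_right_comm]
      refine ih (fun g hg => ?_) h.2
      obtain ⟨i, hi, u, rfl⟩ := mem_sup_span_singleton'.1 hg
      rw [map_add, map_mul, hf]
      exact mem_sup_span_singleton'.2 ⟨_, hI i hi, _, rfl⟩

/-- The power sum of the variables in `V`. -/
def psumOn (V : Finset σ) (n : ℕ) : MvPolynomial σ ℂ := ∑ j ∈ V, X j ^ n

theorem psumOn_isHomogeneous (V : Finset σ) (n : ℕ) : (psumOn V n).IsHomogeneous n :=
  IsHomogeneous.sum _ _ _ fun j _ => isHomogeneous_X_pow j n

open Classical in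
theorem psumOn_newton (V : Finset σ) : ∃ c : ℕ → MvPolynomial σ ℂ,
    c 0 = ∏ j ∈ V, (-X j) ∧
      ∀ k, psumOn V (k + V.card) + ∑ i ∈ Finset.range V.card, c i * psumOn V (k + i) = 0 := by
  let Q : Polynomial (MvPolynomial σ ℂ) := ∏ j ∈ V, (Polynomial.X - Polynomial.C (X j))
  have hQ : Q.Monic := Polynomial.monic_prod_of_monic _ _ fun j _ => Polynomial.monic_X_sub_C _
  have hd : Q.natDegree = V.card := by
    simp [Q]
  refine ⟨Q.coeff, ?_, fun k => ?_⟩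
  · rw [Polynomial.coeff_zero_eq_eval_zero]
    simp [Q, Polynomial.eval_prod]
  · have h : ∀ j ∈ V, X j ^ (k + V.card) + ∑ i ∈ Finset.range V.card, Q.coeff i * X j ^ (k + i) =
        0 := by
      intro j hj
      have h0 : Q.eval (X j) = 0 := by
        rw [Polynomial.eval_prod]
        exact Finset.prod_eq_zero hj (by simp)
      rw [Polynomial.eval_eq_sum_range, Finset.sum_range_succ, hQ.coeff_natDegree, hd] at h0
      have := congrArg (X j ^ k * ·) h0
      simp only [mul_zero] at this
      rw [← this, mul_add, Finset.mul_sum, add_comm, pow_add, one_mul]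
      congr 1
      refine Finset.sum_congr rfl fun i _ => ?_
      rw [pow_add]; ring
    simp only [psumOn, Finset.mul_sum]
    rw [Finset.sum_comm, ← Finset.sum_add_distrib]
    exact Finset.sum_eq_zero h

open Classical in
theorem regIdeal_psumOn (V : Finset σ) (k : ℕ) : RegIdeal (psumOn V) ⊥ (k + 1) V.card := by
  induction hn : V.card generalizing V k with
  | zero => trivial
  | succ n ihV =>
    have hbot : (⊥ : Ideal (MvPolynomial σ ℂ)).IsHomogeneous (homogeneousSubmodule σ ℂ) :=
      Ideal.IsHomogeneous.bot _
    have h1 : ∀ k, ∀ j ∈ V, RegIdeal (psumOn V) ⊥ (k + 1) n ∧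
        ∀ g, X j * g ∈ addSeq (psumOn V) ⊥ (k + 1) n → g ∈ addSeq (psumOn V) ⊥ (k + 1) n := by
      intro k j hj
      refine RegIdeal.rotate hbot (psumOn_isHomogeneous V) one_pos (isHomogeneous_X ℂ j) ?_ ?_
      · intro g hg
        rw [Ideal.mem_bot] at hg ⊢
        exact (mul_eq_zero.1 hg).resolve_left (X_ne_zero j)
      · have h2 := (ihV (V.erase j) k (by rw [Finset.card_erase_of_mem hj, hn]; rfl)).sup_span_X j
          (fun m => by
            simp only [psumOn, map_sum, map_pow]
            refine Finset.sum_congr rfl fun i hi => ?_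
            simp [killVar, Finset.ne_of_mem_erase hi])
          (fun g hg => by rw [Ideal.mem_bot] at hg ⊢; rw [hg, map_zero])
        refine h2.congr fun m hm => Ideal.mem_sup_right ?_
        rw [psumOn, psumOn, ← Finset.add_sum_erase V _ hj, add_sub_cancel_right]
        exact Ideal.pow_mem_of_mem _ (Ideal.mem_span_singleton_self _) _ (by omega)
    have h2 : ∀ k, (∀ g, psumOn V k * g ∈ addSeq (psumOn V) ⊥ (k + 1) n →
        g ∈ addSeq (psumOn V) ⊥ (k + 1) n) → RegIdeal (psumOn V) ⊥ (k + 1) (n + 1) := by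
      intro k hk
      obtain ⟨j₀, hj₀⟩ : V.Nonempty := Finset.card_pos.1 (by omega)
      refine (h1 k j₀ hj₀).1.append fun g hg => ?_
      obtain ⟨c, hc0, hc⟩ := psumOn_newton V
      have hprod : ∀ W ⊆ V, ∀ g, (∏ j ∈ W, (-X j)) * g ∈ addSeq (psumOn V) ⊥ (k + 1) n →
          g ∈ addSeq (psumOn V) ⊥ (k + 1) n := by
        intro W
        induction W using Finset.induction_on with
        | empty => intro _ g hg; simpa using hg
        | insert j W hj ih =>
          intro hW g hg
          rw [Finset.prod_insert hj, mul_assoc] at hg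
          refine ih (fun x hx => hW (Finset.mem_insert_of_mem hx)) g
            ((h1 k j (hW (Finset.mem_insert_self _ _))).2 _ ?_)
          rw [← Ideal.neg_mem_iff, ← neg_mul]
          exact hg
      refine hk g (hprod V subset_rfl _ ?_)
      have h3 := hc k
      rw [hn, Finset.sum_range_succ'] at h3
      have h4 : (∏ j ∈ V, (-X j)) * (psumOn V k * g) = -(psumOn V (k + 1 + n) * g) -
          ∑ i ∈ Finset.range n, psumOn V (k + 1 + i) * (c (i + 1) * g) := by
        have h5 : ∑ i ∈ Finset.range n, psumOn V (k + 1 + i) * (c (i + 1) * g) =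
            (∑ i ∈ Finset.range n, c (i + 1) * psumOn V (k + (i + 1))) * g := by
          rw [Finset.sum_mul]
          refine Finset.sum_congr rfl fun i _ => ?_
          rw [show k + 1 + i = k + (i + 1) by ring]
          ring
        rw [h5, ← hc0, show k + 1 + n = k + (n + 1) by ring]
        linear_combination g * h3
      rw [h4]
      refine Ideal.sub_mem _ (Ideal.neg_mem_iff _ |>.2 hg) (Ideal.sum_mem _ fun i hi => ?_)
      exact Ideal.mul_mem_right _ _ (mem_addSeq _ _ _ _ _ (Finset.mem_range.1 hi))
    induction k with
    | zero =>
      refine h2 0 fun g hg => ?_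
      have : psumOn V 0 * g = C ((n : ℂ) + 1) * g := by
        simp [psumOn, hn]
      rw [this] at hg
      have h3 := Ideal.mul_mem_left _ (C ((n : ℂ) + 1)⁻¹) hg
      rwa [← mul_assoc, ← C_mul, inv_mul_cancel₀ (Nat.cast_add_one_ne_zero n), C_1, one_mul] at h3
    | succ k ihk =>
      exact h2 (k + 1) (RegIdeal.rotate hbot (psumOn_isHomogeneous V) (Nat.succ_pos k)
        (psumOn_isHomogeneous V (k + 1)) ihk.1 ihk.2).2
end RegularSequences

section RegularOnSubspaces

variable {σ : Type*}

/-- Multiplication by `f a, ..., f (a + k - 1)` is a weakly regular sequence of operators on the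
quotient of the subspace `N` by `K`. -/
def RegSub (f : ℕ → MvPolynomial σ ℂ) (N : Submodule ℂ (MvPolynomial σ ℂ)) :
    Submodule ℂ (MvPolynomial σ ℂ) → ℕ → ℕ → Prop
  | _, _, 0 => True
  | K, a, k + 1 => (∀ g ∈ N, f a * g ∈ K → g ∈ K) ∧
      RegSub f N (K ⊔ N.map (LinearMap.mulLeft ℂ (f a))) (a + 1) k

theorem mem_sup_map_mulLeft {K N : Submodule ℂ (MvPolynomial σ ℂ)} {x y : MvPolynomial σ ℂ} :
    y ∈ K ⊔ N.map (LinearMap.mulLeft ℂ x) ↔ ∃ i ∈ K, ∃ g ∈ N, y = i + x * g := by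
  rw [Submodule.mem_sup]
  constructor
  · rintro ⟨i, hi, y, ⟨g, hg, rfl⟩, rfl⟩
    exact ⟨i, hi, g, hg, rfl⟩
  · rintro ⟨i, hi, g, hg, rfl⟩
    exact ⟨i, hi, x * g, ⟨g, hg, rfl⟩, rfl⟩

theorem RegIdeal.regSub {f : ℕ → MvPolynomial σ ℂ} {I : Ideal (MvPolynomial σ ℂ)} {a k : ℕ}
    (h : RegIdeal f I a k) : RegSub f ⊤ (I.restrictScalars ℂ) a k := by
  induction k generalizing I a with
  | zero => trivial
  | succ k ih =>
    refine ⟨fun g _ hg => h.1 g hg, ?_⟩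
    convert ih h.2 using 1
    ext y
    rw [mem_sup_map_mulLeft, Submodule.restrictScalars_mem, mem_sup_span_singleton']
    simp

theorem RegSub.retract {f : ℕ → MvPolynomial σ ℂ} {N K : Submodule ℂ (MvPolynomial σ ℂ)}
    {a k : ℕ} (π : MvPolynomial σ ℂ →ₗ[ℂ] MvPolynomial σ ℂ) (h1 : ∀ g, π g ∈ N)
    (h2 : ∀ g ∈ N, π g = g) (h3 : ∀ n g, π (f n * g) = f n * π g) (hK : ∀ g ∈ K, π g ∈ K)
    (h : RegSub f ⊤ K a k) : RegSub f N (K ⊓ N) a k := by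
  induction k generalizing K a with
  | zero => trivial
  | succ k ih =>
    refine ⟨fun g hg hg' => ⟨h.1 g trivial hg'.1, hg⟩, ?_⟩
    have := ih (fun g hg => ?_) h.2
    · convert this using 1
      refine le_antisymm ?_ ?_
      · intro y hy
        obtain ⟨i, hi, g, hg, rfl⟩ := mem_sup_map_mulLeft.1 hy
        refine ⟨mem_sup_map_mulLeft.2 ⟨i, hi.1, g, trivial, rfl⟩, N.add_mem hi.2 ?_⟩
        rw [← h2 g hg, ← h3]
        exact h1 _
      · rintro y ⟨hy, hyN⟩
        obtain ⟨i, hi, g, -, rfl⟩ := mem_sup_map_mulLeft.1 hy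
        refine mem_sup_map_mulLeft.2 ⟨π i, ⟨hK i hi, h1 i⟩, π g, h1 g, ?_⟩
        rw [← h3, ← map_add, h2 _ hyN]
    · obtain ⟨i, hi, g, -, rfl⟩ := mem_sup_map_mulLeft.1 hg
      exact mem_sup_map_mulLeft.2 ⟨π i, hK i hi, π g, trivial, by rw [map_add, h3]⟩

theorem RegSub.of_exact {f f' : ℕ → MvPolynomial σ ℂ}
    {N N' N'' K : Submodule ℂ (MvPolynomial σ ℂ)} {a k : ℕ}
    (π : MvPolynomial σ ℂ →ₗ[ℂ] MvPolynomial σ ℂ) (hN : N' ≤ N)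
    (hπ : N.map π = N'') (hker : ∀ g ∈ N, π g = 0 ↔ g ∈ N')
    (hf : ∀ n, a ≤ n → ∀ g, π (f n * g) = f' n * π g) (hstab : ∀ n, a ≤ n → ∀ g ∈ N, f n * g ∈ N)
    (hKN : K ≤ N) (hK : ∀ n, a ≤ n → ∀ g ∈ K, f n * g ∈ K)
    (h : RegSub f N K a (k + 1)) (h'' : RegSub f' N'' (K.map π) a k) :
    RegSub f N' (K ⊓ N') a (k + 1) := by
  induction k generalizing K a with
  | zero => exact ⟨fun g hg hg' => ⟨h.1 g (hN hg) hg'.1, hg⟩, trivial⟩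
  | succ k ih =>
    refine ⟨fun g hg hg' => ⟨h.1 g (hN hg) hg'.1, hg⟩, ?_⟩
    have hK1 : (K ⊔ N.map (LinearMap.mulLeft ℂ (f a))).map π =
        K.map π ⊔ N''.map (LinearMap.mulLeft ℂ (f' a)) := by
      rw [Submodule.map_sup, ← hπ, ← Submodule.map_comp, ← Submodule.map_comp]
      congr 2
      exact LinearMap.ext fun g => hf a le_rfl g
    have key := ih (K := K ⊔ N.map (LinearMap.mulLeft ℂ (f a))) (a := a + 1)
      (fun n hn => hf n (by omega)) (fun n hn => hstab n (by omega)) ?_ ?_ h.2 (hK1 ▸ h''.2)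
    · convert key using 1
      refine le_antisymm ?_ ?_
      · intro y hy
        obtain ⟨i, hi, g, hg, rfl⟩ := mem_sup_map_mulLeft.1 hy
        refine ⟨mem_sup_map_mulLeft.2 ⟨i, hi.1, g, hN hg, rfl⟩, N'.add_mem hi.2 ?_⟩
        rw [← hker _ (hstab a le_rfl g (hN hg)), hf a le_rfl, (hker g (hN hg)).2 hg, mul_zero]
      · rintro y ⟨hy, hyN⟩
        obtain ⟨i, hi, g, hg, rfl⟩ := mem_sup_map_mulLeft.1 hy
        have e1 := (hker _ (hN hyN)).2 hyN
        rw [map_add, hf a le_rfl] at e1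
        obtain ⟨i', hi', e2⟩ := h''.1 (π g) (hπ ▸ ⟨g, hg, rfl⟩)
          (by rw [eq_neg_of_add_eq_zero_right e1]; exact neg_mem ⟨i, hi, rfl⟩)
        have hg' : g - i' ∈ N' := by
          rw [← hker _ (N.sub_mem hg (hKN hi')), map_sub, e2, sub_self]
        have h5 : f a * (g - i') ∈ N' := by
          rw [← hker _ (hstab a le_rfl _ (hN hg')), hf a le_rfl, (hker _ (hN hg')).2 hg', mul_zero]
        refine mem_sup_map_mulLeft.2 ⟨i + f a * i', ⟨K.add_mem hi (hK _ le_rfl _ hi'), ?_⟩, _, hg',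
          by ring⟩
        have : i + f a * i' = (i + f a * g) - f a * (g - i') := by ring
        rw [this]
        exact N'.sub_mem hyN h5
    · refine sup_le hKN ?_
      rintro _ ⟨g, hg, rfl⟩
      exact hstab a le_rfl g hg
    · intro n hn y hy
      obtain ⟨i, hi, g, hg, rfl⟩ := mem_sup_map_mulLeft.1 hy
      exact mem_sup_map_mulLeft.2 ⟨_, hK n (by omega) i hi, _, hstab n (by omega) g hg, by ring⟩

/-- Polynomials all of whose exponents lie in `A`. -/
def exponentsIn (A : Set (σ →₀ ℕ)) : Submodule ℂ (MvPolynomial σ ℂ) where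
  carrier := {f | ∀ d, d ∉ A → coeff d f = 0}
  zero_mem' := fun d _ => coeff_zero d
  add_mem' := fun hf hg d hd => by rw [coeff_add, hf d hd, hg d hd, add_zero]
  smul_mem' := fun c f hf d hd => by rw [coeff_smul, hf d hd, smul_zero]

theorem monomial_mul_mem_exponentsIn {A B : Set (σ →₀ ℕ)} {f : MvPolynomial σ ℂ} {e : σ →₀ ℕ}
    (h : ∀ d ∈ A, e + d ∈ B) (hf : f ∈ exponentsIn A) : monomial e 1 * f ∈ exponentsIn B := by
  intro d hd
  rw [coeff_monomial_mul']
  split_ifs with hle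
  · rw [hf, mul_zero]
    intro h'
    apply hd
    have := h _ h'
    rwa [add_tsub_cancel_of_le hle] at this
  · rfl

open Classical in
/-- The projection to the span of the monomials with exponents in `A`. -/
def exponentsProj (A : Set (σ →₀ ℕ)) : MvPolynomial σ ℂ →ₗ[ℂ] MvPolynomial σ ℂ :=
  (basisMonomials σ ℂ).constr ℂ fun d => if d ∈ A then monomial d 1 else 0

open Classical in
theorem exponentsProj_monomial (A : Set (σ →₀ ℕ)) (d : σ →₀ ℕ) :
    exponentsProj A (monomial d 1) = if d ∈ A then monomial d 1 else 0 := by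
  have := (basisMonomials σ ℂ).constr_basis ℂ
    (fun d => if d ∈ A then (monomial d 1 : MvPolynomial σ ℂ) else 0) d
  rwa [coe_basisMonomials] at this

open Classical in
theorem coeff_exponentsProj (A : Set (σ →₀ ℕ)) (f : MvPolynomial σ ℂ) (e : σ →₀ ℕ) :
    coeff e (exponentsProj A f) = if e ∈ A then coeff e f else 0 := by
  have : (lcoeff ℂ e) ∘ₗ exponentsProj A =
      if e ∈ A then lcoeff ℂ e else 0 := by
    refine (basisMonomials σ ℂ).ext fun d => ?_
    rw [coe_basisMonomials, LinearMap.comp_apply, exponentsProj_monomial]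
    by_cases hd : d = e
    · subst hd; split_ifs <;> simp
    · split_ifs <;> simp [coeff_monomial, hd]
  have h := LinearMap.congr_fun this f
  split_ifs at h ⊢ <;> exact h

open Classical in
/-- Extraction of the coefficient of `X j ^ m`. -/
def extractVar (j : σ) (m : ℕ) : MvPolynomial σ ℂ →ₗ[ℂ] MvPolynomial σ ℂ :=
  (basisMonomials σ ℂ).constr ℂ fun d => if d j = m then monomial (d.erase j) 1 else 0

open Classical in
theorem extractVar_monomial (j : σ) (m : ℕ) (d : σ →₀ ℕ) :
    extractVar j m (monomial d 1) = if d j = m then monomial (d.erase j) 1 else 0 := by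
  have := (basisMonomials σ ℂ).constr_basis ℂ
    (fun d => if d j = m then (monomial (d.erase j) 1 : MvPolynomial σ ℂ) else 0) d
  rwa [coe_basisMonomials] at this

open Classical in
theorem coeff_extractVar (j : σ) (m : ℕ) (f : MvPolynomial σ ℂ) (e : σ →₀ ℕ) :
    coeff e (extractVar j m f) = if e j = 0 then coeff (e + Finsupp.single j m) f else 0 := by
  have : (lcoeff ℂ e) ∘ₗ extractVar j m =
      if e j = 0 then lcoeff ℂ (e + Finsupp.single j m) else 0 := by
    refine (basisMonomials σ ℂ).ext fun d => ?_
    rw [coe_basisMonomials, LinearMap.comp_apply, extractVar_monomial]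
    by_cases hd : d = e + Finsupp.single j m
    · subst hd
      by_cases he : e j = 0
      · have : (e + Finsupp.single j m).erase j = e := by
          ext i
          by_cases hij : i = j
          · subst hij; simp [he]
          · simp [Finsupp.erase_ne hij]
        simp [he, this]
      · simp [he]
    · have : ¬ (d j = m ∧ e j = 0 ∧ d.erase j = e) := by
        rintro ⟨h1, h2, h3⟩
        apply hd
        rw [← h3, ← h1, Finsupp.erase_add_single]
      by_cases h1 : d j = m <;> by_cases h2 : e j = 0
      · have h3 : d.erase j ≠ e := fun h => this ⟨h1, h2, h⟩
        simp [h1, h2, coeff_monomial, h3, hd]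
      · have h3 : d.erase j ≠ e := fun h => h2 (by rw [← h]; simp)
        simp [h1, h2, coeff_monomial, h3]
      · simp [h1, h2, coeff_monomial, hd]
      · simp [h1, h2]
  have h := LinearMap.congr_fun this f
  split_ifs at h ⊢ <;> exact h

theorem extractVar_X_pow_mul_self (j : σ) {m n : ℕ} (h : m < n) (f : MvPolynomial σ ℂ) :
    extractVar j m (X j ^ n * f) = 0 := by
  classical
  ext e
  rw [coeff_extractVar, coeff_zero]
  split_ifs with he
  · rw [X_pow_eq_monomial, coeff_monomial_mul', if_neg]
    intro h'
    have := h' j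
    simp [he] at this
    omega
  · rfl

theorem extractVar_X_pow_mul {i j : σ} (hij : i ≠ j) (m n : ℕ) (f : MvPolynomial σ ℂ) :
    extractVar j m (X i ^ n * f) = X i ^ n * extractVar j m f := by
  classical
  ext e
  rw [coeff_extractVar, X_pow_eq_monomial, coeff_monomial_mul', coeff_monomial_mul',
    coeff_extractVar]
  have h1 : Finsupp.single i n ≤ e + Finsupp.single j m ↔ Finsupp.single i n ≤ e := by
    simp [Finsupp.single_le_iff, hij]
  have h2 : (e - Finsupp.single i n) j = e j := by simp [hij]
  rw [h2]
  simp only [h1]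
  by_cases he : e j = 0
  · simp only [he, if_true]
    split_ifs with h3
    · congr 2
      ext l
      have := h3 l
      simp only [Finsupp.coe_add, Finsupp.coe_tsub, Pi.add_apply, Pi.sub_apply]
      omega
    · rfl
  · simp [he]

/-- Exponent vectors supported in `V` whose nonzero entries exceed `c`. -/
def gapExponents (V : Finset σ) (c : σ → ℕ) : Set (σ →₀ ℕ) :=
  {d | ∀ j, (j ∉ V → d j = 0) ∧ (j ∈ V → d j = 0 ∨ c j < d j)}

theorem psumOn_mul_mem {V : Finset σ} {c : σ → ℕ} {r n : ℕ} (hc : ∀ j ∈ V, c j ≤ r)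
    (hn : r < n) {g : MvPolynomial σ ℂ} (hg : g ∈ exponentsIn (gapExponents V c)) :
    psumOn V n * g ∈ exponentsIn (gapExponents V c) := by
  rw [psumOn, Finset.sum_mul]
  refine Submodule.sum_mem _ fun j hj => ?_
  rw [X_pow_eq_monomial]
  refine monomial_mul_mem_exponentsIn (fun d hd i => ?_) hg
  classical
  have := hd i
  by_cases hij : i = j
  · subst hij
    have := hc i hj
    refine ⟨fun h => absurd hj h, fun _ => Or.inr ?_⟩
    simp
    omega
  · simpa [hij] using hd i

theorem regSub_gapExponents_zero (V : Finset σ) (c : σ → ℕ) (hc : ∀ j ∈ V, c j = 0) (r : ℕ) :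
    RegSub (psumOn V) (exponentsIn (gapExponents V c)) ⊥ (r + 1) V.card := by
  classical
  have h := RegSub.retract (f := psumOn V) (N := exponentsIn (gapExponents V c))
    (exponentsProj (gapExponents V c))
    (fun g d hd => by rw [coeff_exponentsProj, if_neg hd])
    (fun g hg => by
      ext d
      rw [coeff_exponentsProj]
      split_ifs with hd
      · rfl
      · rw [hg d hd])
    (fun n g => by
      rw [psumOn, Finset.sum_mul, Finset.sum_mul, map_sum]
      refine Finset.sum_congr rfl fun j hj => ?_
      ext d
      rw [coeff_exponentsProj, X_pow_eq_monomial, coeff_monomial_mul', coeff_monomial_mul',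
        coeff_exponentsProj]
      have : d - Finsupp.single j n ∈ gapExponents V c ↔ d ∈ gapExponents V c := by
        refine forall_congr' fun i => ?_
        by_cases hi : i ∈ V
        · simp only [hi, not_true_eq_false, false_imp_iff, true_and, true_imp_iff, hc i hi]
          omega
        · have hij : i ≠ j := fun h => hi (h ▸ hj)
          simp [hi, hij]
      simp only [this]
      split_ifs <;> simp)
    (fun g hg => by rw [(Submodule.mem_bot ℂ).1 hg, map_zero]; exact Submodule.zero_mem _)
    (regIdeal_psumOn V r).regSub
  convert h using 1
  ext x
  simp

theorem regSub_gapExponents (V : Finset σ) (c : σ → ℕ) (r : ℕ) (hc : ∀ j ∈ V, c j ≤ r) :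
    RegSub (psumOn V) (exponentsIn (gapExponents V c)) ⊥ (r + 1) V.card := by
  classical
  induction hn : V.card generalizing V c with
  | zero => trivial
  | succ n ihV =>
    induction hm : ∑ j ∈ V, c j generalizing c with
    | zero =>
      rw [← hn]
      exact regSub_gapExponents_zero V c (fun j hj => Finset.sum_eq_zero_iff.1 hm j hj) r
    | succ m ihc =>
      obtain ⟨j, hj, hcj⟩ : ∃ j ∈ V, c j ≠ 0 := by
        by_contra! h
        rw [Finset.sum_eq_zero h] at hm
        omega
      let c' : σ → ℕ := Function.update c j (c j - 1)
      have hc'j : c' j = c j - 1 := by simp [c']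
      have hc'i : ∀ i, i ≠ j → c' i = c i := fun i hi => by simp [c', hi]
      have hc' : ∀ i ∈ V, c' i ≤ r := by
        intro i hi
        have := hc i hi
        by_cases hij : i = j
        · subst hij; omega
        · rw [hc'i i hij]; exact this
      have hsum : ∑ i ∈ V, c' i = m := by
        rw [← Finset.add_sum_erase V _ hj] at hm ⊢
        have : 0 < c j := Nat.pos_of_ne_zero hcj
        rw [Finset.sum_congr rfl fun i hi => hc'i i (Finset.ne_of_mem_erase hi), hc'j]
        change c j - 1 + ∑ i ∈ V.erase j, c i = m
        omega
      have h1 := ihc c' hc' hsum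
      have h2 := ihV (V.erase j) c (fun i hi => hc i (Finset.mem_of_mem_erase hi))
        (by rw [Finset.card_erase_of_mem hj, hn]; rfl)
      have key := RegSub.of_exact (N' := exponentsIn (gapExponents V c))
        (N'' := exponentsIn (gapExponents (V.erase j) c)) (f' := psumOn (V.erase j))
        (extractVar j (c j)) ?_ ?_ ?_ ?_ ?_ bot_le ?_ h1 (by rw [Submodule.map_bot]; exact h2)
      · rwa [bot_inf_eq] at key
      · intro f hf d hd
        refine hf d fun h => hd fun i => ?_
        have := h i
        by_cases hij : i = j
        · subst hij; rw [hc'j]; exact ⟨this.1, fun hi => by have := this.2 hi; omega⟩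
        · rw [hc'i i hij]; exact this
      · refine le_antisymm ?_ ?_
        · rintro _ ⟨f, hf, rfl⟩ d hd
          rw [coeff_extractVar]
          split_ifs with hdj
          · refine hf _ fun h => hd fun i => ?_
            have := h i
            by_cases hij : i = j
            · subst hij; exact ⟨fun _ => hdj, fun _ => Or.inl hdj⟩
            · rw [hc'i i hij] at this
              simpa [hij] using this
          · rfl
        · intro g hg
          refine ⟨monomial (Finsupp.single j (c j)) 1 * g, monomial_mul_mem_exponentsIn
            (fun d hd i => ?_) hg, ?_⟩
          · have := hd i
            by_cases hij : i = j
            · subst hij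
              refine ⟨fun h => absurd hj h, fun _ => Or.inr ?_⟩
              rw [hc'j]
              simp
              omega
            · rw [hc'i i hij]
              simpa [hij] using this
          · ext e
            rw [coeff_extractVar, add_comm e, coeff_monomial_mul, one_mul]
            split_ifs with he
            · rfl
            · exact (hg e fun h => he ((h j).1 (by simp))).symm
      · intro g hg
        constructor
        · intro h0 d hd
          by_cases hd' : d ∈ gapExponents V c'
          · have hdj : d j = c j := by
              by_contra hne
              apply hd
              intro i
              have := hd' i
              by_cases hij : i = j
              · subst hij
                rw [hc'j] at this
                exact ⟨this.1, fun hi => by have := this.2 hi; omega⟩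
              · rw [hc'i i hij] at this; exact this
            have := congrArg (coeff (d.erase j)) h0
            rw [coeff_extractVar, if_pos (by simp), coeff_zero, ← hdj, Finsupp.erase_add_single]
              at this
            exact this
          · exact hg d hd'
        · intro hg'
          ext e
          rw [coeff_extractVar, coeff_zero]
          split_ifs with he
          · refine hg' _ fun h => ?_
            have := (h j).2 hj
            simp [he] at this
            exact hcj this
          · rfl
      · intro n hn g
        have := hc j hj
        rw [psumOn, psumOn, ← Finset.add_sum_erase V _ hj, add_mul, map_add,
          extractVar_X_pow_mul_self j (by omega), zero_add, Finset.sum_mul, Finset.sum_mul, map_sum]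
        exact Finset.sum_congr rfl fun i hi =>
          extractVar_X_pow_mul (Finset.ne_of_mem_erase hi) _ _ _
      · intro n hn g hg
        exact psumOn_mul_mem hc' (by omega) hg
      · intro n _ g hg
        rw [(Submodule.mem_bot ℂ).1 hg, mul_zero]
        exact Submodule.zero_mem _

end RegularOnSubspaces

section IndependenceFromRegularity

variable {σ : Type*}

/-- The subspace `K + f a N + ... + f (a + k - 1) N`. -/
def addSubSeq (f : ℕ → MvPolynomial σ ℂ) (N : Submodule ℂ (MvPolynomial σ ℂ)) :
    Submodule ℂ (MvPolynomial σ ℂ) → ℕ → ℕ → Submodule ℂ (MvPolynomial σ ℂ)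
  | K, _, 0 => K
  | K, a, k + 1 => addSubSeq f N (K ⊔ N.map (LinearMap.mulLeft ℂ (f a))) (a + 1) k

theorem addSubSeq_eq (f : ℕ → MvPolynomial σ ℂ) (N K : Submodule ℂ (MvPolynomial σ ℂ))
    (a k : ℕ) :
    addSubSeq f N K a k = K ⊔ ⨆ i ∈ Finset.range k, N.map (LinearMap.mulLeft ℂ (f (a + i))) := by
  induction k generalizing K a with
  | zero => simp [addSubSeq]
  | succ k ih =>
    rw [addSubSeq, ih, sup_assoc]
    congr 1
    refine le_antisymm (sup_le ?_ (iSup₂_le fun i hi => ?_)) (iSup₂_le fun i hi => ?_)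
    · exact le_iSup₂_of_le 0 (by simp) le_rfl
    · refine le_iSup₂_of_le (i + 1) (by simpa using hi) ?_
      rw [show a + (i + 1) = a + 1 + i by ring]
    · rcases i with _ | i
      · exact le_sup_left
      · refine le_sup_of_le_right (le_iSup₂_of_le i (by simpa using hi) ?_)
        rw [show a + (i + 1) = a + 1 + i by ring]

theorem linearIndependent_pow_mul {I : Type*} {N K : Submodule ℂ (MvPolynomial σ ℂ)}
    {x : MvPolynomial σ ℂ} (hx : ∀ g ∈ N, x * g ∈ K → g ∈ K) (hN : ∀ g ∈ N, x * g ∈ N)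
    {w : I → MvPolynomial σ ℂ} (hw : ∀ i, w i ∈ N)
    (h : LinearIndependent ℂ fun i => (K ⊔ N.map (LinearMap.mulLeft ℂ x)).mkQ (w i)) :
    LinearIndependent ℂ fun p : ℕ × I => K.mkQ (x ^ p.1 * w p.2) := by
  have hlc : ∀ c : I →₀ ℂ, Finsupp.linearCombination ℂ w c ∈ N := fun c => by
    rw [Finsupp.linearCombination_apply]
    exact N.sum_mem fun i _ => N.smul_mem _ (hw i)
  have hsum : ∀ (M : ℕ) (c : ℕ → I →₀ ℂ),
      ∑ m ∈ Finset.range M, x ^ m * Finsupp.linearCombination ℂ w (c m) ∈ N := by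
    intro M c
    refine N.sum_mem fun m _ => ?_
    induction m with
    | zero => simpa using hlc _
    | succ m ih =>
      have : ∀ m : ℕ, ∀ g ∈ N, x ^ m * g ∈ N := by
        intro m g hg
        induction m with
        | zero => simpa using hg
        | succ m ih => rw [pow_succ', mul_assoc]; exact hN _ ih
      exact this _ _ (hlc _)
  have key : ∀ (M : ℕ) (c : ℕ → I →₀ ℂ),
      ∑ m ∈ Finset.range M, x ^ m * Finsupp.linearCombination ℂ w (c m) ∈ K →
      ∀ m < M, c m = 0 := by
    intro M
    induction M with
    | zero => intro c _ m hm; omega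
    | succ M ih =>
      intro c hc
      have e : ∑ m ∈ Finset.range (M + 1), x ^ m * Finsupp.linearCombination ℂ w (c m) =
          Finsupp.linearCombination ℂ w (c 0) + x *
            ∑ m ∈ Finset.range M, x ^ m * Finsupp.linearCombination ℂ w (c (m + 1)) := by
        rw [Finset.sum_range_succ', Finset.mul_sum, add_comm, pow_zero, one_mul]
        congr 1
        exact Finset.sum_congr rfl fun m _ => by ring
      rw [e] at hc
      have h0 : c 0 = 0 := by
        refine linearIndependent_iff.1 h _ ?_
        have : Finsupp.linearCombination ℂ
          (fun i => (K ⊔ N.map (LinearMap.mulLeft ℂ x)).mkQ (w i)) (c 0) =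
          (K ⊔ N.map (LinearMap.mulLeft ℂ x)).mkQ (Finsupp.linearCombination ℂ w (c 0)) := by
          rw [Finsupp.apply_linearCombination]; rfl
        rw [this, Submodule.mkQ_apply, Submodule.Quotient.mk_eq_zero, mem_sup_map_mulLeft]
        exact ⟨_, hc, _, N.neg_mem (hsum M fun m => c (m + 1)), by ring⟩
      rw [h0, map_zero, zero_add] at hc
      intro m hm
      rcases m with _ | m
      · exact h0
      · exact ih (fun m => c (m + 1)) (hx _ (hsum M _) hc) m (by omega)
  refine linearIndependent_iff.2 fun l hl => ?_
  have e1 : Finsupp.linearCombination ℂ (fun p : ℕ × I => K.mkQ (x ^ p.1 * w p.2)) l =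
      K.mkQ (Finsupp.linearCombination ℂ (fun p : ℕ × I => x ^ p.1 * w p.2) l) := by
    rw [Finsupp.apply_linearCombination]; rfl
  rw [e1, Submodule.mkQ_apply, Submodule.Quotient.mk_eq_zero] at hl
  obtain ⟨M, hM⟩ : ∃ M, l.curry.support ⊆ Finset.range M :=
    ⟨l.curry.support.sup id + 1, fun m hm => Finset.mem_range.2
      (Nat.lt_succ_of_le (Finset.le_sup (f := id) hm))⟩
  have e2 : Finsupp.linearCombination ℂ (fun p : ℕ × I => x ^ p.1 * w p.2) l =
      ∑ m ∈ Finset.range M, x ^ m * Finsupp.linearCombination ℂ w (l.curry m) := by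
    rw [← Finsupp.sum_of_support_subset l.curry hM
      (fun m c => x ^ m * Finsupp.linearCombination ℂ w c) (by simp),
      Finsupp.linearCombination_apply,
      ← Finsupp.sum_curry_index l (fun m i c => c • (x ^ m * w i))]
    refine Finsupp.sum_congr fun m _ => ?_
    rw [Finsupp.linearCombination_apply, Finsupp.mul_sum]
    exact Finsupp.sum_congr fun i _ => by rw [mul_smul_comm]
  rw [e2] at hl
  have h3 := key M _ hl
  ext ⟨m, i⟩
  rw [← Finsupp.curry_apply]
  by_cases hm : m < M
  · rw [h3 m hm]
    rfl
  · have : m ∉ l.curry.support := fun h => hm (Finset.mem_range.1 (hM h))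
    rw [Finsupp.notMem_support_iff.1 this]
    rfl

theorem RegSub.linearIndependent {I : Type*} {f : ℕ → MvPolynomial σ ℂ}
    {N K : Submodule ℂ (MvPolynomial σ ℂ)} {a k : ℕ} (h : RegSub f N K a k)
    (hN : ∀ n, a ≤ n → ∀ g ∈ N, f n * g ∈ N) {v : I → MvPolynomial σ ℂ} (hv : ∀ i, v i ∈ N)
    (hi : LinearIndependent ℂ fun i => (addSubSeq f N K a k).mkQ (v i)) :
    LinearIndependent ℂ fun p : (Fin k → ℕ) × I =>
      K.mkQ ((∏ i : Fin k, f (a + i) ^ p.1 i) * v p.2) := by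
  induction k generalizing K a with
  | zero =>
    have := hi.comp (fun p : (Fin 0 → ℕ) × I => p.2) (fun p q hpq => Prod.ext
      (Subsingleton.elim _ _) hpq)
    have e : (fun p : (Fin 0 → ℕ) × I =>
        K.mkQ ((∏ i : Fin 0, f (a + i) ^ p.1 i) * v p.2)) =
        (fun i => (addSubSeq f N K a 0).mkQ (v i)) ∘ fun p : (Fin 0 → ℕ) × I => p.2 := by
      funext p
      rw [Fin.prod_univ_zero, one_mul]
      rfl
    rw [e]
    exact this
  | succ k ih =>
    have h1 := ih h.2 (fun n hn => hN n (by omega)) hi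
    have hmem : ∀ p : (Fin k → ℕ) × I, (∏ i : Fin k, f (a + 1 + i) ^ p.1 i) * v p.2 ∈ N := by
      intro p
      have : ∀ (t : Finset (Fin k)), ∀ g ∈ N, (∏ i ∈ t, f (a + 1 + i) ^ p.1 i) * g ∈ N := by
        classical
        intro t
        induction t using Finset.induction_on with
        | empty => intro g hg; simpa using hg
        | insert j t hj iht =>
          intro g hg
          rw [Finset.prod_insert hj, mul_assoc]
          have := iht g hg
          generalize (∏ i ∈ t, f (a + 1 + i) ^ p.1 i) * g = y at this
          generalize p.1 j = m
          induction m with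
          | zero => simpa using this
          | succ m ihm => rw [pow_succ', mul_assoc]; exact hN _ (by omega) _ ihm
      exact this _ _ (hv _)
    have h2 := linearIndependent_pow_mul h.1 (hN a le_rfl) hmem h1
    let e : (Fin (k + 1) → ℕ) × I ≃ ℕ × ((Fin k → ℕ) × I) :=
      ((Fin.consEquiv fun _ => ℕ).symm.prodCongr (Equiv.refl I)).trans (Equiv.prodAssoc _ _ _)
    have e' : (fun p : (Fin (k + 1) → ℕ) × I =>
        K.mkQ ((∏ i : Fin (k + 1), f (a + i) ^ p.1 i) * v p.2)) =
        (fun p : ℕ × ((Fin k → ℕ) × I) =>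
          K.mkQ (f a ^ p.1 * ((∏ i : Fin k, f (a + 1 + i) ^ p.2.1 i) * v p.2.2))) ∘ e := by
      funext p
      have e3 : (∏ i : Fin k, f (a + (i.succ : Fin (k + 1))) ^ p.1 i.succ) =
          ∏ i : Fin k, f (a + 1 + i) ^ (e p).2.1 i := by
        refine Finset.prod_congr rfl fun i _ => ?_
        rw [Fin.val_succ, show a + (↑i + 1) = a + 1 + ↑i by ring]
        rfl
      rw [Fin.prod_univ_succ, e3, mul_assoc]
      rfl
    rw [e']
    exact h2.comp e e.injective

end IndependenceFromRegularity

theorem linearIndependent_esymm_prod (R : Type*) [CommRing R] (k : ℕ) :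
    LinearIndependent R fun ν : Fin k → ℕ => ∏ i : Fin k, esymm (Fin k) R (i + 1) ^ ν i := by
  have h := (esymmAlgHom_fin_bijective (R := R) k).1
  have h1 : LinearIndependent R fun ν : Fin k →₀ ℕ => (monomial ν 1 : MvPolynomial (Fin k) R) := by
    have := (basisMonomials (Fin k) R).linearIndependent
    rwa [coe_basisMonomials] at this
  have h2 := (h1.map_injOn ((Subalgebra.val _).comp (esymmAlgHom (Fin k) R k)).toLinearMap
    (Function.Injective.injOn (Subtype.val_injective.comp h))).comp _
      (Finsupp.equivFunOnFinite (α := Fin k) (M := ℕ)).symm.injective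
  have e : (fun ν : Fin k → ℕ => ∏ i : Fin k, esymm (Fin k) R (i + 1) ^ ν i) =
      (fun ν : Fin k →₀ ℕ => (((Subalgebra.val _).comp (esymmAlgHom (Fin k) R k)).toLinearMap
        (monomial ν 1))) ∘ (Finsupp.equivFunOnFinite (α := Fin k) (M := ℕ)).symm := by
    funext ν
    simp [esymmAlgHom, aeval_monomial, Finsupp.prod_fintype]
  rw [e]
  exact h2

section PowerSumAlgebra

variable (r s : ℕ)

/-- The product of the power sums `p_{r+1+k} ^ θ k` in `s` variables. -/
def psumProd (θ : ℕ →₀ ℕ) : MvPolynomial (Fin s) ℂ :=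
  θ.prod fun k m => psumOn Finset.univ (r + 1 + k) ^ m

/-- The degree of `psumProd r s θ`. -/
def psumWt (θ : ℕ →₀ ℕ) : ℕ := θ.sum fun k m => m * (r + 1 + k)

/-- The degree `n` part of the algebra generated by the power sums `p_i`, `i > r`. -/
def psumSpan (n : ℕ) : Submodule ℂ (MvPolynomial (Fin s) ℂ) :=
  Submodule.span ℂ (psumProd r s '' {θ | psumWt r θ = n})

theorem psumProd_add (θ η : ℕ →₀ ℕ) :
    psumProd r s (θ + η) = psumProd r s θ * psumProd r s η :=
  Finsupp.prod_add_index' (fun _ => pow_zero _) fun _ _ _ => pow_add _ _ _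

theorem psumWt_add (θ η : ℕ →₀ ℕ) : psumWt r (θ + η) = psumWt r θ + psumWt r η :=
  Finsupp.sum_add_index' (fun _ => zero_mul _) fun _ _ _ => add_mul _ _ _

theorem psumProd_single (k m : ℕ) :
    psumProd r s (Finsupp.single k m) = psumOn Finset.univ (r + 1 + k) ^ m :=
  Finsupp.prod_single_index (pow_zero _)

theorem psumWt_single (k m : ℕ) : psumWt r (Finsupp.single k m) = m * (r + 1 + k) :=
  Finsupp.sum_single_index (zero_mul _)

theorem psumWt_zero : psumWt r 0 = 0 := Finsupp.sum_zero_index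

theorem psumProd_zero : psumProd r s 0 = 1 := Finsupp.prod_zero_index

theorem psumProd_isHomogeneous (θ : ℕ →₀ ℕ) : (psumProd r s θ).IsHomogeneous (psumWt r θ) := by
  refine IsHomogeneous.prod _ _ _ fun k _ => ?_
  show (psumOn Finset.univ (r + 1 + k) ^ θ k).IsHomogeneous (θ k * (r + 1 + k))
  rw [mul_comm]
  exact (psumOn_isHomogeneous _ _).pow _

theorem psumProd_mem (θ : ℕ →₀ ℕ) : psumProd r s θ ∈ psumSpan r s (psumWt r θ) :=
  Submodule.subset_span ⟨θ, rfl, rfl⟩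

theorem psumOn_mul_mem_psumSpan {k n : ℕ} {g : MvPolynomial (Fin s) ℂ}
    (hg : g ∈ psumSpan r s n) :
    psumOn Finset.univ (r + 1 + k) * g ∈ psumSpan r s (r + 1 + k + n) := by
  induction hg using Submodule.span_induction with
  | mem x hx =>
    obtain ⟨θ, rfl, rfl⟩ := hx
    have := psumProd_mem r s (Finsupp.single k 1 + θ)
    rwa [psumProd_add, psumProd_single, psumWt_add, psumWt_single, pow_one, one_mul] at this
  | zero => simp
  | add x y _ _ hx hy => rw [mul_add]; exact add_mem hx hy
  | smul c x _ hx => rw [mul_smul_comm]; exact Submodule.smul_mem _ _ hx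

theorem mem_gapExponents_univ {d : Fin s →₀ ℕ} :
    d ∈ gapExponents Finset.univ (fun _ => r) ↔ ∀ j, d j = 0 ∨ r < d j := by
  simp [gapExponents]

theorem psumProd_mem_exponentsIn (θ : ℕ →₀ ℕ) :
    psumProd r s θ ∈ exponentsIn (gapExponents (Finset.univ : Finset (Fin s)) fun _ => r) := by
  induction θ using Finsupp.induction with
  | zero =>
    rw [psumProd_zero]
    intro d hd
    rw [mem_gapExponents_univ] at hd
    rw [coeff_one, if_neg]
    rintro rfl
    exact hd fun j => Or.inl rfl
  | single_add k m θ _ _ ih =>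
    rw [psumProd_add, psumProd_single]
    clear * - ih
    induction m with
    | zero => rwa [pow_zero, one_mul]
    | succ m ihm =>
      rw [pow_succ', mul_assoc]
      exact psumOn_mul_mem (fun _ _ => le_rfl) (by omega) ihm

/-- The sum of all permutations of a polynomial. -/
def symmetrize : MvPolynomial (Fin s) ℂ →ₗ[ℂ] MvPolynomial (Fin s) ℂ :=
  ∑ σ : Equiv.Perm (Fin s), (rename σ).toLinearMap

theorem symmetrize_apply (f : MvPolynomial (Fin s) ℂ) :
    symmetrize s f = ∑ σ : Equiv.Perm (Fin s), rename σ f := by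
  simp [symmetrize]

theorem symmetrize_rename (τ : Equiv.Perm (Fin s)) (f : MvPolynomial (Fin s) ℂ) :
    symmetrize s (rename τ f) = symmetrize s f := by
  rw [symmetrize_apply, symmetrize_apply]
  refine Fintype.sum_equiv (Equiv.mulRight τ) _ _ fun σ => ?_
  rw [rename_rename]
  rfl

theorem symmetrize_mul {p f : MvPolynomial (Fin s) ℂ} (hp : p.IsSymmetric) :
    symmetrize s (p * f) = p * symmetrize s f := by
  rw [symmetrize_apply, symmetrize_apply, Finset.mul_sum]
  exact Finset.sum_congr rfl fun σ _ => by rw [map_mul, hp]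

theorem symmetrize_of_isSymmetric {f : MvPolynomial (Fin s) ℂ} (hf : f.IsSymmetric) :
    symmetrize s f = (s.factorial : ℂ) • f := by
  rw [symmetrize_apply, Finset.sum_congr rfl fun σ _ => hf σ, Finset.sum_const, Finset.card_univ,
    Fintype.card_perm, Fintype.card_fin, Nat.cast_smul_eq_nsmul]

theorem psumOn_univ_isSymmetric (n : ℕ) :
    (psumOn (Finset.univ : Finset (Fin s)) n).IsSymmetric := by
  intro σ
  simp only [psumOn, map_sum, map_pow, rename_X]
  exact Equiv.sum_comp σ fun j => (X j : MvPolynomial (Fin s) ℂ) ^ n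

theorem psumProd_isSymmetric (θ : ℕ →₀ ℕ) : (psumProd r s θ).IsSymmetric := by
  intro σ
  rw [psumProd, Finsupp.prod, map_prod]
  exact Finset.prod_congr rfl fun k _ => by rw [map_pow, psumOn_univ_isSymmetric]

theorem symmetrize_monomial_mem {d : Fin s →₀ ℕ} (hd : ∀ j, d j = 0 ∨ r < d j) :
    symmetrize s (monomial d 1) ∈ psumSpan r s d.degree := by
  classical
  induction hc : d.support.card using Nat.strong_induction_on generalizing d with
  | _ c ih =>
    subst hc
    rcases eq_or_ne d 0 with rfl | h0
    · have h1 : symmetrize s (monomial 0 1) = (s.factorial : ℂ) • psumProd r s 0 := by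
        rw [psumProd_zero]
        exact symmetrize_of_isSymmetric s (f := 1) (fun σ => map_one _)
      rw [h1, map_zero, ← psumWt_zero r]
      exact Submodule.smul_mem _ _ (psumProd_mem r s 0)
    obtain ⟨j₀, hj₀⟩ := Finsupp.support_nonempty_iff.2 h0
    obtain ⟨k, hk⟩ : ∃ k, d j₀ = r + 1 + k :=
      ⟨d j₀ - (r + 1), by have := hd j₀; rw [Finsupp.mem_support_iff] at hj₀; omega⟩
    set d' := d.erase j₀ with hd'
    have hdd : d' + Finsupp.single j₀ (r + 1 + k) = d := by
      rw [← hk]; exact Finsupp.erase_add_single j₀ d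
    have hdeg : d.degree = r + 1 + k + d'.degree := by
      rw [← hdd, map_add, Finsupp.degree_single, add_comm]
    have hd'0 : d' j₀ = 0 := Finsupp.erase_same
    have hcard : d'.support.card < d.support.card := by
      rw [hd', Finsupp.support_erase]
      exact Finset.card_erase_lt_of_mem hj₀
    have hgap' : ∀ j, d' j = 0 ∨ r < d' j := by
      intro j
      by_cases hj : j = j₀
      · exact Or.inl (hj ▸ hd'0)
      · rw [hd', Finsupp.erase_ne hj]; exact hd j
    have e1 : psumOn Finset.univ (r + 1 + k) * symmetrize s (monomial d' 1) =
        ∑ j, symmetrize s (monomial (d' + Finsupp.single j (r + 1 + k)) 1) := by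
      rw [← symmetrize_mul s (psumOn_univ_isSymmetric s _), psumOn, Finset.sum_mul, map_sum]
      refine Finset.sum_congr rfl fun j _ => ?_
      rw [X_pow_eq_monomial, monomial_mul, one_mul, add_comm]
    have e2 : ∀ j ∉ d'.support, symmetrize s (monomial (d' + Finsupp.single j (r + 1 + k)) 1) =
        symmetrize s (monomial d 1) := by
      intro j hj
      rw [← symmetrize_rename s (Equiv.swap j j₀), rename_monomial, Finsupp.mapDomain_add,
        Finsupp.mapDomain_single, Equiv.swap_apply_left]
      have : Finsupp.mapDomain (Equiv.swap j j₀) d' = d' := by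
        ext i
        rw [Finsupp.mapDomain_equiv_apply, Equiv.symm_swap, Equiv.swap_apply_def]
        split_ifs with h1 h2
        · rw [h1, hd'0, Finsupp.notMem_support_iff.1 hj]
        · rw [h2, hd'0, Finsupp.notMem_support_iff.1 hj]
        · rfl
      rw [this, hdd]
    have e3 : ∀ j ∈ d'.support, symmetrize s (monomial (d' + Finsupp.single j (r + 1 + k)) 1) ∈
        psumSpan r s d.degree := by
      intro j hj
      have h1 := ih (d' + Finsupp.single j (r + 1 + k)).support.card ?_
        (d := d' + Finsupp.single j (r + 1 + k)) ?_ rfl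
      · rwa [map_add, Finsupp.degree_single, add_comm, ← hdeg] at h1
      · refine lt_of_le_of_lt (Finset.card_le_card ?_) hcard
        intro i hi
        by_cases hij : i = j
        · rwa [hij]
        · rw [Finsupp.mem_support_iff] at hi ⊢
          rwa [Finsupp.add_apply, Finsupp.single_eq_of_ne hij, add_zero] at hi
      · intro i
        by_cases hij : i = j
        · right
          rw [hij, Finsupp.add_apply, Finsupp.single_eq_same]
          omega
        · rw [Finsupp.add_apply, Finsupp.single_eq_of_ne hij, add_zero]
          exact hgap' i
    have e4 : psumOn Finset.univ (r + 1 + k) * symmetrize s (monomial d' 1) ∈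
        psumSpan r s d.degree := by
      rw [hdeg]
      exact psumOn_mul_mem_psumSpan r s (ih _ hcard hgap' rfl)
    rw [e1, ← Finset.sum_add_sum_compl d'.support,
      Finset.sum_congr (s₁ := d'.supportᶜ) rfl fun j hj => e2 j (Finset.mem_compl.1 hj),
      Finset.sum_const] at e4
    have e5 := (Submodule.add_mem_iff_right _ (Submodule.sum_mem _ e3)).1 e4
    rw [← Nat.cast_smul_eq_nsmul ℂ] at e5
    refine (Submodule.smul_mem_iff _ ?_).1 e5
    rw [Nat.cast_ne_zero, ← Nat.pos_iff_ne_zero, Finset.card_pos]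
    exact ⟨j₀, by simpa using hd'0⟩

theorem exponentsIn_eq_span {σ : Type*} (A : Set (σ →₀ ℕ)) :
    exponentsIn A = Submodule.span ℂ ((fun d => monomial d (1 : ℂ)) '' A) := by
  refine le_antisymm (fun f hf => ?_) (Submodule.span_le.2 ?_)
  · rw [f.as_sum]
    refine Submodule.sum_mem _ fun d hd => ?_
    rw [show monomial d (coeff d f) = coeff d f • monomial d (1 : ℂ) by simp [smul_monomial]]
    refine Submodule.smul_mem _ _ (Submodule.subset_span ⟨d, ?_, rfl⟩)
    by_contra h
    exact mem_support_iff.1 hd (hf d h)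
  · rintro _ ⟨d, hd, rfl⟩ d' hd'
    classical
    rw [coeff_monomial, if_neg]
    rintro rfl
    exact hd' hd

theorem mem_psumSpan_of_isSymmetric {f : MvPolynomial (Fin s) ℂ} {n : ℕ} (hf : f.IsSymmetric)
    (hn : f.IsHomogeneous n)
    (hg : f ∈ exponentsIn (gapExponents (Finset.univ : Finset (Fin s)) fun _ => r)) :
    f ∈ psumSpan r s n := by
  have h1 : symmetrize s f ∈ psumSpan r s n := by
    rw [f.as_sum, map_sum]
    refine Submodule.sum_mem _ fun d hd => ?_
    rw [show monomial d (coeff d f) = coeff d f • monomial d (1 : ℂ) by simp [smul_monomial],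
      map_smul]
    have h2 := hn (mem_support_iff.1 hd)
    replace h2 : d.degree = n := by rw [Finsupp.degree_eq_weight_one]; exact h2
    rw [← h2]
    refine Submodule.smul_mem _ _ (symmetrize_monomial_mem r s ?_)
    rw [← mem_gapExponents_univ]
    by_contra h
    exact mem_support_iff.1 hd (hg d h)
  rw [symmetrize_of_isSymmetric s hf] at h1
  exact (Submodule.smul_mem_iff _ (by exact_mod_cast s.factorial_ne_zero)).1 h1

end PowerSumAlgebra

theorem finrank_map_add_card_le {K V W ι : Type*} [Field K] [AddCommGroup V] [Module K V]
    [AddCommGroup W] [Module K W] [Finite ι] (f : V →ₗ[K] W) (D : Submodule K V)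
    [FiniteDimensional K D] {w : ι → V} (hw : LinearIndependent K w) (hD : ∀ i, w i ∈ D)
    (h0 : ∀ i, f (w i) = 0) :
    Module.finrank K (D.map f) + Nat.card ι ≤ Module.finrank K D := by
  have := Fintype.ofFinite ι
  rw [Nat.card_eq_fintype_card, ← LinearMap.finrank_range_add_finrank_ker (f.domRestrict D),
    LinearMap.range_domRestrict]
  let w' : ι → (f.domRestrict D).ker := fun i => ⟨⟨w i, hD i⟩, h0 i⟩
  have hw' : LinearIndependent K w' :=
    LinearIndependent.of_comp (D.subtype.comp (f.domRestrict D).ker.subtype) hw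
  exact Nat.add_le_add_left hw'.fintype_card_le_finrank _

section PowerSumBasis

variable (r s : ℕ)

theorem finite_psumWt (n : ℕ) : {θ | psumWt r θ = n}.Finite := by
  refine (Set.finite_Iic (Finsupp.indicator (Finset.range n) fun _ _ => n)).subset ?_
  rintro θ rfl k
  have h : ∀ k, θ k ≠ 0 → θ k * (r + 1 + k) ≤ psumWt r θ := fun k hk =>
    Finset.single_le_sum (f := fun k => θ k * (r + 1 + k)) (fun _ _ => Nat.zero_le _)
      (Finsupp.mem_support_iff.2 hk)
  rw [Finsupp.indicator_apply]
  by_cases hk : θ k = 0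
  · rw [hk]; exact Nat.zero_le _
  · have h1 := h k hk
    rw [dif_pos]
    · nlinarith
    · rw [Finset.mem_range]
      have : 1 ≤ θ k := Nat.pos_of_ne_zero hk
      nlinarith

instance (n : ℕ) : FiniteDimensional ℂ (psumSpan r s n) :=
  FiniteDimensional.span_of_finite ℂ ((finite_psumWt r n).image _)

/-- The degree `n` part of the ideal generated by `p_{r+1}, ..., p_{r+s}` in the algebra generated
by the power sums `p_i`, `i > r`. -/
def psumDec (n : ℕ) : Submodule ℂ (MvPolynomial (Fin s) ℂ) :=
  Submodule.span ℂ {f | ∃ k < s, ∃ θ, r + 1 + k + psumWt r θ = n ∧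
    f = psumOn Finset.univ (r + 1 + k) * psumProd r s θ}

theorem psumOn_mul_mem_psumDec {k n : ℕ} (hk : k < s) {g : MvPolynomial (Fin s) ℂ}
    (hg : g ∈ psumSpan r s n) :
    psumOn Finset.univ (r + 1 + k) * g ∈ psumDec r s (r + 1 + k + n) := by
  induction hg using Submodule.span_induction with
  | mem x hx =>
    obtain ⟨θ, rfl, rfl⟩ := hx
    exact Submodule.subset_span ⟨k, hk, θ, rfl, rfl⟩
  | zero => simp
  | add x y _ _ hx hy => rw [mul_add]; exact add_mem hx hy
  | smul c x _ hx => rw [mul_smul_comm]; exact Submodule.smul_mem _ _ hx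

theorem exists_psum_index : ∃ T : ℕ → Set (ℕ →₀ ℕ), ∀ n, T n ⊆ {θ | psumWt r θ = n} ∧
    psumSpan r s n ≤ psumDec r s n ⊔ Submodule.span ℂ (psumProd r s '' T n) ∧
    LinearIndepOn ℂ (fun θ => (psumDec r s n).mkQ (psumProd r s θ)) (T n) := by
  refine Classical.axiomOfChoice (r := fun n (T : Set (ℕ →₀ ℕ)) => T ⊆ {θ | psumWt r θ = n} ∧
    psumSpan r s n ≤ psumDec r s n ⊔ Submodule.span ℂ (psumProd r s '' T) ∧
    LinearIndepOn ℂ (fun θ => (psumDec r s n).mkQ (psumProd r s θ)) T) fun n => ?_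
  obtain ⟨T, h1, -, h2, h3⟩ := exists_linearIndepOn_extension
    (linearIndepOn_empty ℂ fun θ => (psumDec r s n).mkQ (psumProd r s θ))
    (Set.empty_subset {θ | psumWt r θ = n})
  refine ⟨T, h1, Submodule.span_le.2 ?_, h3⟩
  rintro _ ⟨θ, hθ, rfl⟩
  have h4 := h2 ⟨θ, hθ, rfl⟩
  have h5 : (fun θ => (psumDec r s n).mkQ (psumProd r s θ)) '' T =
    (psumDec r s n).mkQ '' (psumProd r s '' T) := (Set.image_image _ _ _).symm
  rw [h5, SetLike.mem_coe, ← Submodule.map_span, Submodule.mem_map] at h4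
  obtain ⟨y, hy, h6⟩ := h4
  replace h6 := (Submodule.Quotient.eq _).1 h6
  refine Submodule.mem_sup.2 ⟨psumProd r s θ - y, ?_, y, hy, sub_add_cancel _ _⟩
  rw [← neg_sub]
  exact neg_mem h6

/-- The element of the power sum algebra attached to exponents of the `p_{r+1}, ..., p_{r+s}` and a
further product of power sums. -/
def psumFamily (x : (Fin s → ℕ) × (ℕ →₀ ℕ)) : MvPolynomial (Fin s) ℂ :=
  (∏ k : Fin s, psumOn Finset.univ (r + 1 + k) ^ x.1 k) * psumProd r s x.2

/-- The degree of `psumFamily r s x`. -/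
def psumFamilyWt (x : (Fin s → ℕ) × (ℕ →₀ ℕ)) : ℕ :=
  ∑ k : Fin s, (r + 1 + k) * x.1 k + psumWt r x.2

theorem psumOn_mul_psumFamily (k : Fin s) (x : (Fin s → ℕ) × (ℕ →₀ ℕ)) :
    psumOn Finset.univ (r + 1 + k) * psumFamily r s x =
      psumFamily r s (x.1 + Pi.single k 1, x.2) := by
  rw [psumFamily, psumFamily, ← mul_assoc]
  congr 1
  simp only [Pi.add_apply, pow_add, Finset.prod_mul_distrib]
  rw [mul_comm]
  congr 1
  rw [Finset.prod_eq_single k]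
  · simp
  · intro j _ hj
    rw [Pi.single_eq_of_ne hj, pow_zero]
  · simp

theorem psumFamilyWt_add_single (k : Fin s) (x : (Fin s → ℕ) × (ℕ →₀ ℕ)) :
    psumFamilyWt r s (x.1 + Pi.single k 1, x.2) = r + 1 + k + psumFamilyWt r s x := by
  rw [psumFamilyWt, psumFamilyWt, ← add_assoc]
  congr 1
  simp only [Pi.add_apply, mul_add, Finset.sum_add_distrib]
  rw [add_comm]
  congr 1
  rw [Finset.sum_eq_single k]
  · simp
  · intro j _ hj
    rw [Pi.single_eq_of_ne hj, mul_zero]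
  · simp

/-- The span of the elements `psumFamily r s x` of degree `n` whose second index is selected by
`T`. -/
def psumFamilySpan (T : ℕ → Set (ℕ →₀ ℕ)) (n : ℕ) : Submodule ℂ (MvPolynomial (Fin s) ℂ) :=
  Submodule.span ℂ (psumFamily r s '' {x | x.2 ∈ T (psumWt r x.2) ∧ psumFamilyWt r s x = n})

theorem psumOn_mul_mem_psumFamilySpan {T : ℕ → Set (ℕ →₀ ℕ)} {n : ℕ} (k : Fin s)
    {g : MvPolynomial (Fin s) ℂ} (hg : g ∈ psumFamilySpan r s T n) :
    psumOn Finset.univ (r + 1 + k) * g ∈ psumFamilySpan r s T (r + 1 + k + n) := by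
  have h : psumFamilySpan r s T n ≤ (psumFamilySpan r s T (r + 1 + k + n)).comap
      (LinearMap.mulLeft ℂ (psumOn Finset.univ (r + 1 + k))) := by
    refine Submodule.span_le.2 ?_
    rintro _ ⟨x, hx, rfl⟩
    rw [SetLike.mem_coe, Submodule.mem_comap, LinearMap.mulLeft_apply, psumOn_mul_psumFamily]
    refine Submodule.subset_span ⟨(x.1 + Pi.single k 1, x.2), ⟨hx.1, ?_⟩, rfl⟩
    rw [psumFamilyWt_add_single, hx.2]
  exact h hg

theorem psumSpan_le_psumFamilySpan {T : ℕ → Set (ℕ →₀ ℕ)}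
    (hT : ∀ n, T n ⊆ {θ | psumWt r θ = n} ∧
      psumSpan r s n ≤ psumDec r s n ⊔ Submodule.span ℂ (psumProd r s '' T n)) (n : ℕ) :
    psumSpan r s n ≤ psumFamilySpan r s T n := by
  induction n using Nat.strong_induction_on with
  | _ n ih =>
    refine (hT n).2.trans (sup_le (Submodule.span_le.2 ?_) (Submodule.span_le.2 ?_))
    · rintro _ ⟨k, hk, θ, hn, rfl⟩
      rw [← hn]
      exact psumOn_mul_mem_psumFamilySpan r s ⟨k, hk⟩ (ih _ (by omega) (psumProd_mem r s θ))
    · rintro _ ⟨θ, hθ, rfl⟩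
      have h1 : psumWt r θ = n := (hT n).1 hθ
      have h2 : psumFamily r s (0, θ) = psumProd r s θ := by simp [psumFamily]
      have h3 : psumFamilyWt r s (0, θ) = n := by simp [psumFamilyWt, h1]
      rw [← h1] at hθ
      exact Submodule.subset_span ⟨(0, θ), ⟨hθ, h3⟩, h2⟩

theorem finite_psumFamilyWt (S : Set (ℕ →₀ ℕ)) (n : ℕ) :
    Finite {x : (Fin s → ℕ) × S // psumFamilyWt r s (x.1, x.2) = n} := by
  refine finite_prodFiber (a := fun μ : Fin s → ℕ => ∑ k : Fin s, (r + 1 + k) * μ k)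
    (b := fun σ : S => psumWt r σ) (finite_sumFiber (fun k : Fin s => r + 1 + k) fun _ => by omega)
    (fun m => ?_) n
  have := (finite_psumWt r m).to_subtype
  exact Finite.of_injective (β := {θ | psumWt r θ = m}) (fun σ => ⟨σ.1.1, σ.2⟩) fun x y h =>
    Subtype.ext (Subtype.ext (congrArg (fun z => z.1) h))

theorem symmetrize_homogeneousComponent_mem {n : ℕ} {g : MvPolynomial (Fin s) ℂ}
    (hg : g ∈ addSubSeq (psumOn Finset.univ)
      (exponentsIn (gapExponents (Finset.univ : Finset (Fin s)) fun _ => r)) ⊥ (r + 1) s) :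
    symmetrize s (homogeneousComponent n g) ∈ psumDec r s n := by
  have key : addSubSeq (psumOn Finset.univ)
      (exponentsIn (gapExponents (Finset.univ : Finset (Fin s)) fun _ => r)) ⊥ (r + 1) s ≤
      (psumDec r s n).comap ((symmetrize s).comp (homogeneousComponent n)) := by
    rw [addSubSeq_eq, bot_sup_eq]
    refine iSup₂_le fun k hk => ?_
    rw [exponentsIn_eq_span, Submodule.map_span, Submodule.span_le]
    rintro _ ⟨_, ⟨d, hd, rfl⟩, rfl⟩
    rw [mem_gapExponents_univ] at hd
    rw [SetLike.mem_coe, Submodule.mem_comap, LinearMap.comp_apply, LinearMap.mulLeft_apply]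
    have h1 : (psumOn Finset.univ (r + 1 + k) * monomial d (1 : ℂ)) ∈
        homogeneousSubmodule (Fin s) ℂ (r + 1 + k + d.degree) :=
      (psumOn_isHomogeneous _ _).mul (isHomogeneous_monomial _ rfl)
    rw [homogeneousComponent_of_mem h1]
    split_ifs with hn
    · rw [hn, symmetrize_mul s (psumOn_univ_isSymmetric s _)]
      exact psumOn_mul_mem_psumDec r s (Finset.mem_range.1 hk) (symmetrize_monomial_mem r s hd)
    · rw [map_zero]
      exact zero_mem _
  exact key hg

theorem linearIndependent_psumFamily {T : ℕ → Set (ℕ →₀ ℕ)}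
    (hT : ∀ n, LinearIndepOn ℂ (fun θ => (psumDec r s n).mkQ (psumProd r s θ)) (T n)) :
    LinearIndependent ℂ fun x : (Fin s → ℕ) × {θ | θ ∈ T (psumWt r θ)} =>
      psumFamily r s (x.1, x.2) := by
  set N := exponentsIn (gapExponents (Finset.univ : Finset (Fin s)) fun _ => r) with hN
  have h1 : LinearIndependent ℂ fun θ : {θ | θ ∈ T (psumWt r θ)} =>
      (addSubSeq (psumOn Finset.univ) N ⊥ (r + 1) s).mkQ (psumProd r s θ) := by
    classical
    change LinearIndepOn ℂ (fun θ => (addSubSeq (psumOn Finset.univ) N ⊥ (r + 1) s).mkQ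
      (psumProd r s θ)) {θ | θ ∈ T (psumWt r θ)}
    rw [linearIndepOn_iff']
    intro t c ht hc i hi
    have h2 : ∑ j ∈ t, c j • (psumProd r s j) ∈
        addSubSeq (psumOn Finset.univ) N ⊥ (r + 1) s := by
      rw [← Submodule.Quotient.mk_eq_zero, ← Submodule.mkQ_apply, map_sum]
      simpa only [map_smul] using hc
    set n := psumWt r i with hn
    have h3 := symmetrize_homogeneousComponent_mem r s (n := n) h2
    have h4 : symmetrize s (homogeneousComponent n (∑ j ∈ t, c j • (psumProd r s j))) =
        ∑ j ∈ t.filter fun j => psumWt r j = n, (s.factorial : ℂ) • (c j • psumProd r s j) := by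
      rw [map_sum, map_sum, Finset.sum_filter]
      refine Finset.sum_congr rfl fun j _ => ?_
      rw [map_smul, map_smul, homogeneousComponent_of_mem (psumProd_isHomogeneous r s j)]
      split_ifs with h5 h6 h7
      · rw [symmetrize_of_isSymmetric s (psumProd_isSymmetric r s _), smul_comm]
      · exact absurd h5.symm h6
      · exact absurd h7.symm h5
      · rw [map_zero, smul_zero]
    rw [h4, ← Finset.smul_sum, Submodule.smul_mem_iff _ (by exact_mod_cast s.factorial_ne_zero),
      ← Submodule.Quotient.mk_eq_zero, ← Submodule.mkQ_apply, map_sum] at h3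
    simp only [map_smul] at h3
    refine linearIndepOn_iff'.1 (hT n) _ c (fun j hj => ?_) h3 i
      (Finset.mem_filter.2 ⟨hi, rfl⟩)
    obtain ⟨hj1, hj2⟩ := Finset.mem_filter.1 (Finset.mem_coe.1 hj)
    rw [← hj2]
    exact ht hj1
  have hreg := regSub_gapExponents (Finset.univ : Finset (Fin s))
    (fun _ => r) r fun _ _ => le_rfl
  rw [Finset.card_fin] at hreg
  have h2 := hreg.linearIndependent (fun n hn g hg => psumOn_mul_mem (fun _ _ => le_rfl) hn hg)
    (fun i : {θ | θ ∈ T (psumWt r θ)} => psumProd_mem_exponentsIn r s i.1) h1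
  exact LinearIndependent.of_comp (⊥ : Submodule ℂ (MvPolynomial (Fin s) ℂ)).mkQ h2

end PowerSumBasis

theorem esymm_isHomogeneous_of_fintype (σ R : Type*) [Fintype σ] [CommSemiring R] (n : ℕ) :
    (esymm σ R n).IsHomogeneous n := by
  refine IsHomogeneous.sum _ _ _ fun t ht => ?_
  have h := IsHomogeneous.prod t (fun i => (X i : MvPolynomial σ R)) (fun _ => 1)
    fun i _ => isHomogeneous_X R i
  simpa [(Finset.mem_powersetCard.1 ht).2] using h

section PowerSumDimension

variable (r s : ℕ)

/-- Setting the first variable to zero. -/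
def dropVar : MvPolynomial (Fin (s + 1)) ℂ →ₐ[ℂ] MvPolynomial (Fin s) ℂ :=
  aeval (Fin.cons 0 X)

theorem dropVar_psumOn {n : ℕ} (hn : n ≠ 0) :
    dropVar s (psumOn Finset.univ n) = psumOn Finset.univ n := by
  simp [dropVar, psumOn, Fin.sum_univ_succ, hn]

theorem dropVar_psumProd (θ : ℕ →₀ ℕ) : dropVar s (psumProd r (s + 1) θ) = psumProd r s θ := by
  rw [psumProd, psumProd, Finsupp.prod, Finsupp.prod, map_prod]
  exact Finset.prod_congr rfl fun k _ => by rw [map_pow, dropVar_psumOn s (by omega)]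

theorem map_dropVar_psumSpan (n : ℕ) :
    (psumSpan r (s + 1) n).map (dropVar s).toLinearMap = psumSpan r s n := by
  rw [psumSpan, psumSpan, Submodule.map_span, Set.image_image]
  congr 1
  exact Set.image_congr fun θ _ => dropVar_psumProd r s θ

theorem prod_X_pow_isSymmetric (n : ℕ) :
    ((∏ j : Fin s, X j : MvPolynomial (Fin s) ℂ) ^ n).IsSymmetric := by
  intro σ
  rw [map_pow, map_prod]
  simp only [rename_X]
  rw [Equiv.prod_comp σ fun j => (X j : MvPolynomial (Fin s) ℂ)]

theorem esymm_prod_isHomogeneous (ν : Fin s → ℕ) :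
    (∏ i : Fin s, esymm (Fin s) ℂ (i + 1) ^ ν i).IsHomogeneous
      (∑ i : Fin s, ((i : ℕ) + 1) * ν i) :=
  IsHomogeneous.prod _ _ _ fun _ _ => (esymm_isHomogeneous_of_fintype _ _ _).pow _

theorem prod_X_pow_mul_mem_exponentsIn (f : MvPolynomial (Fin s) ℂ) :
    (∏ j : Fin s, X j : MvPolynomial (Fin s) ℂ) ^ (r + 1) * f ∈
      exponentsIn (gapExponents (Finset.univ : Finset (Fin s)) fun _ => r) := by
  have h1 : (∏ j : Fin s, X j : MvPolynomial (Fin s) ℂ) ^ (r + 1) =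
      monomial (Finsupp.equivFunOnFinite.symm fun _ => r + 1) 1 := by
    rw [monomial_eq, Finsupp.prod_fintype _ _ fun _ => pow_zero _, map_one, one_mul,
      ← Finset.prod_pow]
    simp only [Finsupp.equivFunOnFinite_symm_apply_apply]
  rw [h1]
  refine monomial_mul_mem_exponentsIn (A := Set.univ) (fun d _ => ?_)
    fun d hd => absurd trivial hd
  rw [mem_gapExponents_univ]
  intro j
  right
  simp only [Finsupp.add_apply, Finsupp.equivFunOnFinite_symm_apply_apply]
  omega

theorem finite_symSeries_fiber (k n : ℕ) :
    Finite {ν : Fin k → ℕ // ∑ i : Fin k, ((i : ℕ) + 1) * ν i = n} :=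
  finite_sumFiber (fun i : Fin k => (i : ℕ) + 1) (fun _ => Nat.succ_pos _) n

theorem coeff_dSeries_le_finrank_psumSpan (n : ℕ) :
    PowerSeries.coeff n (dSeries r s) ≤ (Module.finrank ℂ (psumSpan r s n) : ℚ) := by
  induction s with
  | zero =>
    have h0 : symSeries 0 = 1 := by simpa [uu] using symSeries_mul_uu 0
    rw [dSeries, Finset.sum_range_one, zero_mul, pow_zero, one_mul, h0, PowerSeries.coeff_one]
    split_ifs with hn
    · subst hn
      have h1 : (1 : MvPolynomial (Fin 0) ℂ) ∈ psumSpan r 0 0 := by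
        have := psumProd_mem r 0 0
        rwa [psumProd_zero, psumWt_zero] at this
      have h2 : 0 < Module.finrank ℂ (psumSpan r 0 0) :=
        Module.finrank_pos_iff_exists_ne_zero.2 ⟨⟨1, h1⟩, fun h => one_ne_zero
          (congrArg Subtype.val h)⟩
      exact_mod_cast h2
    · exact Nat.cast_nonneg _
  | succ s ih =>
    have h1 : dSeries r (s + 1) =
        dSeries r s + PowerSeries.X ^ ((s + 1) * (r + 1)) * symSeries (s + 1) :=
      Finset.sum_range_succ _ _
    rw [h1, map_add, PowerSeries.coeff_X_pow_mul']
    rw [← map_dropVar_psumSpan] at ih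
    split_ifs with hn
    · rw [symSeries, coeff_wtSeries]
      set I := {ν : Fin (s + 1) → ℕ //
        ∑ i : Fin (s + 1), ((i : ℕ) + 1) * ν i = n - (s + 1) * (r + 1)}
      have : Finite I := finite_symSeries_fiber _ _
      have hP : (∏ j : Fin (s + 1), X j : MvPolynomial (Fin (s + 1)) ℂ) ^ (r + 1) ≠ 0 :=
        pow_ne_zero _ (Finset.prod_ne_zero_iff.2 fun j _ => X_ne_zero j)
      have h2 : LinearIndependent ℂ fun ν : I =>
          (∏ j : Fin (s + 1), X j : MvPolynomial (Fin (s + 1)) ℂ) ^ (r + 1) *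
            ∏ i : Fin (s + 1), esymm (Fin (s + 1)) ℂ (i + 1) ^ ν.1 i :=
        ((linearIndependent_esymm_prod ℂ (s + 1)).comp _ Subtype.val_injective).map_injOn
          (LinearMap.mulLeft ℂ _) (mul_right_injective₀ hP).injOn
      have h3 := finrank_map_add_card_le (dropVar s).toLinearMap (psumSpan r (s + 1) n) h2
        (fun ν => ?_) (fun ν => ?_)
      · refine (add_le_add_left ih _).trans ?_
        exact_mod_cast h3
      · refine mem_psumSpan_of_isSymmetric r (s + 1) ?_ ?_ (prod_X_pow_mul_mem_exponentsIn r _ _)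
        · refine IsSymmetric.mul (prod_X_pow_isSymmetric _ _) fun σ => ?_
          rw [map_prod]
          exact Finset.prod_congr rfl fun i _ => by rw [map_pow, rename_esymm]
        · have h4 :
              ((∏ j : Fin (s + 1), X j : MvPolynomial (Fin (s + 1)) ℂ) ^ (r + 1)).IsHomogeneous
              ((s + 1) * (r + 1)) := by
            refine IsHomogeneous.pow ?_ _
            have := IsHomogeneous.prod (Finset.univ : Finset (Fin (s + 1)))
              (fun j => (X j : MvPolynomial (Fin (s + 1)) ℂ)) (fun _ => 1)
              fun j _ => isHomogeneous_X ℂ j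
            simpa using this
          have h5 := h4.mul (esymm_prod_isHomogeneous (s + 1) ν.1)
          rwa [ν.2, Nat.add_sub_cancel' hn] at h5
      · have h4 : dropVar s (∏ j : Fin (s + 1), X j) = 0 := by
          rw [Fin.prod_univ_succ, map_mul]
          simp [dropVar]
        rw [AlgHom.toLinearMap_apply, map_mul, map_pow, h4, zero_pow (Nat.succ_ne_zero _), zero_mul]
    · rw [add_zero]
      refine ih.trans ?_
      exact_mod_cast Submodule.finrank_map_le _ _

/-- The algebra generated by the power sums `p_i`, `i > r`, in `s` variables contains an
independent family of the form `p_{r+1}^{μ_1} ⋯ p_{r+s}^{μ_s} p^σ`, of the expected size. -/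
theorem exists_linearIndependent_psumFamily : ∃ S : Set (ℕ →₀ ℕ),
    (LinearIndependent ℂ fun x : (Fin s → ℕ) × S => psumFamily r s (x.1, x.2)) ∧
    ∀ n, PowerSeries.coeff n (dSeries r s) ≤
      (Nat.card {x : (Fin s → ℕ) × S // psumFamilyWt r s (x.1, x.2) = n} : ℚ) := by
  obtain ⟨T, hT⟩ := exists_psum_index r s
  refine ⟨{θ | θ ∈ T (psumWt r θ)}, linearIndependent_psumFamily r s fun n => (hT n).2.2,
    fun n => (coeff_dSeries_le_finrank_psumSpan r s n).trans ?_⟩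
  set I := {x : (Fin s → ℕ) × {θ | θ ∈ T (psumWt r θ)} // psumFamilyWt r s (x.1, x.2) = n}
  have : Finite I := finite_psumFamilyWt r s _ n
  have := Fintype.ofFinite I
  have h1 := psumSpan_le_psumFamilySpan r s (fun n => ⟨(hT n).1, (hT n).2.1⟩) n
  have h2 : psumFamilySpan r s T n ≤
      Submodule.span ℂ (Set.range fun x : I => psumFamily r s (x.1.1, x.1.2)) := by
    refine Submodule.span_mono ?_
    rintro _ ⟨x, hx, rfl⟩
    exact ⟨⟨(x.1, ⟨x.2, hx.1⟩), hx.2⟩, rfl⟩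
  have : Module.Finite ℂ
      (Submodule.span ℂ (Set.range fun x : I => psumFamily r s (x.1.1, x.1.2))) :=
    FiniteDimensional.span_of_finite ℂ (Set.finite_range _)
  have h3 := (Submodule.finrank_mono (h1.trans h2)).trans
    (finrank_range_le_card fun x : I => psumFamily r s (x.1.1, x.1.2))
  rw [Nat.card_eq_fintype_card]
  exact_mod_cast h3

end PowerSumDimension

section NewtonRecursion

variable {B : Type*} [CommRing B]

/-- The elementary symmetric functions attached to the power sums `Q` by Newton's identities. -/
def newtonE [Algebra ℂ B] (Q : ℕ → B) : ℕ → B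
  | 0 => 1
  | n + 1 => ((n + 1 : ℂ)⁻¹) • ∑ i : Fin (n + 1), (-1) ^ (i : ℕ) * Q (i + 1) * newtonE Q (n - i)
decreasing_by omega

theorem newtonE_zero [Algebra ℂ B] (Q : ℕ → B) : newtonE Q 0 = 1 := by rw [newtonE]

theorem newtonE_succ [Algebra ℂ B] (Q : ℕ → B) (n : ℕ) : newtonE Q (n + 1) = ((n + 1 : ℂ)⁻¹) •
    ∑ i ∈ Finset.range (n + 1), (-1) ^ i * Q (i + 1) * newtonE Q (n - i) := by
  rw [newtonE, Finset.sum_range fun i => (-1) ^ i * Q (i + 1) * newtonE Q (n - i)]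

theorem map_newtonE [Algebra ℂ B] {B' : Type*} [CommRing B'] [Algebra ℂ B']
    (φ : B →ₐ[ℂ] B') (Q : ℕ → B) (n : ℕ) :
    φ (newtonE Q n) = newtonE (fun i => φ (Q i)) n := by
  induction n using Nat.strong_induction_on with
  | _ n ih =>
    rcases n with _ | n
    · rw [newtonE_zero, newtonE_zero, map_one]
    · rw [newtonE_succ, newtonE_succ, map_smul, map_sum]
      congr 1
      refine Finset.sum_congr rfl fun i _ => ?_
      rw [map_mul, map_mul, ih _ (by omega), map_pow, map_neg, map_one]

theorem eq_newtonE [Algebra ℂ B] {Q : ℕ → B} {E : ℕ → B} (h0 : E 0 = 1)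
    (h : ∀ n : ℕ, ((n : B) + 1) * E (n + 1) =
      ∑ i ∈ Finset.range (n + 1), (-1) ^ i * Q (i + 1) * E (n - i)) (n : ℕ) :
    E n = newtonE Q n := by
  induction n using Nat.strong_induction_on with
  | _ n ih =>
    rcases n with _ | n
    · rw [newtonE_zero, h0]
    · rw [newtonE_succ, ← Finset.sum_congr rfl fun i _ => by rw [← ih (n - i) (by omega)], ← h,
        show ((n : B) + 1) * E (n + 1) = ((n : ℂ) + 1) • E (n + 1) by
          rw [Algebra.smul_def, map_add, map_natCast, map_one], smul_smul,
        inv_mul_cancel₀ (Nat.cast_add_one_ne_zero n), one_smul]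

/-- The power series `F` has constant coefficient one and logarithmic derivative
`∑ (-1)^i Q_{i+1} X^i`. -/
def IsLogDeriv (F : PowerSeries B) (Q : ℕ → B) : Prop :=
  PowerSeries.constantCoeff F = 1 ∧
    PowerSeries.derivative B F = F * PowerSeries.mk fun i => (-1) ^ i * Q (i + 1)

theorem IsLogDeriv.coeff_eq [Algebra ℂ B] {F : PowerSeries B} {Q : ℕ → B} (h : IsLogDeriv F Q)
    (n : ℕ) :
    PowerSeries.coeff n F = newtonE Q n := by
  refine eq_newtonE (E := fun n => PowerSeries.coeff n F) ?_ (fun n => ?_) n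
  · rw [PowerSeries.coeff_zero_eq_constantCoeff_apply, h.1]
  · have := congrArg (PowerSeries.coeff n) h.2
    rw [PowerSeries.coeff_derivative, mul_comm] at this
    rw [this, mul_comm F, PowerSeries.coeff_mul,
      Finset.Nat.sum_antidiagonal_eq_sum_range_succ_mk]
    simp only [PowerSeries.coeff_mk]

theorem isLogDeriv_one : IsLogDeriv (1 : PowerSeries B) 0 := by
  refine ⟨map_one _, ?_⟩
  have : (PowerSeries.mk fun i => (-1) ^ i * (0 : ℕ → B) (i + 1)) = 0 := by
    ext i; simp
  rw [this, mul_zero, Derivation.map_one_eq_zero]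

theorem mk_logDeriv_add (Q Q' : ℕ → B) :
    (PowerSeries.mk fun i => (-1) ^ i * (Q + Q') (i + 1)) =
      (PowerSeries.mk fun i => (-1) ^ i * Q (i + 1)) +
      PowerSeries.mk fun i => (-1) ^ i * Q' (i + 1) := by
  ext i
  simp [mul_add]

theorem IsLogDeriv.mul {F F' : PowerSeries B} {Q Q' : ℕ → B} (h : IsLogDeriv F Q)
    (h' : IsLogDeriv F' Q') : IsLogDeriv (F * F') (Q + Q') := by
  refine ⟨by rw [map_mul, h.1, h'.1, one_mul], ?_⟩
  rw [Derivation.leibniz, h.2, h'.2, mk_logDeriv_add, smul_eq_mul, smul_eq_mul]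
  ring

theorem IsLogDeriv.prod {ι : Type*} (t : Finset ι) {F : ι → PowerSeries B} {Q : ι → ℕ → B}
    (h : ∀ i ∈ t, IsLogDeriv (F i) (Q i)) : IsLogDeriv (∏ i ∈ t, F i) (∑ i ∈ t, Q i) := by
  classical
  induction t using Finset.induction_on with
  | empty => simpa using isLogDeriv_one
  | insert j t hj ih =>
    rw [Finset.prod_insert hj, Finset.sum_insert hj]
    exact (h j (Finset.mem_insert_self _ _)).mul
      (ih fun i hi => h i (Finset.mem_insert_of_mem hi))

theorem IsLogDeriv.of_mul {F F' : PowerSeries B} {Q Q' : ℕ → B} (h : IsLogDeriv F Q)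
    (h' : IsLogDeriv (F * F') (Q + Q')) : IsLogDeriv F' Q' := by
  refine ⟨by simpa [h.1] using h'.1, ?_⟩
  have h1 := h'.2
  rw [Derivation.leibniz, h.2, mk_logDeriv_add, smul_eq_mul, smul_eq_mul] at h1
  have hu : IsUnit F := PowerSeries.isUnit_iff_constantCoeff.2 (h.1 ▸ isUnit_one)
  refine hu.mul_left_cancel ?_
  linear_combination h1

/-- The power series `∑ (-1)^i c^{i+1} X^i`. -/
def geomSeries (c : B) : PowerSeries B := PowerSeries.mk fun i => (-1) ^ i * c ^ (i + 1)

theorem one_add_mul_geomSeries (c : B) :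
    (1 + PowerSeries.C c * PowerSeries.X) * geomSeries c = PowerSeries.C c := by
  ext n
  rw [add_mul, one_mul, map_add, mul_assoc, PowerSeries.coeff_C_mul, PowerSeries.coeff_C]
  rcases n with _ | n
  · simp [geomSeries]
  · rw [PowerSeries.coeff_succ_X_mul, geomSeries, PowerSeries.coeff_mk, PowerSeries.coeff_mk,
      if_neg (Nat.succ_ne_zero n)]
    ring

theorem isLogDeriv_one_add (c : B) :
    IsLogDeriv (1 + PowerSeries.C c * PowerSeries.X) fun i => c ^ i := by
  refine ⟨by simp, ?_⟩
  rw [← geomSeries, one_add_mul_geomSeries, map_add, Derivation.leibniz,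
    PowerSeries.derivative_C, PowerSeries.derivative_X, Derivation.map_one_eq_zero]
  simp

theorem isLogDeriv_geomSeries (e c : B) :
    IsLogDeriv (1 + PowerSeries.C e * (PowerSeries.X * geomSeries c))
      fun i => ((1 + e) ^ i - 1) * c ^ i := by
  refine (isLogDeriv_one_add c).of_mul ?_
  have h1 : (1 + PowerSeries.C c * PowerSeries.X) *
      (1 + PowerSeries.C e * (PowerSeries.X * geomSeries c)) =
      1 + PowerSeries.C ((1 + e) * c) * PowerSeries.X := by
    rw [map_mul, map_add, map_one]
    linear_combination (PowerSeries.C e * PowerSeries.X) * one_add_mul_geomSeries c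
  have h2 : ((fun i => c ^ i) + fun i => ((1 + e) ^ i - 1) * c ^ i) =
      fun i => ((1 + e) * c) ^ i := by
    funext i
    rw [Pi.add_apply, mul_pow]
    ring
  rw [h1, h2]
  exact isLogDeriv_one_add _

theorem exists_prod_one_add_mul {R ι : Type*} [CommRing R] (t : Finset ι) (x : R) (f : ι → R) :
    ∃ c, ∏ i ∈ t, (1 + x * f i) = 1 + x * (∑ i ∈ t, f i + x * c) := by
  classical
  induction t using Finset.induction_on with
  | empty => exact ⟨0, by simp⟩
  | insert j t hj ih =>
    obtain ⟨c, hc⟩ := ih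
    refine ⟨c + f j * (∑ i ∈ t, f i + x * c), ?_⟩
    rw [Finset.prod_insert hj, Finset.sum_insert hj, hc]
    ring

end NewtonRecursion

theorem newtonE_congr {B : Type*} [CommRing B] [Algebra ℂ B] {Q Q' : ℕ → B}
    (h : ∀ i, Q (i + 1) = Q' (i + 1)) (n : ℕ) : newtonE Q n = newtonE Q' n := by
  induction n using Nat.strong_induction_on with
  | _ n ih =>
    rcases n with _ | n
    · rw [newtonE_zero, newtonE_zero]
    · rw [newtonE_succ, newtonE_succ]
      congr 1
      exact Finset.sum_congr rfl fun i _ => by rw [h, ih (n - i) (by omega)]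

section Monomials

variable {B : Type*} [CommRing B] (r s : ℕ)

/-- The monomial in a sequence `E` with exponents `x.1` for `E_1, ..., E_r`, exponents `x.2.1` for
`E_{r+1}, ..., E_{r+s}` and further exponents `x.2.2` for `E_{r+1}, E_{r+2}, ...`. -/
def monoE (E : ℕ → B) (x : (Fin r → ℕ) × (Fin s → ℕ) × (ℕ →₀ ℕ)) : B :=
  (∏ k : Fin r, E (k + 1) ^ x.1 k) *
    ((∏ k : Fin s, E (r + 1 + k) ^ x.2.1 k) * x.2.2.prod fun k m => E (r + 1 + k) ^ m)

/-- The degree of `monoE r s E x`. -/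
def monoWt (x : (Fin r → ℕ) × (Fin s → ℕ) × (ℕ →₀ ℕ)) : ℕ :=
  ∑ k : Fin r, ((k : ℕ) + 1) * x.1 k + psumFamilyWt r s x.2

theorem map_monoE {B' F : Type*} [CommRing B'] [FunLike F B B'] [RingHomClass F B B'] (φ : F)
    (E : ℕ → B) (x : (Fin r → ℕ) × (Fin s → ℕ) × (ℕ →₀ ℕ)) :
    φ (monoE r s E x) = monoE r s (fun n => φ (E n)) x := by
  simp only [monoE, map_mul, map_prod, map_pow, Finsupp.prod]

theorem monoE_mul (d v : ℕ → B) (x : (Fin r → ℕ) × (Fin s → ℕ) × (ℕ →₀ ℕ)) :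
    monoE r s (fun n => d n * v n) x = monoE r s d x * monoE r s v x := by
  simp only [monoE, Finsupp.prod, mul_pow, Finset.prod_mul_distrib]
  ring

theorem monoE_ne_zero [IsDomain B] {d : ℕ → B} (hd : ∀ n, d n ≠ 0)
    (x : (Fin r → ℕ) × (Fin s → ℕ) × (ℕ →₀ ℕ)) : monoE r s d x ≠ 0 :=
  mul_ne_zero (Finset.prod_ne_zero_iff.2 fun _ _ => pow_ne_zero _ (hd _))
    (mul_ne_zero (Finset.prod_ne_zero_iff.2 fun _ _ => pow_ne_zero _ (hd _))
      (Finset.prod_ne_zero_iff.2 fun _ _ => pow_ne_zero _ (hd _)))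

theorem finite_monoWt (S : Set (ℕ →₀ ℕ)) (n : ℕ) :
    Finite {x : (Fin r → ℕ) × (Fin s → ℕ) × S // monoWt r s (x.1, x.2.1, x.2.2) = n} :=
  finite_prodFiber (a := fun ν : Fin r → ℕ => ∑ k : Fin r, ((k : ℕ) + 1) * ν k)
    (b := fun x : (Fin s → ℕ) × S => psumFamilyWt r s (x.1, x.2)) (finite_symSeries_fiber r)
    (finite_psumFamilyWt r s S) n

end Monomials

/-- The deformed super power sums `(1 - q^i) p_i(y) + (t^i - 1) p_i(z)`. -/
def superP {R : Type*} [CommRing R] (r s : ℕ) (q t : R) (i : ℕ) :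
    MvPolynomial (Fin r ⊕ Fin s) R :=
  C (1 - q ^ i) * ∑ j, X (Sum.inl j) ^ i + C (t ^ i - 1) * ∑ l, X (Sum.inr l) ^ i

theorem map_superP {R R' : Type*} [CommRing R] [CommRing R'] (φ : R →+* R') (r s : ℕ) (q t : R)
    (i : ℕ) : map φ (superP r s q t i) = superP r s (φ q) (φ t) i := by
  simp [superP]

section Degeneration

variable {R : Type*} [CommRing R] (r s : ℕ) (δ : R)

/-- The generating series of the degenerating family. -/
def degSeries : PowerSeries (MvPolynomial (Fin r ⊕ Fin s) R) :=
  (∏ j : Fin r, (1 + PowerSeries.C (C δ * X (Sum.inl j)) * PowerSeries.X)) *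
    ∏ l : Fin s, (1 + PowerSeries.C (C (δ ^ (r + 1))) *
      (PowerSeries.X * geomSeries (X (Sum.inr l))))

theorem isLogDeriv_degSeries : IsLogDeriv (degSeries r s δ) fun i =>
    C (δ ^ i) * ∑ j, X (Sum.inl j) ^ i +
      C ((1 + δ ^ (r + 1)) ^ i - 1) * ∑ l, X (Sum.inr l) ^ i := by
  have h1 := (IsLogDeriv.prod Finset.univ fun (j : Fin r) _ =>
    isLogDeriv_one_add (C δ * X (Sum.inl j) : MvPolynomial (Fin r ⊕ Fin s) R)).mul
    (IsLogDeriv.prod Finset.univ fun (l : Fin s) _ => isLogDeriv_geomSeries (C (δ ^ (r + 1)))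
      (X (Sum.inr l) : MvPolynomial (Fin r ⊕ Fin s) R))
  have e : (fun i => C (δ ^ i) * ∑ j, X (Sum.inl j) ^ i +
      C ((1 + δ ^ (r + 1)) ^ i - 1) * ∑ l, X (Sum.inr l) ^ i :
      ℕ → MvPolynomial (Fin r ⊕ Fin s) R) =
      (∑ j : Fin r, fun i => (C δ * X (Sum.inl j)) ^ i) +
      ∑ l : Fin s, fun i => ((1 + C (δ ^ (r + 1))) ^ i - 1) * X (Sum.inr l) ^ i := by
    funext i
    simp only [Pi.add_apply, Finset.sum_apply, mul_pow, Finset.mul_sum, map_sub, map_pow, map_add,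
      map_one]
  rw [e]
  exact h1

theorem coeff_prod_one_add (n : ℕ) :
    PowerSeries.coeff n (∏ j : Fin r, (1 + PowerSeries.C (C δ * X (Sum.inl j) :
      MvPolynomial (Fin r ⊕ Fin s) R) * PowerSeries.X)) =
      C (δ ^ n) * rename Sum.inl (esymm (Fin r) R n) := by
  rw [Finset.prod_one_add, map_sum, esymm, map_sum, Finset.mul_sum,
    Finset.powersetCard_eq_filter, Finset.sum_filter]
  refine Finset.sum_congr rfl fun t _ => ?_
  rw [Finset.prod_mul_distrib, ← map_prod, Finset.prod_const, PowerSeries.coeff_C_mul_X_pow,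
    Finset.prod_mul_distrib, Finset.prod_const, map_prod]
  by_cases h : t.card = n
  · rw [if_pos h, if_pos h.symm, h, map_pow]
    simp
  · rw [if_neg h, if_neg (Ne.symm h)]

theorem esymm_eq_zero {n : ℕ} (h : r < n) : esymm (Fin r) R n = 0 := by
  rw [esymm, Finset.powersetCard_eq_empty.2 (by simpa using h), Finset.sum_empty]

theorem exists_degeneration (φ : R →+* ℂ) (hφ : φ δ = 0) :
    ∃ v : ℕ → MvPolynomial (Fin r ⊕ Fin s) R,
      (∀ n, PowerSeries.coeff n (degSeries r s δ) =
        C (if n ≤ r then δ ^ n else δ ^ (r + 1)) * v n) ∧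
      ∀ n, map φ (v n) = C (if n ≤ r then 1 else (-1) ^ (n - 1)) *
        if n ≤ r then rename Sum.inl (esymm (Fin r) ℂ n)
          else rename Sum.inr (psumOn (Finset.univ : Finset (Fin s)) n) := by
  set Y : PowerSeries (MvPolynomial (Fin r ⊕ Fin s) R) :=
    ∏ j : Fin r, (1 + PowerSeries.C (C δ * X (Sum.inl j)) * PowerSeries.X) with hY
  obtain ⟨c, hc⟩ := exists_prod_one_add_mul (Finset.univ : Finset (Fin s))
    (PowerSeries.C (C (δ ^ (r + 1)) : MvPolynomial (Fin r ⊕ Fin s) R))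
    fun l => PowerSeries.X * geomSeries (X (Sum.inr l))
  set K := ∑ l : Fin s, PowerSeries.X * geomSeries (X (Sum.inr l)) +
    PowerSeries.C (C (δ ^ (r + 1)) : MvPolynomial (Fin r ⊕ Fin s) R) * c with hK
  have h1 : ∀ n, PowerSeries.coeff n (degSeries r s δ) =
      C (δ ^ n) * rename Sum.inl (esymm (Fin r) R n) +
        C (δ ^ (r + 1)) * PowerSeries.coeff n (Y * K) := by
    intro n
    rw [degSeries, ← hY, hc, mul_add, mul_one, map_add, ← coeff_prod_one_add r s δ n, mul_left_comm,
      PowerSeries.coeff_C_mul]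
  refine ⟨fun n => if n ≤ r then rename Sum.inl (esymm (Fin r) R n) +
    C (δ ^ (r + 1 - n)) * PowerSeries.coeff n (Y * K) else PowerSeries.coeff n (Y * K),
    fun n => ?_, fun n => ?_⟩
  · rw [h1]
    beta_reduce
    generalize PowerSeries.coeff n (Y * K) = w
    split_ifs with hn
    · rw [mul_add, ← mul_assoc, ← C_mul, ← pow_add, Nat.add_sub_cancel' (by omega)]
    · rw [esymm_eq_zero r (by omega), map_zero, mul_zero, zero_add]
  · beta_reduce
    split_ifs with hn
    · rw [map_add, map_mul, map_C, map_pow, hφ, zero_pow (by omega), C_0, zero_mul, add_zero,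
        map_rename, map_esymm, C_1, one_mul]
    · have hY0 : PowerSeries.map (map φ) Y = 1 := by
        rw [hY, map_prod]
        refine Finset.prod_eq_one fun j _ => ?_
        simp [hφ]
      have hK0 : PowerSeries.map (map φ) K =
          ∑ l : Fin s, PowerSeries.X * PowerSeries.map (map φ) (geomSeries (X (Sum.inr l))) := by
        rw [hK, map_add, map_sum, map_mul, PowerSeries.map_C, map_C, map_pow, hφ,
          zero_pow (Nat.succ_ne_zero _), C_0, map_zero, zero_mul, add_zero]
        exact Finset.sum_congr rfl fun l _ => by rw [map_mul, PowerSeries.map_X]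
      obtain ⟨m, rfl⟩ : ∃ m, n = m + 1 := ⟨n - 1, by omega⟩
      rw [← PowerSeries.coeff_map, map_mul, hY0, one_mul, hK0, map_sum, psumOn, map_sum,
        Finset.mul_sum]
      refine Finset.sum_congr rfl fun l _ => ?_
      rw [PowerSeries.coeff_succ_X_mul, PowerSeries.coeff_map, geomSeries, PowerSeries.coeff_mk]
      simp

end Degeneration

theorem linearIndependent_C_mul_iff {ι σ : Type*} {v : ι → MvPolynomial σ ℂ} {d : ι → ℂ}
    (hd : ∀ i, d i ≠ 0) :
    (LinearIndependent ℂ fun i => C (d i) * v i) ↔ LinearIndependent ℂ v := by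
  rw [← LinearIndependent.units_smul_iff v fun i => Units.mk0 (d i) (hd i)]
  have e : (fun i => C (d i) * v i) = (fun i => Units.mk0 (d i) (hd i)) • v := by
    funext i
    rw [Pi.smul_apply', Units.smul_def, Units.val_mk0, smul_eq_C_mul]
  rw [e]

section LowerBound

variable (r s : ℕ)

/-- The degenerate generators `e_1(y), ..., e_r(y), p_{r+1}(z), p_{r+2}(z), ...`. -/
def limitE (n : ℕ) : MvPolynomial (Fin r ⊕ Fin s) ℂ :=
  if n ≤ r then rename Sum.inl (esymm (Fin r) ℂ n)
    else rename Sum.inr (psumOn (Finset.univ : Finset (Fin s)) n)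

theorem monoE_limitE (x : (Fin r → ℕ) × (Fin s → ℕ) × (ℕ →₀ ℕ)) :
    monoE r s (limitE r s) x = rename Sum.inl (∏ k : Fin r, esymm (Fin r) ℂ (k + 1) ^ x.1 k) *
      rename Sum.inr (psumFamily r s x.2) := by
  have h1 : ∀ k : Fin r, limitE r s (k + 1) = rename Sum.inl (esymm (Fin r) ℂ (k + 1)) :=
    fun k => if_pos (by omega)
  have h2 : ∀ k : ℕ, limitE r s (r + 1 + k) =
      rename Sum.inr (psumOn (Finset.univ : Finset (Fin s)) (r + 1 + k)) :=
    fun k => if_neg (by omega)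
  simp only [monoE, h1, h2, psumFamily, psumProd, map_mul, map_prod, map_pow, Finsupp.prod]

/-- The identification of `ℂ[y, z]` with polynomials in `y` over `ℂ[z]`. -/
def splitHom : MvPolynomial (Fin r ⊕ Fin s) ℂ →ₐ[ℂ] MvPolynomial (Fin r) (MvPolynomial (Fin s) ℂ) :=
  aeval (Sum.elim X fun l => C (X l))

theorem splitHom_inr (f : MvPolynomial (Fin s) ℂ) : splitHom r s (rename Sum.inr f) = C f := by
  induction f using MvPolynomial.induction_on with
  | C a => rw [rename_C, ← algebraMap_eq, AlgHom.commutes]; rfl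
  | add f g hf hg => rw [map_add, map_add, hf, hg, map_add]
  | mul_X f l hf => rw [map_mul, map_mul, hf, rename_X, splitHom, aeval_X, map_mul]; rfl

theorem splitHom_inl_esymm (n : ℕ) : splitHom r s (rename Sum.inl (esymm (Fin r) ℂ n)) =
    esymm (Fin r) (MvPolynomial (Fin s) ℂ) n := by
  simp only [esymm, splitHom, map_sum, map_prod, rename_X, aeval_X, Sum.elim_inl]

theorem linearIndependent_monoE_limitE {S : Set (ℕ →₀ ℕ)}
    (hS : LinearIndependent ℂ fun x : (Fin s → ℕ) × S => psumFamily r s (x.1, x.2)) :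
    LinearIndependent ℂ fun x : (Fin r → ℕ) × (Fin s → ℕ) × S =>
      monoE r s (limitE r s) (x.1, x.2.1, x.2.2) := by
  refine LinearIndependent.of_comp (splitHom r s).toLinearMap ?_
  have h := linearIndependent_smul hS (linearIndependent_esymm_prod (MvPolynomial (Fin s) ℂ) r)
  have h2 := h.comp (fun x : (Fin r → ℕ) × (Fin s → ℕ) × S => (x.2, x.1))
    (fun x y hxy => by
      simp only [Prod.mk.injEq] at hxy
      exact Prod.ext hxy.2 hxy.1)
  have e : (splitHom r s).toLinearMap ∘ (fun x : (Fin r → ℕ) × (Fin s → ℕ) × S =>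
      monoE r s (limitE r s) (x.1, x.2.1, x.2.2)) =
      (fun p : ((Fin s → ℕ) × S) × (Fin r → ℕ) => psumFamily r s (p.1.1, p.1.2) •
        ∏ i : Fin r, esymm (Fin r) (MvPolynomial (Fin s) ℂ) (i + 1) ^ p.2 i) ∘
        (fun x : (Fin r → ℕ) × (Fin s → ℕ) × S => (x.2, x.1)) := by
    funext x
    simp only [Function.comp_apply, AlgHom.toLinearMap_apply, monoE_limitE, map_mul, map_prod,
      map_pow, splitHom_inr, splitHom_inl_esymm, smul_eq_C_mul]
    rw [mul_comm]
  rw [e]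
  exact h2

theorem exists_linearIndependent_degeneration {ι : Type*} [Finite ι]
    (x : ι → (Fin r → ℕ) × (Fin s → ℕ) × (ℕ →₀ ℕ))
    (hx : LinearIndependent ℂ fun i => monoE r s (limitE r s) (x i)) :
    ∃ t : ℂ, LinearIndependent ℂ fun i => monoE r s (newtonE (superP r s 0 t)) (x i) := by
  set x₀ : Polynomial ℂ →ₐ[ℂ] ℂ := Polynomial.aeval 0 with hx₀
  obtain ⟨v, hv1, hv2⟩ := exists_degeneration r s (Polynomial.X : Polynomial ℂ)
    (x₀ : Polynomial ℂ →+* ℂ) (by simp [hx₀])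
  have h0 : LinearIndependent ℂ fun i => map (x₀ : Polynomial ℂ →+* ℂ) (monoE r s v (x i)) := by
    have e : (fun i => map (x₀ : Polynomial ℂ →+* ℂ) (monoE r s v (x i))) = fun i =>
        C (monoE r s (fun n => if n ≤ r then (1 : ℂ) else (-1) ^ (n - 1)) (x i)) *
          monoE r s (limitE r s) (x i) := by
      funext i
      rw [map_monoE, map_monoE, ← monoE_mul]
      exact congrArg (fun E => monoE r s E (x i)) (funext hv2)
    rw [e, linearIndependent_C_mul_iff fun i => monoE_ne_zero r s (fun n => ?_) (x i)]
    · exact hx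
    · split_ifs
      · exact one_ne_zero
      · exact pow_ne_zero _ (by norm_num)
  obtain ⟨p, hp, hpx⟩ := exists_linearIndependent_map _ x₀ h0
  have hp0 : p ≠ 0 := by
    rintro rfl
    exact hp (map_zero _)
  obtain ⟨δ, hδ⟩ : ∃ δ : ℂ, (Polynomial.X * p).eval δ ≠ 0 := by
    by_contra! h
    exact mul_ne_zero Polynomial.X_ne_zero hp0 (Polynomial.funext fun z => by
      rw [h z, Polynomial.eval_zero])
  rw [Polynomial.eval_mul, Polynomial.eval_X] at hδ
  have hδ0 : δ ≠ 0 := left_ne_zero_of_mul hδ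
  set y : Polynomial ℂ →ₐ[ℂ] ℂ := Polynomial.aeval δ with hy
  have hyX : y Polynomial.X = δ := by simp [hy]
  have h1 := hpx y (by rw [hy, Polynomial.coe_aeval_eq_eval]; exact right_ne_zero_of_mul hδ)
  refine ⟨1 + δ ^ (r + 1), ?_⟩
  set ψ : MvPolynomial (Fin r ⊕ Fin s) ℂ →ₐ[ℂ] MvPolynomial (Fin r ⊕ Fin s) ℂ :=
    aeval (Sum.elim (fun j => C δ * X (Sum.inl j)) fun l => X (Sum.inr l)) with hψ
  refine LinearIndependent.of_comp ψ.toLinearMap ?_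
  have hE : ∀ n, ψ (newtonE (superP r s 0 (1 + δ ^ (r + 1))) n) =
      C (if n ≤ r then δ ^ n else δ ^ (r + 1)) * map (y : Polynomial ℂ →+* ℂ) (v n) := by
    intro n
    have h2 := congrArg (mapAlgHom y)
      ((isLogDeriv_degSeries r s (Polynomial.X : Polynomial ℂ)).coeff_eq n)
    rw [hv1, map_newtonE] at h2
    rw [map_newtonE]
    refine Eq.trans (newtonE_congr (fun i => ?_) n) (h2.symm.trans ?_)
    · simp [superP, hψ, hyX, mul_pow, Finset.mul_sum]
    · rw [mapAlgHom_apply, map_mul, map_C]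
      split_ifs <;> simp [hyX]
  have e : ψ.toLinearMap ∘ (fun i => monoE r s (newtonE (superP r s 0 (1 + δ ^ (r + 1)))) (x i)) =
      fun i => C (monoE r s (fun n => if n ≤ r then δ ^ n else δ ^ (r + 1)) (x i)) *
        map (y : Polynomial ℂ →+* ℂ) (monoE r s v (x i)) := by
    funext i
    rw [Function.comp_apply, AlgHom.toLinearMap_apply, map_monoE, map_monoE, map_monoE, ← monoE_mul]
    exact congrArg (fun E => monoE r s E (x i)) (funext hE)
  rw [e, linearIndependent_C_mul_iff fun i => monoE_ne_zero r s (fun n => ?_) (x i)]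
  · exact h1
  · split_ifs <;> exact pow_ne_zero _ hδ0

/-- The evaluation homomorphism at `(q, t)`. -/
def evalHom (q t : ℂ) : MvPolynomial (Fin 2) ℂ →ₐ[ℂ] ℂ := aeval ![q, t]

theorem evalHom_apply (q t : ℂ) (p : MvPolynomial (Fin 2) ℂ) : evalHom q t p = eval ![q, t] p := by
  rw [evalHom, aeval_eq_eval]

theorem exists_linearIndependent_monoE {ι : Type*} [Finite ι]
    (x : ι → (Fin r → ℕ) × (Fin s → ℕ) × (ℕ →₀ ℕ))
    (hx : LinearIndependent ℂ fun i => monoE r s (limitE r s) (x i)) :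
    ∃ p : MvPolynomial (Fin 2) ℂ, p ≠ 0 ∧ ∀ q t : ℂ, eval ![q, t] p ≠ 0 →
      LinearIndependent ℂ fun i => monoE r s (newtonE (superP r s q t)) (x i) := by
  obtain ⟨t₀, ht₀⟩ := exists_linearIndependent_degeneration r s x hx
  have key : ∀ q t : ℂ, (fun i => map (evalHom q t : MvPolynomial (Fin 2) ℂ →+* ℂ)
      (monoE r s (newtonE (superP r s (X 0) (X 1))) (x i))) =
      fun i => monoE r s (newtonE (superP r s q t)) (x i) := by
    intro q t
    funext i
    rw [map_monoE]
    refine congrArg (fun E => monoE r s E (x i)) (funext fun n => ?_)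
    have h := map_newtonE (mapAlgHom (evalHom q t) : MvPolynomial (Fin r ⊕ Fin s)
      (MvPolynomial (Fin 2) ℂ) →ₐ[ℂ] _) (superP r s (X 0) (X 1)) n
    refine Eq.trans ?_ (h.trans (newtonE_congr (fun i => ?_) n))
    · rw [mapAlgHom_apply]
    · have h3 := map_superP (evalHom q t : MvPolynomial (Fin 2) ℂ →+* ℂ) r s (X 0) (X 1) (i + 1)
      have h4 : (evalHom q t : MvPolynomial (Fin 2) ℂ →+* ℂ) (X 0) = q := by simp [evalHom]
      have h5 : (evalHom q t : MvPolynomial (Fin 2) ℂ →+* ℂ) (X 1) = t := by simp [evalHom]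
      rw [h4, h5] at h3
      exact h3
  obtain ⟨p, hp, hpx⟩ := exists_linearIndependent_map
    (fun i => monoE r s (newtonE (superP r s (X 0) (X 1))) (x i)) (evalHom 0 t₀)
    (by rw [key]; exact ht₀)
  refine ⟨p, ?_, fun q t h => ?_⟩
  · rintro rfl
    exact hp (map_zero _)
  · rw [← key]
    exact hpx _ (by rwa [evalHom_apply])

end LowerBound

section Divisibility

variable {σ K : Type*} [DecidableEq σ] [Field K]

/-- The substitution `X i ↦ p`. -/
def substVar (i : σ) (p : MvPolynomial σ K) : MvPolynomial σ K →ₐ[K] MvPolynomial σ K :=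
  aeval (Function.update X i p)

theorem substVar_X_self (i : σ) (p : MvPolynomial σ K) : substVar i p (X i) = p := by
  rw [substVar, aeval_X, Function.update_self]

theorem substVar_X_of_ne {i j : σ} (h : j ≠ i) (p : MvPolynomial σ K) :
    substVar i p (X j) = X j := by
  rw [substVar, aeval_X, Function.update_of_ne h]

theorem X_sub_dvd_sub_substVar (i : σ) (p f : MvPolynomial σ K) :
    X i - p ∣ f - substVar i p f := by
  induction f using MvPolynomial.induction_on with
  | C a => rw [← algebraMap_eq, AlgHom.commutes, sub_self]; exact dvd_zero _
  | add f g hf hg => rw [map_add, add_sub_add_comm]; exact dvd_add hf hg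
  | mul_X f j hf =>
    have e : f * X j - substVar i p (f * X j) =
        (f - substVar i p f) * X j + substVar i p f * (X j - substVar i p (X j)) := by
      rw [map_mul]; ring
    rw [e]
    refine dvd_add (hf.mul_right _) (Dvd.dvd.mul_left ?_ _)
    by_cases h : j = i
    · rw [h, substVar_X_self]
    · rw [substVar_X_of_ne h, sub_self]; exact dvd_zero _

theorem X_sub_dvd_iff {i : σ} {p : MvPolynomial σ K} (hp : substVar i p p = p)
    {f : MvPolynomial σ K} : X i - p ∣ f ↔ substVar i p f = 0 := by
  refine ⟨fun ⟨g, hg⟩ => ?_, fun h => ?_⟩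
  · rw [hg, map_mul, map_sub, substVar_X_self, hp, sub_self, zero_mul]
  · have := X_sub_dvd_sub_substVar i p f
    rwa [h, sub_zero] at this

theorem prime_X_sub {i : σ} {p : MvPolynomial σ K} (hp : substVar i p p = p) (hi : X i ≠ p) :
    Prime (X i - p) := by
  refine ⟨sub_ne_zero.2 hi, fun h => ?_, fun f g h => ?_⟩
  · have := h.map (substVar i p)
    rw [map_sub, substVar_X_self, hp, sub_self] at this
    exact not_isUnit_zero this
  · rw [X_sub_dvd_iff hp, map_mul] at h
    rw [X_sub_dvd_iff hp, X_sub_dvd_iff hp]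
    exact mul_eq_zero.1 h

end Divisibility

theorem exists_isHomogeneous_of_dvd {σ K : Type*} [Field K] {f G : MvPolynomial σ K} {d n : ℕ}
    (hf : f.IsHomogeneous n) (hG : G.IsHomogeneous d) (h : G ∣ f) :
    ∃ g : MvPolynomial σ K, f = G * g ∧ (n < d → g = 0) ∧ g.IsHomogeneous (n - d) := by
  obtain ⟨g, rfl⟩ := h
  have h1 : homogeneousComponent n (G * g) =
      if d ≤ n then G * homogeneousComponent (n - d) g else 0 := by
    conv_lhs => rw [← sum_homogeneousComponent g, Finset.mul_sum, map_sum]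
    have h2 : ∀ k, homogeneousComponent n (G * homogeneousComponent k g) =
        if n = d + k then G * homogeneousComponent k g else 0 := fun k =>
      homogeneousComponent_of_mem (hG.mul (homogeneousComponent_isHomogeneous k g))
    simp only [h2]
    split_ifs with hd
    · rw [Finset.sum_eq_single (n - d)]
      · rw [if_pos (by omega)]
      · exact fun k _ hk => if_neg (by omega)
      · intro hk
        rw [Finset.mem_range, not_lt] at hk
        rw [homogeneousComponent_eq_zero _ _ (by omega), mul_zero, ite_self]
    · exact Finset.sum_eq_zero fun k _ => if_neg (by omega)
  rw [homogeneousComponent_eq_self hf] at h1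
  by_cases hd : d ≤ n
  · refine ⟨homogeneousComponent (n - d) g, by rw [h1, if_pos hd], fun h => absurd hd (by omega),
      homogeneousComponent_isHomogeneous _ _⟩
  · exact ⟨0, by rw [h1, if_neg hd, mul_zero], fun _ => rfl, isHomogeneous_zero _ _ _⟩

section SymmetricPolynomials

variable (r s : ℕ)

instance finite_compRS (M : Submodule ℂ (Rrs r s)) (n : ℕ) : Module.Finite ℂ (compRS r s M n) := by
  have : Module.Finite ℂ (homogeneousSubmodule (Fin r ⊕ Fin s) ℂ n) :=
    Module.Finite.iff_fg.2 (homogeneousSubmodule_fg _ _ n)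
  exact Submodule.finiteDimensional_of_le inf_le_right

/-- The polynomials in `y, z` symmetric in `y` and in `z`. -/
def symmAlg : Subalgebra ℂ (Rrs r s) :=
  ⨅ (π : Equiv.Perm (Fin r)) (π' : Equiv.Perm (Fin s)),
    AlgHom.equalizer (rename (Sum.map π π')) (AlgHom.id ℂ (Rrs r s))

variable {r s}

theorem mem_symmAlg {f : Rrs r s} : f ∈ symmAlg r s ↔
    ∀ (π : Equiv.Perm (Fin r)) (π' : Equiv.Perm (Fin s)), rename (Sum.map π π') f = f := by
  simp only [symmAlg, Algebra.mem_iInf, AlgHom.mem_equalizer, AlgHom.id_apply]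

variable (r s)

/-- The restriction `z_0 ↦ 0`, with the remaining `z` renumbered. -/
def restrictZ : Rrs r (s + 1) →ₐ[ℂ] Rrs r s :=
  aeval (Sum.elim (fun j => X (Sum.inl j)) (Fin.cons 0 fun l => X (Sum.inr l)))

theorem restrictZ_X_inl (j : Fin r) : restrictZ r s (X (Sum.inl j)) = X (Sum.inl j) := by
  rw [restrictZ, aeval_X, Sum.elim_inl]

theorem restrictZ_X_zero : restrictZ r s (X (Sum.inr 0)) = 0 := by
  rw [restrictZ, aeval_X, Sum.elim_inr, Fin.cons_zero]

theorem restrictZ_X_succ (l : Fin s) : restrictZ r s (X (Sum.inr l.succ)) = X (Sum.inr l) := by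
  rw [restrictZ, aeval_X, Sum.elim_inr, Fin.cons_succ]

variable {r s}

theorem restrictZ_isHomogeneous {f : Rrs r (s + 1)} {n : ℕ} (hf : f.IsHomogeneous n) :
    (restrictZ r s f).IsHomogeneous n := by
  have := hf.aeval (Sum.elim (fun j => X (Sum.inl j)) (Fin.cons 0 fun l => X (Sum.inr l)) :
    Fin r ⊕ Fin (s + 1) → Rrs r s) (n := 1) (by
      rintro (j | l)
      · exact isHomogeneous_X _ _
      · refine Fin.cases ?_ (fun l => ?_) l
        · exact isHomogeneous_zero _ _ _
        · exact isHomogeneous_X _ _)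
  rwa [one_mul] at this

theorem restrictZ_mem_symmAlg {f : Rrs r (s + 1)} (hf : f ∈ symmAlg r (s + 1)) :
    restrictZ r s f ∈ symmAlg r s := by
  rw [mem_symmAlg] at hf ⊢
  intro π π'
  have h : (rename (Sum.map π π') : Rrs r s →ₐ[ℂ] Rrs r s).comp (restrictZ r s) =
      (restrictZ r s).comp (rename (Sum.map π (Equiv.Perm.decomposeFin.symm (0, π')))) := by
    refine algHom_ext fun i => ?_
    rw [AlgHom.comp_apply, AlgHom.comp_apply, rename_X]
    rcases i with j | l
    · rw [restrictZ_X_inl, rename_X, Sum.map_inl, Sum.map_inl, restrictZ_X_inl]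
    · refine Fin.cases ?_ (fun l => ?_) l
      · rw [restrictZ_X_zero, Sum.map_inr, Equiv.Perm.decomposeFin_symm_apply_zero,
          restrictZ_X_zero, map_zero]
      · rw [restrictZ_X_succ, Sum.map_inr, Equiv.Perm.decomposeFin_symm_apply_succ,
          Equiv.swap_self, Equiv.refl_apply, restrictZ_X_succ, rename_X, Sum.map_inr]
  have h2 := DFunLike.congr_fun h f
  rw [AlgHom.comp_apply, AlgHom.comp_apply, hf] at h2
  exact h2

theorem substVar_zero_of_restrictZ_eq_zero {f : Rrs r (s + 1)} (hf : f ∈ symmAlg r (s + 1))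
    (h0 : restrictZ r s f = 0) (l : Fin (s + 1)) : substVar (Sum.inr l) 0 f = 0 := by
  have h : substVar (Sum.inr l) 0 =
      ((rename (Sum.map id (Equiv.swap 0 l)) : Rrs r (s + 1) →ₐ[ℂ] Rrs r (s + 1)).comp
        ((rename (Sum.map id Fin.succ)).comp (restrictZ r s))).comp
        (rename (Sum.map (Equiv.refl _) (Equiv.swap 0 l))) := by
    refine algHom_ext fun i => ?_
    simp only [AlgHom.comp_apply, rename_X]
    rcases i with j | k
    · rw [substVar_X_of_ne Sum.inl_ne_inr, Sum.map_inl, restrictZ_X_inl]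
      simp
    · rw [Sum.map_inr]
      by_cases hk : k = l
      · rw [hk, substVar_X_self, Equiv.swap_apply_right, restrictZ_X_zero, map_zero, map_zero]
      · rw [substVar_X_of_ne (by simpa using hk)]
        obtain ⟨m, hm⟩ : ∃ m, Equiv.swap 0 l k = Fin.succ m :=
          (Fin.exists_succ_eq_of_ne_zero fun (h : Equiv.swap 0 l k = 0) => hk (by
            rw [← Equiv.swap_apply_self 0 l k, h, Equiv.swap_apply_left])).imp fun _ h => h.symm
        rw [hm, restrictZ_X_succ, rename_X, rename_X, Sum.map_inr, Sum.map_inr, ← hm,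
          Equiv.swap_apply_self]
  rw [h, AlgHom.comp_apply, mem_symmAlg.1 hf, AlgHom.comp_apply, AlgHom.comp_apply, h0, map_zero,
    map_zero]

/-- `0` for `none` and `y_j` for `some j`. -/
def zeroOrY (r s : ℕ) : Option (Fin r) → Rrs r s
  | none => 0
  | some j => X (Sum.inl j)

theorem zeroOrY_injective : Function.Injective (zeroOrY r s) := by
  rintro (_ | i) (_ | j) h
  · rfl
  · exact absurd h.symm (X_ne_zero _)
  · exact absurd h (X_ne_zero _)
  · rw [Sum.inl_injective (X_injective h)]

theorem X_inr_ne_zeroOrY (l : Fin s) (o : Option (Fin r)) : X (Sum.inr l) ≠ zeroOrY r s o := by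
  rcases o with _ | j
  · exact X_ne_zero _
  · exact fun h => Sum.inr_ne_inl (X_injective h)

theorem substVar_zeroOrY (l : Fin s) (p : Rrs r s) (o : Option (Fin r)) :
    substVar (Sum.inr l) p (zeroOrY r s o) = zeroOrY r s o := by
  rcases o with _ | j
  · exact map_zero _
  · exact substVar_X_of_ne Sum.inl_ne_inr _

/-- The product of the linear forms `z_l - p`, where `p` is `0` or one of the `y_j`, as selected by
`T`. -/
def linProd (r s : ℕ) (T : Finset (Option (Fin r))) : Rrs r s :=
  ∏ x ∈ T ×ˢ (Finset.univ : Finset (Fin s)), (X (Sum.inr x.2) - zeroOrY r s x.1)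

theorem linProd_ne_zero (T : Finset (Option (Fin r))) : linProd r s T ≠ 0 :=
  Finset.prod_ne_zero_iff.2 fun _ _ => sub_ne_zero.2 (X_inr_ne_zeroOrY _ _)

theorem linProd_isHomogeneous (T : Finset (Option (Fin r))) :
    (linProd r s T).IsHomogeneous (T.card * s) := by
  have := IsHomogeneous.prod (T ×ˢ (Finset.univ : Finset (Fin s)))
    (fun x => X (Sum.inr x.2) - zeroOrY r s x.1) (fun _ => 1) fun x _ => by
      refine (isHomogeneous_X ℂ _).sub ?_
      rcases x.1 with _ | j
      · exact isHomogeneous_zero _ _ _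
      · exact isHomogeneous_X _ _
  rwa [Finset.sum_const, Finset.card_product, Finset.card_univ, Fintype.card_fin, smul_eq_mul,
    mul_one] at this

theorem linProd_mem_symmAlg {T : Finset (Option (Fin r))}
    (hT : ∀ (π : Equiv.Perm (Fin r)) o, o ∈ T → Option.map π o ∈ T) :
    linProd r s T ∈ symmAlg r s := by
  rw [mem_symmAlg]
  intro π π'
  have h : ∀ o, rename (Sum.map π π') (zeroOrY r s o) = zeroOrY r s (Option.map π o) := by
    rintro (_ | j)
    · exact map_zero _
    · rw [zeroOrY, rename_X]; rfl
  rw [linProd, map_prod]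
  refine Finset.prod_bij' (fun x _ => (Option.map π x.1, π' x.2))
    (fun x _ => (Option.map π.symm x.1, π'.symm x.2)) (fun x hx => ?_) (fun x hx => ?_)
    (fun x _ => ?_) (fun x _ => ?_) (fun x _ => ?_)
  · rw [Finset.mem_product] at hx ⊢
    exact ⟨hT π _ hx.1, Finset.mem_univ _⟩
  · rw [Finset.mem_product] at hx ⊢
    exact ⟨hT π.symm _ hx.1, Finset.mem_univ _⟩
  · simp
  · simp
  · rw [map_sub, h, rename_X, Sum.map_inr]

theorem linProd_dvd {T : Finset (Option (Fin r))} {f : Rrs r s}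
    (h : ∀ o ∈ T, ∀ l, substVar (Sum.inr l) (zeroOrY r s o) f = 0) : linProd r s T ∣ f := by
  refine Finset.prod_dvd_of_isRelPrime (fun x _ y _ hxy => ?_) fun x hx => ?_
  · refine (prime_X_sub (substVar_zeroOrY _ _ _)
      (X_inr_ne_zeroOrY _ _)).irreducible.isRelPrime_iff_not_dvd.2 fun hd => ?_
    rw [X_sub_dvd_iff (substVar_zeroOrY _ _ _), map_sub, substVar_zeroOrY] at hd
    by_cases hl : y.2 = x.2
    · rw [hl, substVar_X_self, sub_eq_zero] at hd
      exact hxy (Prod.ext (zeroOrY_injective hd) hl.symm)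
    · rw [substVar_X_of_ne (by simpa using hl), sub_eq_zero] at hd
      exact X_inr_ne_zeroOrY _ _ hd
  · rw [Finset.mem_product] at hx
    exact (X_sub_dvd_iff (substVar_zeroOrY _ _ _)).2 (h _ hx.1 _)

theorem mem_symmAlg_of_mul {f g : Rrs r s} (hf : f ∈ symmAlg r s) (hf0 : f ≠ 0)
    (hfg : f * g ∈ symmAlg r s) : g ∈ symmAlg r s := by
  rw [mem_symmAlg] at *
  intro π π'
  have := hfg π π'
  rw [map_mul, hf] at this
  exact mul_left_cancel₀ hf0 this

theorem finrank_compRS_le_add {V V'' : Submodule ℂ (Rrs r (s + 1))} {V' : Submodule ℂ (Rrs r s)}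
    {G : Rrs r (s + 1)} {d : ℕ} (hG : G.IsHomogeneous d) (h1 : ∀ f ∈ V, restrictZ r s f ∈ V')
    (h2 : ∀ f ∈ V, restrictZ r s f = 0 → G ∣ f) (h3 : ∀ g, G * g ∈ V → g ∈ V'') (n : ℕ) :
    Module.finrank ℂ (compRS r (s + 1) V n) ≤ Module.finrank ℂ (compRS r s V' n) +
      if d ≤ n then Module.finrank ℂ (compRS r (s + 1) V'' (n - d)) else 0 := by
  set φ := (restrictZ r s).toLinearMap.domRestrict (compRS r (s + 1) V n) with hφ
  rw [← LinearMap.finrank_range_add_finrank_ker φ]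
  refine add_le_add (Submodule.finrank_mono ?_) ?_
  · rintro _ ⟨f, rfl⟩
    exact ⟨h1 _ f.2.1, restrictZ_isHomogeneous f.2.2⟩
  · have hk : ∀ f ∈ LinearMap.ker φ, ∃ g, (f : Rrs r (s + 1)) = G * g ∧ (n < d → g = 0) ∧
        g.IsHomogeneous (n - d) := fun f hf =>
      exists_isHomogeneous_of_dvd f.2.2 hG (h2 _ f.2.1 (by simpa [hφ] using hf))
    split_ifs with hd
    · rw [← Submodule.finrank_map_subtype_eq]
      refine (Submodule.finrank_mono
        (t := (compRS r (s + 1) V'' (n - d)).map (LinearMap.mulLeft ℂ G))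
        ?_).trans (Submodule.finrank_map_le _ _)
      rintro _ ⟨f, hf, rfl⟩
      obtain ⟨g, hg, -, hgd⟩ := hk f hf
      refine ⟨g, ⟨h3 g ?_, hgd⟩, ?_⟩
      · rw [← hg]; exact f.2.1
      · rw [LinearMap.mulLeft_apply, ← hg]; rfl
    · have : LinearMap.ker φ = ⊥ := by
        rw [eq_bot_iff]
        intro f hf
        obtain ⟨g, hg, hg0, -⟩ := hk f hf
        rw [hg0 (by omega), mul_zero] at hg
        exact (Submodule.mem_bot ℂ).2 (Subtype.ext hg)
      rw [this, finrank_bot]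

end SymmetricPolynomials

theorem symSeries_zero : symSeries 0 = 1 := by
  have := symSeries_mul_uu 0
  rwa [uu, Finset.range_zero, Finset.prod_empty, mul_one] at this

theorem symSeries_succ (k : ℕ) :
    symSeries (k + 1) = symSeries k + PowerSeries.X ^ (k + 1) * symSeries (k + 1) := by
  have h1 := symSeries_mul_uu k
  have h2 := symSeries_mul_uu (k + 1)
  rw [uu, Finset.prod_range_succ] at h2
  refine mul_right_cancel₀ (uu_ne_zero k) ?_
  rw [add_mul, h1, ← h2, uu]
  ring

theorem coe_le_coeff_mul_symSeries {F : PowerSeries ℚ} {u : ℕ → ℕ → ℕ}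
    (h0 : ∀ n, (u 0 n : ℚ) ≤ PowerSeries.coeff n F)
    (h : ∀ k n, u (k + 1) n ≤ u k n + if k + 1 ≤ n then u (k + 1) (n - (k + 1)) else 0) (k n : ℕ) :
    (u k n : ℚ) ≤ PowerSeries.coeff n (F * symSeries k) := by
  induction k generalizing n with
  | zero => rw [symSeries_zero, mul_one]; exact h0 n
  | succ k ih =>
    induction n using Nat.strong_induction_on with
    | _ n ihn =>
      rw [symSeries_succ, mul_add, mul_left_comm, map_add, PowerSeries.coeff_X_pow_mul']
      have h1 : (u (k + 1) n : ℚ) ≤ u k n +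
          if k + 1 ≤ n then (u (k + 1) (n - (k + 1)) : ℚ) else 0 := by
        exact_mod_cast h k n
      refine h1.trans (add_le_add (ih n) ?_)
      split_ifs with hn
      · exact ihn _ (by omega)
      · exact le_rfl

theorem finrank_symmAlg_zero (n : ℕ) :
    (Module.finrank ℂ (compRS 0 0 (Subalgebra.toSubmodule (symmAlg 0 0)) n) : ℚ) ≤
      PowerSeries.coeff n (1 : PowerSeries ℚ) := by
  rw [PowerSeries.coeff_one]
  split_ifs with hn
  · have h1 : compRS 0 0 (Subalgebra.toSubmodule (symmAlg 0 0)) n ≤ Submodule.span ℂ {1} := by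
      intro f _
      rw [eq_C_of_isEmpty f, Submodule.mem_span_singleton]
      exact ⟨_, by rw [smul_eq_C_mul, mul_one]⟩
    have h2 := (Submodule.finrank_mono h1).trans (finrank_span_le_card ({1} : Set (Rrs 0 0)))
    simp only [Set.toFinset_singleton, Finset.card_singleton] at h2
    exact_mod_cast h2
  · have h1 : compRS 0 0 (Subalgebra.toSubmodule (symmAlg 0 0)) n = ⊥ := by
      rw [eq_bot_iff]
      intro f hf
      by_contra hf0
      refine hn (IsHomogeneous.inj_right hf.2 ?_ hf0)
      rw [eq_C_of_isEmpty f]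
      exact isHomogeneous_C _ _
    rw [h1, finrank_bot, Nat.cast_zero]

theorem finrank_symmAlg_succ (r s n : ℕ) :
    Module.finrank ℂ (compRS r (s + 1) (Subalgebra.toSubmodule (symmAlg r (s + 1))) n) ≤
      Module.finrank ℂ (compRS r s (Subalgebra.toSubmodule (symmAlg r s)) n) +
      if s + 1 ≤ n then Module.finrank ℂ
        (compRS r (s + 1) (Subalgebra.toSubmodule (symmAlg r (s + 1))) (n - (s + 1))) else 0 := by
  have hd := linProd_isHomogeneous (s := s + 1) ({none} : Finset (Option (Fin r)))
  rw [Finset.card_singleton, one_mul] at hd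
  refine finrank_compRS_le_add hd (fun f hf => restrictZ_mem_symmAlg hf) (fun f hf h0 => ?_)
    (fun g hg => mem_symmAlg_of_mul (linProd_mem_symmAlg fun π o ho => ?_) (linProd_ne_zero _) hg) n
  · refine linProd_dvd fun o ho l => ?_
    rw [Finset.mem_singleton.1 ho]
    exact substVar_zero_of_restrictZ_eq_zero hf h0 l
  · rw [Finset.mem_singleton.1 ho]
    exact Finset.mem_singleton_self _

theorem finrank_symmAlg_swap (r n : ℕ) :
    Module.finrank ℂ (compRS r 0 (Subalgebra.toSubmodule (symmAlg r 0)) n) ≤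
      Module.finrank ℂ (compRS 0 r (Subalgebra.toSubmodule (symmAlg 0 r)) n) := by
  have hinj : Function.Injective (rename Sum.swap : Rrs r 0 →ₐ[ℂ] Rrs 0 r).toLinearMap :=
    rename_injective _ Sum.swap_leftInverse.injective
  rw [(Submodule.equivMapOfInjective _ hinj _).finrank_eq]
  refine Submodule.finrank_mono ?_
  rintro _ ⟨f, hf, rfl⟩
  refine ⟨mem_symmAlg.2 fun π π' => ?_, hf.2.rename_isHomogeneous⟩
  have h := mem_symmAlg.1 hf.1 π' π
  rw [AlgHom.toLinearMap_apply]
  nth_rw 2 [← h]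
  rw [rename_rename, rename_rename]
  congr 2
  funext x
  rcases x with _ | x <;> rfl

theorem finrank_symmAlg_le (r s n : ℕ) :
    (Module.finrank ℂ (compRS r s (Subalgebra.toSubmodule (symmAlg r s)) n) : ℚ) ≤
      PowerSeries.coeff n (symSeries r * symSeries s) := by
  refine coe_le_coeff_mul_symSeries (u := fun s n =>
    Module.finrank ℂ (compRS r s (Subalgebra.toSubmodule (symmAlg r s)) n)) (fun n => ?_)
    (finrank_symmAlg_succ r) s n
  have h := coe_le_coeff_mul_symSeries (F := 1) (u := fun s n =>
    Module.finrank ℂ (compRS 0 s (Subalgebra.toSubmodule (symmAlg 0 s)) n)) finrank_symmAlg_zero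
    (finrank_symmAlg_succ 0) r n
  rw [one_mul] at h
  exact (Nat.cast_le.2 (finrank_symmAlg_swap r n)).trans h

section PairEvaluation

variable {R : Type*} [CommRing R] {r s : ℕ}

/-- The substitution `y_i ↦ c y_i`, `z_j ↦ d y_i`. -/
def evPair (c d : R) (i : Fin r) (j : Fin s) :
    MvPolynomial (Fin r ⊕ Fin s) R →ₐ[R] MvPolynomial (Fin r ⊕ Fin s) R :=
  aeval (Sum.elim (fun k => if k = i then C c * X (Sum.inl i) else X (Sum.inl k))
    fun l => if l = j then C d * X (Sum.inl i) else X (Sum.inr l))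

theorem evPair_X_inl (c d : R) (i : Fin r) (j : Fin s) (k : Fin r) :
    evPair c d i j (X (Sum.inl k)) = if k = i then C c * X (Sum.inl i) else X (Sum.inl k) := by
  rw [evPair, aeval_X, Sum.elim_inl]

theorem evPair_X_inr (c d : R) (i : Fin r) (j : Fin s) (l : Fin s) :
    evPair c d i j (X (Sum.inr l)) = if l = j then C d * X (Sum.inl i) else X (Sum.inr l) := by
  rw [evPair, aeval_X, Sum.elim_inr]

theorem map_evPair {R' : Type*} [CommRing R'] (φ : R →+* R') (c d : R) (i : Fin r) (j : Fin s)
    (f : MvPolynomial (Fin r ⊕ Fin s) R) :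
    map φ (evPair c d i j f) = evPair (φ c) (φ d) i j (map φ f) := by
  induction f using MvPolynomial.induction_on with
  | C a => simp only [← algebraMap_eq, AlgHom.commutes]; simp [algebraMap_eq]
  | add f g hf hg => simp only [map_add, hf, hg]
  | mul_X f k hf =>
    rw [map_mul, map_mul, hf, map_mul, map_mul, map_X]
    congr 1
    rcases k with k | k
    · rw [evPair_X_inl, evPair_X_inl]
      split_ifs <;> simp
    · rw [evPair_X_inr, evPair_X_inr]
      split_ifs <;> simp

theorem evPair_rename (c d : R) (i : Fin r) (j : Fin s) (π : Equiv.Perm (Fin r))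
    (π' : Equiv.Perm (Fin s)) (f : MvPolynomial (Fin r ⊕ Fin s) R) :
    evPair c d (π i) (π' j) (rename (Sum.map π π') f) =
      rename (Sum.map π π') (evPair c d i j f) := by
  have h : (evPair c d (π i) (π' j)).comp (rename (Sum.map π π')) =
      (rename (Sum.map π π') : MvPolynomial (Fin r ⊕ Fin s) R →ₐ[R] _).comp (evPair c d i j) := by
    refine algHom_ext fun k => ?_
    rw [AlgHom.comp_apply, AlgHom.comp_apply, rename_X]
    rcases k with k | k
    · rw [Sum.map_inl, evPair_X_inl, evPair_X_inl]
      simp only [π.injective.eq_iff]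
      split_ifs <;> simp
    · rw [Sum.map_inr, evPair_X_inr, evPair_X_inr]
      simp only [π'.injective.eq_iff]
      split_ifs <;> simp
  exact DFunLike.congr_fun h f

end PairEvaluation

/-- The symmetric polynomials whose substitutions `y_i ↦ t w, z_j ↦ q w` and `y_i, z_j ↦ w`
agree. -/
def superAlg (r s : ℕ) (q t : ℂ) : Subalgebra ℂ (Rrs r s) :=
  symmAlg r s ⊓ ⨅ (i : Fin r) (j : Fin s), AlgHom.equalizer (evPair t q i j) (evPair 1 1 i j)

theorem mem_superAlg {r s : ℕ} {q t : ℂ} {f : Rrs r s} : f ∈ superAlg r s q t ↔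
    f ∈ symmAlg r s ∧ ∀ i j, evPair t q i j f = evPair 1 1 i j f := by
  simp only [superAlg, Algebra.mem_inf, Algebra.mem_iInf, AlgHom.mem_equalizer]

theorem superP_mem_superAlg (r s : ℕ) (q t : ℂ) (n : ℕ) : superP r s q t n ∈ superAlg r s q t := by
  rw [mem_superAlg, mem_symmAlg]
  refine ⟨fun π π' => ?_, fun i j => ?_⟩
  · simp only [superP, map_add, map_mul, map_sum, map_pow, rename_X, rename_C, Sum.map_inl,
      Sum.map_inr]
    rw [Equiv.sum_comp π fun j => (X (Sum.inl j) : Rrs r s) ^ n,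
      Equiv.sum_comp π' fun j => (X (Sum.inr j) : Rrs r s) ^ n]
  · have h : ∀ c d : ℂ, evPair c d i j (superP r s q t n) =
        C (1 - q ^ n) * (C c ^ n * X (Sum.inl i) ^ n +
          ∑ k ∈ Finset.univ.erase i, X (Sum.inl k) ^ n) +
        C (t ^ n - 1) * (C d ^ n * X (Sum.inl i) ^ n +
          ∑ k ∈ Finset.univ.erase j, X (Sum.inr k) ^ n) := by
      intro c d
      have hC : ∀ a : ℂ, evPair c d i j (C a : Rrs r s) = C a := fun a => AlgHom.commutes _ a
      rw [superP, map_add, map_mul, map_mul, hC, hC, map_sum, map_sum,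
        ← Finset.add_sum_erase _ _ (Finset.mem_univ i),
        ← Finset.add_sum_erase _ _ (Finset.mem_univ j)]
      rw [map_pow, map_pow, evPair_X_inl, evPair_X_inr, if_pos rfl, if_pos rfl, mul_pow, mul_pow]
      congr 3
      · exact Finset.sum_congr rfl fun k hk => by
          rw [map_pow, evPair_X_inl, if_neg (Finset.ne_of_mem_erase hk)]
      · exact Finset.sum_congr rfl fun k hk => by
          rw [map_pow, evPair_X_inr, if_neg (Finset.ne_of_mem_erase hk)]
    rw [h, h]
    simp only [map_sub, map_pow, map_one, one_pow]
    ring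

section Degenerate

variable {r s : ℕ}

theorem restrictZ_evPair (c d : ℂ) (i : Fin r) (j : Fin s) (f : Rrs r (s + 1)) :
    restrictZ r s (evPair c d i j.succ f) = evPair c d i j (restrictZ r s f) := by
  have hC : ∀ a : ℂ, restrictZ r s (C a) = C a := fun a => AlgHom.commutes _ a
  have h : (restrictZ r s).comp (evPair c d i j.succ) = (evPair c d i j).comp (restrictZ r s) := by
    refine algHom_ext fun k => ?_
    rw [AlgHom.comp_apply, AlgHom.comp_apply]
    rcases k with k | k
    · rw [restrictZ_X_inl, evPair_X_inl, evPair_X_inl]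
      split_ifs
      · rw [map_mul, hC, restrictZ_X_inl]
      · rw [restrictZ_X_inl]
    · refine Fin.cases ?_ (fun l => ?_) k
      · rw [evPair_X_inr, if_neg (Fin.succ_ne_zero j).symm, restrictZ_X_zero, map_zero]
      · rw [restrictZ_X_succ, evPair_X_inr, evPair_X_inr]
        simp only [Fin.succ_inj]
        split_ifs
        · rw [map_mul, hC, restrictZ_X_inl]
        · rw [restrictZ_X_succ]
  exact DFunLike.congr_fun h f

theorem evPair_zero (i : Fin r) (j : Fin s) (f : Rrs r s) :
    evPair 0 0 i j f = substVar (Sum.inl i) 0 (substVar (Sum.inr j) 0 f) := by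
  have h : evPair 0 0 i j = (substVar (Sum.inl i) 0 : Rrs r s →ₐ[ℂ] Rrs r s).comp
      (substVar (Sum.inr j) 0) := by
    refine algHom_ext fun k => ?_
    rw [AlgHom.comp_apply]
    rcases k with k | k
    · rw [substVar_X_of_ne Sum.inl_ne_inr, evPair_X_inl]
      split_ifs with h
      · rw [h, substVar_X_self, C_0, zero_mul]
      · rw [substVar_X_of_ne (by simpa using h)]
    · rw [evPair_X_inr]
      split_ifs with h
      · rw [h, substVar_X_self, C_0, zero_mul, map_zero]
      · rw [substVar_X_of_ne (by simpa using h), substVar_X_of_ne Sum.inr_ne_inl]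
  exact DFunLike.congr_fun h f

theorem evPair_one (i : Fin r) (j : Fin s) (f : Rrs r s) :
    evPair 1 1 i j f = substVar (Sum.inr j) (X (Sum.inl i)) f := by
  have h : evPair 1 1 i j = (substVar (Sum.inr j) (X (Sum.inl i)) : Rrs r s →ₐ[ℂ] Rrs r s) := by
    refine algHom_ext fun k => ?_
    rcases k with k | k
    · rw [substVar_X_of_ne Sum.inl_ne_inr, evPair_X_inl]
      split_ifs with h
      · rw [h, C_1, one_mul]
      · rfl
    · rw [evPair_X_inr]
      split_ifs with h
      · rw [h, substVar_X_self, C_1, one_mul]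
      · rw [substVar_X_of_ne (by simpa using h)]
  exact DFunLike.congr_fun h f

theorem mem_superAlg_zero_of_pair {f : Rrs r s} (hf : f ∈ symmAlg r s) (i : Fin r) (j : Fin s)
    (h : evPair 0 0 i j f = evPair 1 1 i j f) : f ∈ superAlg r s 0 0 := by
  refine mem_superAlg.2 ⟨hf, fun i' j' => ?_⟩
  have h1 := mem_symmAlg.1 hf (Equiv.swap i i') (Equiv.swap j j')
  have h2 : ∀ c d : ℂ, evPair c d i' j' f =
      rename (Sum.map (Equiv.swap i i') (Equiv.swap j j')) (evPair c d i j f) := fun c d => by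
    rw [← evPair_rename, h1, Equiv.swap_apply_left, Equiv.swap_apply_left]
  rw [h2, h2, h]

end Degenerate

theorem finrank_superAlg_zero_succ (r s n : ℕ) :
    Module.finrank ℂ (compRS r (s + 1) (Subalgebra.toSubmodule (superAlg r (s + 1) 0 0)) n) ≤
      Module.finrank ℂ (compRS r s (Subalgebra.toSubmodule (superAlg r s 0 0)) n) +
      if (r + 1) * (s + 1) ≤ n then Module.finrank ℂ
        (compRS r (s + 1) (Subalgebra.toSubmodule (symmAlg r (s + 1))) (n - (r + 1) * (s + 1)))
      else 0 := by
  have hd := linProd_isHomogeneous (s := s + 1) (Finset.univ : Finset (Option (Fin r)))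
  rw [Finset.card_univ, Fintype.card_option, Fintype.card_fin] at hd
  refine finrank_compRS_le_add hd (fun f hf => ?_) (fun f hf h0 => ?_)
    (fun g hg => mem_symmAlg_of_mul (linProd_mem_symmAlg fun π o ho => Finset.mem_univ _)
      (linProd_ne_zero _) (mem_superAlg.1 hg).1) n
  · obtain ⟨h1, h2⟩ := mem_superAlg.1 hf
    exact mem_superAlg.2 ⟨restrictZ_mem_symmAlg h1, fun i j => by
      rw [← restrictZ_evPair, ← restrictZ_evPair, h2]⟩
  · obtain ⟨h1, h2⟩ := mem_superAlg.1 hf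
    have h3 := substVar_zero_of_restrictZ_eq_zero h1 h0
    refine linProd_dvd fun o _ l => ?_
    rcases o with _ | i
    · exact h3 l
    · have := h2 i l
      rw [evPair_one, evPair_zero, h3, map_zero] at this
      exact this.symm

theorem finrank_superAlg_zero_le (r s n : ℕ) :
    (Module.finrank ℂ (compRS r s (Subalgebra.toSubmodule (superAlg r s 0 0)) n) : ℚ) ≤
      PowerSeries.coeff n (symSeries r * dSeries r s) := by
  induction s generalizing n with
  | zero =>
    have h1 : compRS r 0 (Subalgebra.toSubmodule (superAlg r 0 0 0)) n ≤
        compRS r 0 (Subalgebra.toSubmodule (symmAlg r 0)) n :=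
      inf_le_inf_right _ fun f hf => (mem_superAlg.1 hf).1
    have h2 := finrank_symmAlg_le r 0 n
    rw [symSeries_zero] at h2
    rw [dSeries, zero_add, Finset.sum_range_one, zero_mul, pow_zero, one_mul, symSeries_zero]
    exact (Nat.cast_le.2 (Submodule.finrank_mono h1)).trans h2
  | succ s ih =>
    have h1 : symSeries r * dSeries r (s + 1) = symSeries r * dSeries r s +
        PowerSeries.X ^ ((r + 1) * (s + 1)) * (symSeries r * symSeries (s + 1)) := by
      rw [dSeries, Finset.sum_range_succ, ← dSeries, mul_comm (r + 1)]
      ring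
    rw [h1, map_add, PowerSeries.coeff_X_pow_mul']
    have h2 := Nat.cast_le (α := ℚ).2 (finrank_superAlg_zero_succ r s n)
    rw [Nat.cast_add] at h2
    refine h2.trans (add_le_add (ih n) ?_)
    split_ifs
    · exact finrank_symmAlg_le _ _ _
    · exact Nat.cast_zero.le

/-- Upper semicontinuity of the dimension of the kernel in an algebraic family. -/
theorem exists_finrank_ker_le {P σ : Type*} [CommRing P] [Algebra ℂ P]
    (V : Submodule ℂ (MvPolynomial σ ℂ)) [Module.Finite ℂ V]
    (δ : (P →ₐ[ℂ] ℂ) → MvPolynomial σ ℂ →ₗ[ℂ] MvPolynomial σ ℂ)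
    (F : MvPolynomial σ ℂ → MvPolynomial σ P)
    (hF : ∀ (x : P →ₐ[ℂ] ℂ) f, map (x : P →+* ℂ) (F f) = δ x f) (x₀ : P →ₐ[ℂ] ℂ) :
    ∃ p : P, x₀ p ≠ 0 ∧ ∀ x : P →ₐ[ℂ] ℂ, x p ≠ 0 →
      Module.finrank ℂ (LinearMap.ker ((δ x).domRestrict V)) ≤
        Module.finrank ℂ (LinearMap.ker ((δ x₀).domRestrict V)) := by
  set b := Module.finBasis ℂ (LinearMap.range ((δ x₀).domRestrict V)) with hb
  choose v hv using fun i => LinearMap.mem_range.1 (b i).2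
  have h0 : LinearIndependent ℂ fun i => map (x₀ : P →+* ℂ) (F (v i)) := by
    have h1 := b.linearIndependent.map' (Submodule.subtype _) (Submodule.ker_subtype _)
    have e : (fun i => map (x₀ : P →+* ℂ) (F (v i))) =
        (LinearMap.range ((δ x₀).domRestrict V)).subtype ∘ b :=
      funext fun i => (hF _ _).trans (hv i)
    rwa [e]
  obtain ⟨p, hp, hpx⟩ := exists_linearIndependent_map _ x₀ h0
  refine ⟨p, hp, fun x hx => ?_⟩
  have h1 : LinearIndependent ℂ fun i => (δ x).domRestrict V (v i) := by
    have e : (fun i => (δ x).domRestrict V (v i)) = fun i => map (x : P →+* ℂ) (F (v i)) :=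
      funext fun i => (hF _ _).symm
    rw [e]
    exact hpx x hx
  have h2 : LinearIndependent ℂ fun i => (δ x).domRestrict V |>.rangeRestrict (v i) :=
    LinearIndependent.of_comp (Submodule.subtype _) h1
  have h3 := h2.fintype_card_le_finrank
  rw [Fintype.card_fin] at h3
  have h4 := LinearMap.finrank_range_add_finrank_ker ((δ x).domRestrict V)
  have h5 := LinearMap.finrank_range_add_finrank_ker ((δ x₀).domRestrict V)
  omega

theorem exists_finrank_superAlg_le {r s : ℕ} (i : Fin r) (j : Fin s) (n : ℕ) :
    ∃ p : MvPolynomial (Fin 2) ℂ, p ≠ 0 ∧ ∀ q t : ℂ, eval ![q, t] p ≠ 0 →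
      Module.finrank ℂ (compRS r s (Subalgebra.toSubmodule (superAlg r s q t)) n) ≤
        Module.finrank ℂ (compRS r s (Subalgebra.toSubmodule (superAlg r s 0 0)) n) := by
  set V := compRS r s (Subalgebra.toSubmodule (symmAlg r s)) n with hV
  set δ : (MvPolynomial (Fin 2) ℂ →ₐ[ℂ] ℂ) → Rrs r s →ₗ[ℂ] Rrs r s := fun x =>
    (evPair (x (X 1)) (x (X 0)) i j).toLinearMap - (evPair 1 1 i j).toLinearMap with hδ
  obtain ⟨p, hp, hpx⟩ := exists_finrank_ker_le V δ
    (fun f => evPair (X 1) (X 0) i j (map C f) - evPair 1 1 i j (map C f)) (fun x f => by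
      have h : map (x : MvPolynomial (Fin 2) ℂ →+* ℂ) (map C f) = f := by
        rw [map_map]
        have e : (x : MvPolynomial (Fin 2) ℂ →+* ℂ).comp C = RingHom.id ℂ :=
          RingHom.ext fun a => AlgHom.commutes x a
        rw [e, map_id]
      rw [map_sub, map_evPair, map_evPair, h, map_one]
      rfl) (evalHom 0 0)
  refine ⟨p, ?_, fun q t h => ?_⟩
  · rintro rfl
    exact hp (map_zero _)
  have hX : ∀ q t, δ (evalHom q t) =
      (evPair t q i j).toLinearMap - (evPair 1 1 i j).toLinearMap := by
    intro q t
    have h0 : evalHom q t (X 0) = q := by simp [evalHom]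
    have h1 : evalHom q t (X 1) = t := by simp [evalHom]
    simp only [hδ, h0, h1]
  have hk : ∀ q t f, f ∈ LinearMap.ker ((δ (evalHom q t)).domRestrict V) ↔
      evPair t q i j (f : Rrs r s) = evPair 1 1 i j (f : Rrs r s) := by
    intro q t f
    rw [LinearMap.mem_ker, LinearMap.domRestrict_apply, hX, LinearMap.sub_apply, sub_eq_zero]
    rfl
  have h1 := hpx (evalHom q t) (by rwa [evalHom_apply])
  rw [← Submodule.finrank_map_subtype_eq, ← Submodule.finrank_map_subtype_eq V] at h1
  refine (Submodule.finrank_mono ?_).trans (h1.trans (Submodule.finrank_mono ?_))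
  · intro f hf
    obtain ⟨h2, h3⟩ := mem_superAlg.1 hf.1
    exact ⟨⟨f, h2, hf.2⟩, (hk q t _).2 (h3 i j), rfl⟩
  · rintro _ ⟨f, hf, rfl⟩
    exact ⟨mem_superAlg_zero_of_pair f.2.1 i j ((hk 0 0 f).1 hf), f.2.2⟩

theorem linearIndependent_of_isHomogeneous {ι σ K : Type*} [Field K] {v : ι → MvPolynomial σ K}
    {w : ι → ℕ} (hv : ∀ i, (v i).IsHomogeneous (w i))
    (h : ∀ n, LinearIndependent K fun i : {i // w i = n} => v i) : LinearIndependent K v := by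
  rw [linearIndependent_iff']
  intro T g hg i hi
  have h1 : LinearIndepOn K v {j | w j = w i} := h (w i)
  rw [linearIndepOn_iff'] at h1
  refine h1 (T.filter fun j => w j = w i) g (by simp) ?_ i (by simp [hi])
  have h2 := congrArg (homogeneousComponent (w i)) hg
  rw [map_sum, map_zero] at h2
  refine Eq.trans ?_ h2
  rw [Finset.sum_filter]
  refine Finset.sum_congr rfl fun j _ => ?_
  rw [map_smul, homogeneousComponent_of_mem (hv j)]
  by_cases hj : w j = w i
  · rw [if_pos hj, if_pos hj.symm]
  · rw [if_neg hj, if_neg (Ne.symm hj), smul_zero]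

section Newton

variable {B : Type*} [CommRing B] [Algebra ℂ B] {Q : ℕ → B} {A : Subalgebra ℂ B} {m : ℕ}

theorem newtonE_mem (h : ∀ i < m, Q (i + 1) ∈ A) : ∀ n ≤ m, newtonE Q n ∈ A := by
  intro n
  induction n using Nat.strong_induction_on with
  | _ n ih =>
    intro hn
    rcases n with _ | n
    · rw [newtonE_zero]; exact one_mem A
    · rw [newtonE_succ]
      refine A.smul_mem (sum_mem fun i hi => ?_) _
      rw [Finset.mem_range] at hi
      exact mul_mem (mul_mem (pow_mem (neg_mem (one_mem A)) _) (h i (by omega)))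
        (ih _ (by omega) (by omega))

theorem mem_of_newtonE_mem (h : ∀ n ≤ m, newtonE Q n ∈ A) : ∀ i < m, Q (i + 1) ∈ A := by
  intro n
  induction n using Nat.strong_induction_on with
  | _ n ih =>
    intro hn
    have h1 := newtonE_succ Q n
    have h2 : ((n : ℂ) + 1) ≠ 0 := by exact_mod_cast Nat.succ_ne_zero n
    rw [eq_inv_smul_iff₀ h2, Finset.sum_range_succ, Nat.sub_self, newtonE_zero, mul_one] at h1
    have h3 : Q (n + 1) = (-1) ^ n * (((n : ℂ) + 1) • newtonE Q (n + 1) -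
        ∑ i ∈ Finset.range n, (-1) ^ i * Q (i + 1) * newtonE Q (n - i)) := by
      rw [h1, add_sub_cancel_left, ← mul_assoc, ← mul_pow, neg_one_mul, neg_neg, one_pow, one_mul]
    rw [h3]
    refine mul_mem (pow_mem (neg_mem (one_mem A)) _) (sub_mem (A.smul_mem (h _ (by omega)) _)
      (sum_mem fun i hi => ?_))
    rw [Finset.mem_range] at hi
    exact mul_mem (mul_mem (pow_mem (neg_mem (one_mem A)) _) (ih i hi (by omega)))
      (h _ (by omega))

end Newton

section Homogeneity

variable {r s : ℕ}

theorem superP_isHomogeneous (q t : ℂ) (i : ℕ) : (superP r s q t i).IsHomogeneous i := by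
  have h : ∀ k, ((X k : Rrs r s) ^ i).IsHomogeneous i := fun k => isHomogeneous_X_pow _ _
  exact ((IsHomogeneous.sum _ _ _ fun j _ => h _).C_mul _).add
    ((IsHomogeneous.sum _ _ _ fun j _ => h _).C_mul _)

theorem newtonE_isHomogeneous {σ : Type*} {Q : ℕ → MvPolynomial σ ℂ}
    (hQ : ∀ i, (Q i).IsHomogeneous i) (n : ℕ) : (newtonE Q n).IsHomogeneous n := by
  induction n using Nat.strong_induction_on with
  | _ n ih =>
    rcases n with _ | n
    · rw [newtonE_zero]; exact isHomogeneous_one _ _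
    · rw [newtonE_succ, smul_eq_C_mul]
      refine (IsHomogeneous.sum _ _ _ fun i hi => ?_).C_mul _
      rw [Finset.mem_range] at hi
      have h1 : ((-1 : MvPolynomial σ ℂ) ^ i) = C ((-1) ^ i) := by simp
      have h2 := ((hQ (i + 1)).C_mul ((-1) ^ i)).mul (ih (n - i) (by omega))
      rw [show i + 1 + (n - i) = n + 1 by omega] at h2
      rwa [h1]

theorem monoE_isHomogeneous {σ : Type*} {E : ℕ → MvPolynomial σ ℂ}
    (hE : ∀ n, (E n).IsHomogeneous n) (x : (Fin r → ℕ) × (Fin s → ℕ) × (ℕ →₀ ℕ)) :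
    (monoE r s E x).IsHomogeneous (monoWt r s x) := by
  refine (IsHomogeneous.prod _ _ _ fun k _ => (hE _).pow _).mul
    ((IsHomogeneous.prod _ _ _ fun k _ => (hE _).pow _).mul ?_)
  rw [psumWt, Finsupp.sum]
  refine IsHomogeneous.prod _ _ _ fun k _ => ?_
  rw [mul_comm]
  exact (hE _).pow _

end Homogeneity

theorem linearIndependent_subalgebra {A J S : Type*} [CommRing A] [Algebra ℂ A]
    {B : Subalgebra ℂ A} {P : J → A} (hP : ∀ b ∈ B, b ∈ Submodule.span ℂ (Set.range P)) {e : S → A}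
    (h : LinearIndependent ℂ fun x : J × S => P x.1 * e x.2) : LinearIndependent B e := by
  classical
  rw [linearIndependent_iff']
  intro T β hβ σ hσ
  choose c hc using fun τ => Finsupp.mem_span_range_iff_exists_finsupp.1 (hP (β τ) (β τ).2)
  set U := T.biUnion fun τ => (c τ).support with hU
  have hc2 : ∀ τ ∈ T, (β τ : A) = ∑ j ∈ U, c τ j • P j := by
    intro τ hτ
    rw [← hc τ]
    exact Finsupp.sum_of_support_subset _
      (Finset.subset_biUnion_of_mem (fun τ => (c τ).support) hτ) _ fun j _ => zero_smul _ _
  rw [linearIndependent_iff'] at h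
  have h1 := h (U ×ˢ T) (fun x => c x.2 x.1) (by
    rw [Finset.sum_product_right, ← hβ]
    refine Finset.sum_congr rfl fun τ hτ => ?_
    rw [Subalgebra.smul_def, smul_eq_mul, hc2 τ hτ, Finset.sum_mul]
    exact Finset.sum_congr rfl fun j _ => (smul_mul_assoc _ _ _).symm)
  refine Subtype.ext ?_
  rw [hc2 σ hσ]
  exact Finset.sum_eq_zero fun j hj => by
    rw [h1 (j, σ) (Finset.mk_mem_product hj hσ), zero_smul]

theorem mem_span_monomials {r s : ℕ} {A : Type*} [CommRing A] [Algebra ℂ A] {E : ℕ → A} {f : A}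
    (hf : f ∈ (aeval (R := ℂ) (Sum.elim (fun k : Fin r => E (k + 1))
      fun k : Fin s => E (r + 1 + k))).range) :
    f ∈ Submodule.span ℂ (Set.range fun x : (Fin r → ℕ) × (Fin s → ℕ) =>
      (∏ k : Fin r, E (k + 1) ^ x.1 k) * ∏ k : Fin s, E (r + 1 + k) ^ x.2 k) := by
  obtain ⟨p, rfl⟩ := hf
  rw [AlgHom.toRingHom_eq_coe, RingHom.coe_coe, aeval_def, eval₂_eq']
  refine sum_mem fun d _ => ?_
  rw [← Algebra.smul_def, Fintype.prod_sum_type]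
  exact Submodule.smul_mem _ _ (Submodule.subset_span
    ⟨(fun k => d (Sum.inl k), fun k => d (Sum.inr k)), rfl⟩)

section Series

variable {r s : ℕ} {S : Set (ℕ →₀ ℕ)}

theorem wtSeries_monoWt (S : Set (ℕ →₀ ℕ)) :
    wtSeries (fun x : (Fin r → ℕ) × (Fin s → ℕ) × S => monoWt r s (x.1, x.2.1, x.2.2)) =
      symSeries r * wtSeries fun x : (Fin s → ℕ) × S => psumFamilyWt r s (x.1, x.2) :=
  wtSeries_prod (a := fun ν : Fin r → ℕ => ∑ k : Fin r, ((k : ℕ) + 1) * ν k)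
    (b := fun x : (Fin s → ℕ) × S => psumFamilyWt r s (x.1, x.2)) (finite_symSeries_fiber r)
    (finite_psumFamilyWt r s S)

theorem coeff_symSeries_mul_dSeries_le
    (hS : ∀ n, PowerSeries.coeff n (dSeries r s) ≤
      (Nat.card {x : (Fin s → ℕ) × S // psumFamilyWt r s (x.1, x.2) = n} : ℚ)) (n : ℕ) :
    PowerSeries.coeff n (symSeries r * dSeries r s) ≤
      (Nat.card {x : (Fin r → ℕ) × (Fin s → ℕ) × S //
        monoWt r s (x.1, x.2.1, x.2.2) = n} : ℚ) := by
  rw [← coeff_wtSeries, wtSeries_monoWt, PowerSeries.coeff_mul, PowerSeries.coeff_mul]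
  refine Finset.sum_le_sum fun p _ => mul_le_mul_of_nonneg_left ?_ ?_
  · rw [coeff_wtSeries]; exact hS _
  · rw [symSeries, coeff_wtSeries]; exact Nat.cast_nonneg _

theorem finite_of_wtSeries_eq
    (h : wtSeries (fun x : (Fin r → ℕ) × (Fin s → ℕ) × S => monoWt r s (x.1, x.2.1, x.2.2)) =
      symSeries r * dSeries r s) : S.Finite := by
  have hfin : ∀ n, Finite {σ : S // psumWt r σ = n} := fun m => by
    have := (finite_psumWt r m).to_subtype
    exact Finite.of_injective (β := {θ | psumWt r θ = m}) (fun σ => ⟨σ.1.1, σ.2⟩) fun x y h =>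
      Subtype.ext (Subtype.ext (congrArg (fun z => z.1) h))
  have hw : ∀ k : Fin s, 0 < r + 1 + (k : ℕ) := fun _ => by omega
  rw [wtSeries_monoWt] at h
  have h1 := mul_left_cancel₀ (left_ne_zero_of_mul_eq_one (symSeries_mul_uu r)) h
  have h2 : wtSeries (fun x : (Fin s → ℕ) × S => psumFamilyWt r s (x.1, x.2)) =
      wtSeries (fun μ : Fin s → ℕ => ∑ k : Fin s, (r + 1 + k) * μ k) *
        wtSeries fun σ : S => psumWt r σ :=
    wtSeries_prod (a := fun μ : Fin s → ℕ => ∑ k : Fin s, (r + 1 + k) * μ k)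
      (b := fun σ : S => psumWt r σ) (finite_sumFiber (fun k : Fin s => r + 1 + k) hw) hfin
  have h3 := wtSeries_sum_mul (fun k : Fin s => r + 1 + (k : ℕ)) hw
  obtain ⟨p, hp⟩ := exists_dSeries_mul r s
  rw [Fin.prod_univ_eq_prod_range (fun k => 1 - (PowerSeries.X : PowerSeries ℚ) ^ (r + 1 + k)) s]
    at h3
  rw [← h1, h2, mul_right_comm, h3, one_mul] at hp
  refine ((Set.finite_Iic p.natDegree).biUnion fun n _ => finite_psumWt r n).subset fun σ hσ => ?_
  rw [Set.mem_iUnion₂]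
  refine ⟨psumWt r σ, ?_, rfl⟩
  rw [Set.mem_Iic]
  by_contra! hlt
  have h4 := congrArg (PowerSeries.coeff (psumWt r σ)) hp
  rw [coeff_wtSeries, Polynomial.coeff_coe, Polynomial.coeff_eq_zero_of_natDegree_lt hlt] at h4
  have := hfin (psumWt r σ)
  rw [Nat.cast_eq_zero, Finite.card_eq_zero_iff] at h4
  exact h4.false ⟨⟨σ, hσ⟩, rfl⟩

end Series

section Spans

variable {r s : ℕ}

theorem span_eq_compRS {ι : Type*} {v : ι → Rrs r s} {w : ι → ℕ} {M : Submodule ℂ (Rrs r s)}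
    (hv : ∀ i, (v i).IsHomogeneous (w i)) (hM : ∀ i, v i ∈ M) (n : ℕ) [Finite {i // w i = n}]
    (h : LinearIndependent ℂ fun i : {i // w i = n} => v i)
    (hle : Module.finrank ℂ (compRS r s M n) ≤ Nat.card {i // w i = n}) :
    Module.finrank ℂ (compRS r s M n) = Nat.card {i // w i = n} ∧
      Submodule.span ℂ (Set.range fun i : {i // w i = n} => v i) = compRS r s M n := by
  have := Fintype.ofFinite {i // w i = n}
  have h1 : Submodule.span ℂ (Set.range fun i : {i // w i = n} => v i) ≤ compRS r s M n := by
    rw [Submodule.span_le]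
    rintro _ ⟨i, rfl⟩
    have h0 := hv i
    rw [i.2] at h0
    exact ⟨hM i, (mem_homogeneousSubmodule _ _).2 h0⟩
  have h2 := finrank_span_eq_card h
  rw [← Nat.card_eq_fintype_card] at h2
  have h3 := Submodule.eq_of_le_of_finrank_le h1 (hle.trans h2.ge)
  exact ⟨by rw [← h3, h2], h3⟩

theorem toSubmodule_adjoin_le {G : Set (Rrs r s)} (hG : ∀ g ∈ G, ∃ n, g.IsHomogeneous n)
    {N : Submodule ℂ (Rrs r s)}
    (hN : ∀ n, compRS r s (Subalgebra.toSubmodule (Algebra.adjoin ℂ G)) n ≤ N) :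
    Subalgebra.toSubmodule (Algebra.adjoin ℂ G) ≤ N := by
  conv_lhs => rw [Algebra.adjoin_eq_span]
  rw [Submodule.span_le]
  intro f hf
  have h1 : ∃ n, f.IsHomogeneous n := by
    induction hf using Submonoid.closure_induction with
    | mem x hx => exact hG x hx
    | one => exact ⟨0, isHomogeneous_one _ _⟩
    | mul x y _ _ hx hy =>
      obtain ⟨m, hm⟩ := hx
      obtain ⟨n, hn⟩ := hy
      exact ⟨m + n, hm.mul hn⟩
  obtain ⟨n, hn⟩ := h1
  refine hN n ⟨?_, (mem_homogeneousSubmodule _ _).2 hn⟩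
  rw [Algebra.adjoin_eq_span]
  exact Submodule.subset_span hf

theorem free_span_of_monoE {A : Type*} [CommRing A] [Algebra ℂ A] {B Λ : Subalgebra ℂ A}
    {E : ℕ → A} {S : Set (ℕ →₀ ℕ)} (hS : S.Finite)
    (hB : B ≤ (aeval (R := ℂ) (Sum.elim (fun k : Fin r => E (k + 1))
      fun k : Fin s => E (r + 1 + k))).range)
    (hEB : ∀ n ≤ r + s, E n ∈ B) (hE : ∀ n, E n ∈ Λ)
    (h : LinearIndependent ℂ fun x : (Fin r → ℕ) × (Fin s → ℕ) × S =>
      monoE r s E (x.1, x.2.1, x.2.2))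
    (hΛ : Subalgebra.toSubmodule Λ ≤ Submodule.span ℂ (Set.range
      fun x : (Fin r → ℕ) × (Fin s → ℕ) × S => monoE r s E (x.1, x.2.1, x.2.2))) :
    Module.Finite B (Submodule.span B (Λ : Set A)) ∧
      Module.Free B (Submodule.span B (Λ : Set A)) := by
  set e : S → A := fun σ => σ.1.prod fun k m => E (r + 1 + k) ^ m with he
  set P : (Fin r → ℕ) × (Fin s → ℕ) → A := fun x =>
    (∏ k : Fin r, E (k + 1) ^ x.1 k) * ∏ k : Fin s, E (r + 1 + k) ^ x.2 k with hP
  have hmono : ∀ x : (Fin r → ℕ) × (Fin s → ℕ) × S,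
      monoE r s E (x.1, x.2.1, x.2.2) = P (x.1, x.2.1) * e x.2.2 := fun x => by
    rw [monoE, ← mul_assoc]
  have h1 : LinearIndependent ℂ fun x : ((Fin r → ℕ) × (Fin s → ℕ)) × S => P x.1 * e x.2 := by
    have h2 := h.comp (Equiv.prodAssoc (Fin r → ℕ) (Fin s → ℕ) S) (Equiv.injective _)
    have h3 : (fun x : ((Fin r → ℕ) × (Fin s → ℕ)) × S => P x.1 * e x.2) =
        (fun x : (Fin r → ℕ) × (Fin s → ℕ) × S => monoE r s E (x.1, x.2.1, x.2.2)) ∘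
          Equiv.prodAssoc (Fin r → ℕ) (Fin s → ℕ) S :=
      funext fun x => (hmono (x.1.1, x.1.2, x.2)).symm
    rw [h3]
    exact h2
  have h4 : LinearIndependent B e :=
    linearIndependent_subalgebra (fun b hb => mem_span_monomials (hB hb)) h1
  have h5 : Submodule.span B (Λ : Set A) = Submodule.span B (Set.range e) := by
    refine le_antisymm (Submodule.span_le.2 fun f hf => ?_) (Submodule.span_mono ?_)
    · have h6 : Submodule.span ℂ (Set.range fun x : (Fin r → ℕ) × (Fin s → ℕ) × S =>
          monoE r s E (x.1, x.2.1, x.2.2)) ≤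
          (Submodule.span B (Set.range e)).restrictScalars ℂ := by
        rw [Submodule.span_le]
        rintro _ ⟨x, rfl⟩
        have h7 : P (x.1, x.2.1) ∈ B :=
          mul_mem (prod_mem fun k _ => pow_mem (hEB _ (by omega)) _)
            (prod_mem fun k _ => pow_mem (hEB _ (by omega)) _)
        have h8 := (Submodule.span B (Set.range e)).smul_mem (⟨_, h7⟩ : B)
          (Submodule.subset_span ⟨x.2.2, rfl⟩)
        rw [Subalgebra.smul_def, smul_eq_mul] at h8
        rwa [← hmono] at h8
      exact h6 (hΛ hf)
    · rintro _ ⟨σ, rfl⟩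
      exact prod_mem fun k _ => pow_mem (hE _) _
  rw [h5]
  have := hS.to_subtype
  exact ⟨Module.Finite.of_basis (Module.Basis.span h4), Module.Free.of_basis (Module.Basis.span h4)⟩

end Spans

section Generic

variable {r s : ℕ} {q t : ℂ}

theorem superP_eq_smul (ht : ∀ n, 1 ≤ n → t ^ n ≠ 1) {i : ℕ} (hi : 1 ≤ i) :
    superP r s q t i = (t ^ i - 1) • Qrs r s (fun i => (q ^ i - 1) / (1 - t ^ i)) i := by
  have h : 1 - t ^ i ≠ 0 := sub_ne_zero.2 (ht i hi).symm
  have h1 : 1 - q ^ i = (t ^ i - 1) * ((q ^ i - 1) / (1 - t ^ i)) := by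
    field_simp
    ring
  rw [superP, Qrs, smul_eq_C_mul, mul_add, ← mul_assoc, ← C_mul, h1]

theorem superP_mem_iff (ht : ∀ n, 1 ≤ n → t ^ n ≠ 1) {i : ℕ} (hi : 1 ≤ i)
    (A : Subalgebra ℂ (Rrs r s)) :
    superP r s q t i ∈ A ↔ Qrs r s (fun i => (q ^ i - 1) / (1 - t ^ i)) i ∈ A := by
  rw [superP_eq_smul ht hi]
  exact (Subalgebra.toSubmodule A).smul_mem_iff (sub_ne_zero.2 (ht i hi))

theorem lamRS_finite_free_hilbRS {S : Set (ℕ →₀ ℕ)}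
    (hS : ∀ n, PowerSeries.coeff n (dSeries r s) ≤
      (Nat.card {x : (Fin s → ℕ) × S // psumFamilyWt r s (x.1, x.2) = n} : ℚ))
    (ht : ∀ n, 1 ≤ n → t ^ n ≠ 1)
    (hli : ∀ n, LinearIndependent ℂ
      fun x : {x : (Fin r → ℕ) × (Fin s → ℕ) × S // monoWt r s (x.1, x.2.1, x.2.2) = n} =>
        monoE r s (newtonE (superP r s q t)) (x.1.1, x.1.2.1, x.1.2.2))
    (hle : ∀ n, Module.finrank ℂ (compRS r s (Subalgebra.toSubmodule (superAlg r s q t)) n) ≤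
        Module.finrank ℂ (compRS r s (Subalgebra.toSubmodule (superAlg r s 0 0)) n))
    {a : ℕ → ℂ} (ha : a = fun i => (q ^ i - 1) / (1 - t ^ i)) :
    Module.Finite (BRS r s a) (LamRSMod r s a) ∧ Module.Free (BRS r s a) (LamRSMod r s a) ∧
      hilbRS r s (Subalgebra.toSubmodule (LamRS r s a)) = symSeries r * dSeries r s := by
  set E := newtonE (superP r s q t) with hE
  set v : (Fin r → ℕ) × (Fin s → ℕ) × S → Rrs r s := fun x => monoE r s E (x.1, x.2.1, x.2.2)
    with hv
  set w : (Fin r → ℕ) × (Fin s → ℕ) × S → ℕ := fun x => monoWt r s (x.1, x.2.1, x.2.2) with hw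
  have hmem : ∀ i, 1 ≤ i → ∀ A : Subalgebra ℂ (Rrs r s),
      superP r s q t i ∈ A ↔ Qrs r s a i ∈ A := fun i hi A => by
    rw [ha]; exact superP_mem_iff ht hi A
  have hQ : ∀ i, 1 ≤ i → Qrs r s a i ∈ LamRS r s a := fun i hi =>
    Algebra.subset_adjoin ⟨i, hi, rfl⟩
  have hEΛ : ∀ n, E n ∈ LamRS r s a := fun n =>
    newtonE_mem (m := n) (fun i _ => (hmem _ (by omega) _).2 (hQ _ (by omega))) n le_rfl
  have hEB : ∀ n ≤ r + s, E n ∈ BRS r s a := newtonE_mem fun i hi =>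
    (hmem _ (by omega) _).2 (Algebra.subset_adjoin ⟨i + 1, by omega, by omega, rfl⟩)
  have hBE : BRS r s a ≤ (aeval (R := ℂ) (Sum.elim (fun k : Fin r => E (k + 1))
      fun k : Fin s => E (r + 1 + k))).range := by
    refine Algebra.adjoin_le ?_
    rintro _ ⟨i, h1, h2, rfl⟩
    refine (hmem i h1 _).1 ?_
    obtain ⟨i, rfl⟩ := Nat.exists_eq_add_of_le' h1
    refine mem_of_newtonE_mem (m := r + s) (fun n hn => ?_) i (by omega)
    rcases n with _ | n
    · rw [newtonE_zero]; exact one_mem _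
    · rcases lt_or_ge n r with hnr | hnr
      · exact ⟨X (Sum.inl ⟨n, hnr⟩), aeval_X _ _⟩
      · refine ⟨X (Sum.inr ⟨n - r, by omega⟩), (aeval_X _ _).trans ?_⟩
        rw [Sum.elim_inr, ← hE]
        congr 1
        simp only
        omega
  have hΛ : LamRS r s a ≤ superAlg r s q t := by
    refine Algebra.adjoin_le ?_
    rintro _ ⟨i, h1, rfl⟩
    exact (hmem i h1 _).1 (superP_mem_superAlg r s q t i)
  have hvh : ∀ x, (v x).IsHomogeneous (w x) := fun x =>
    monoE_isHomogeneous (newtonE_isHomogeneous (superP_isHomogeneous q t)) _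
  have hvΛ : ∀ x, v x ∈ LamRS r s a := fun x =>
    mul_mem (prod_mem fun k _ => pow_mem (hEΛ _) _)
      (mul_mem (prod_mem fun k _ => pow_mem (hEΛ _) _) (prod_mem fun k _ => pow_mem (hEΛ _) _))
  have hfin : ∀ n, Finite {x // w x = n} := finite_monoWt r s S
  have hup : ∀ n, (Module.finrank ℂ (compRS r s (Subalgebra.toSubmodule (LamRS r s a)) n) : ℚ) ≤
      PowerSeries.coeff n (symSeries r * dSeries r s) := fun n => by
    refine le_trans ?_ (finrank_superAlg_zero_le r s n)
    have h : compRS r s (Subalgebra.toSubmodule (LamRS r s a)) n ≤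
        compRS r s (Subalgebra.toSubmodule (superAlg r s q t)) n := inf_le_inf_right _ hΛ
    exact_mod_cast (Submodule.finrank_mono h).trans (hle n)
  have hlow := coeff_symSeries_mul_dSeries_le hS
  have hspan : ∀ n, Module.finrank ℂ (compRS r s (Subalgebra.toSubmodule (LamRS r s a)) n) =
      Nat.card {x // w x = n} ∧ Submodule.span ℂ (Set.range fun i : {x // w x = n} => v i) =
        compRS r s (Subalgebra.toSubmodule (LamRS r s a)) n := fun n =>
    span_eq_compRS hvh hvΛ n (hli n) (by exact_mod_cast (hup n).trans (hlow n))
  have hcoeff : ∀ n, (Nat.card {x // w x = n} : ℚ) =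
      PowerSeries.coeff n (symSeries r * dSeries r s) := fun n =>
    le_antisymm ((hspan n).1 ▸ hup n) (hlow n)
  have hSfin : S.Finite := finite_of_wtSeries_eq (PowerSeries.ext fun n =>
    (coeff_wtSeries w n).trans (hcoeff n))
  have hΛv : Subalgebra.toSubmodule (LamRS r s a) ≤ Submodule.span ℂ (Set.range v) := by
    refine toSubmodule_adjoin_le ?_ fun n => ?_
    · rintro _ ⟨i, hi, rfl⟩
      have h : ∀ k, ((X k : Rrs r s) ^ i).IsHomogeneous i := fun k => isHomogeneous_X_pow _ _
      exact ⟨i, ((IsHomogeneous.sum _ _ _ fun j _ => h _).C_mul _).add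
        (IsHomogeneous.sum _ _ _ fun j _ => h _)⟩
    · refine (hspan n).2.symm.le.trans (Submodule.span_mono ?_)
      rintro _ ⟨x, rfl⟩
      exact ⟨x, rfl⟩
  have hfree := free_span_of_monoE hSfin hBE hEB hEΛ
    (linearIndependent_of_isHomogeneous hvh hli) hΛv
  refine ⟨hfree.1, hfree.2, PowerSeries.ext fun n => ?_⟩
  rw [hilbRS, PowerSeries.coeff_mk, (hspan n).1, hcoeff]

end Generic

theorem X_pow_sub_one_ne_zero {σ K : Type*} [Field K] (i : σ) (n : ℕ) :
    (X i ^ (n + 1) - 1 : MvPolynomial σ K) ≠ 0 := fun h => by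
  have := congrArg (eval (0 : σ → K)) h
  simp at this

/-- For `r, s ≥ 1` and Weil generic `(q,t)` — i.e. for all `(q,t)` outside a countable
union of proper Zariski-closed subsets of `ℂ²` (in particular, `q` and `t` are not roots
of unity) — the algebra `Λ_{r,s,a}` with `a_i = (q^i-1)/(1-t^i)` is Cohen–Macaulay:
it is a free module of finite rank over `ℂ[Q_1,...,Q_{r+s}]`, and its Hilbert series is
`h_{r,s}(u) = (1/(u;u)_r) Σ_{i=0}^{s} u^{i(r+1)}/(u;u)_i`, i.e.
`H(u)·(u;u)_r·(u;u)_s = Σ_{i=0}^{s} u^{i(r+1)} Π_{k=i+1}^{s}(1-u^k)`. -/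
theorem lambdaRS_CM_weil_generic (r s : ℕ) (hr : 1 ≤ r) (hs : 1 ≤ s) :
    ∃ Z : ℕ → Set (ℂ × ℂ),
      (∀ n : ℕ, ∃ p : MvPolynomial (Fin 2) ℂ, p ≠ 0 ∧
        Z n = {x : ℂ × ℂ | eval ![x.1, x.2] p = 0}) ∧
      ∀ q t : ℂ, (q, t) ∉ ⋃ n, Z n →
        (∀ n : ℕ, 1 ≤ n → q ^ n ≠ 1) ∧ (∀ n : ℕ, 1 ≤ n → t ^ n ≠ 1) ∧
        (let a : ℕ → ℂ := fun i => (q ^ i - 1) / (1 - t ^ i)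
         Module.Finite ↥(BRS r s a) ↥(LamRSMod r s a) ∧
         Module.Free ↥(BRS r s a) ↥(LamRSMod r s a) ∧
         hilbRS r s (Subalgebra.toSubmodule (LamRS r s a)) * (uu r * uu s) =
           ∑ i ∈ Finset.range (s + 1), PowerSeries.X ^ (i * (r + 1)) *
             ∏ k ∈ Finset.Ico i s, (1 - PowerSeries.X ^ (k + 1))) := by
  obtain ⟨S, hS, hcard⟩ := exists_linearIndependent_psumFamily r s
  have hlim := linearIndependent_monoE_limitE r s hS
  have h1 : ∀ n, ∃ p : MvPolynomial (Fin 2) ℂ, p ≠ 0 ∧ ∀ q t : ℂ, eval ![q, t] p ≠ 0 →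
      LinearIndependent ℂ
        fun x : {x : (Fin r → ℕ) × (Fin s → ℕ) × S // monoWt r s (x.1, x.2.1, x.2.2) = n} =>
          monoE r s (newtonE (superP r s q t)) (x.1.1, x.1.2.1, x.1.2.2) := fun n => by
    have := finite_monoWt r s S n
    exact exists_linearIndependent_monoE r s (ι := {x : (Fin r → ℕ) × (Fin s → ℕ) × S //
      monoWt r s (x.1, x.2.1, x.2.2) = n}) (fun x => (x.1.1, x.1.2.1, x.1.2.2))
      (hlim.comp Subtype.val Subtype.val_injective)
  choose p1 hp1 hp1' using h1
  choose p2 hp2 hp2' using exists_finrank_superAlg_le (⟨0, hr⟩ : Fin r) (⟨0, hs⟩ : Fin s)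
  refine ⟨fun n => {x | eval ![x.1, x.2]
    (p1 n * p2 n * ((X 0 ^ (n + 1) - 1) * (X 1 ^ (n + 1) - 1))) = 0}, fun n => ⟨_,
    mul_ne_zero (mul_ne_zero (hp1 n) (hp2 n))
      (mul_ne_zero (X_pow_sub_one_ne_zero _ _) (X_pow_sub_one_ne_zero _ _)), rfl⟩,
    fun q t hqt => ?_⟩
  simp only [Set.mem_iUnion, not_exists, Set.mem_ofPred_eq, map_mul, mul_eq_zero, not_or] at hqt
  have hq : ∀ n : ℕ, 1 ≤ n → q ^ n ≠ 1 := fun n hn => by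
    obtain ⟨n, rfl⟩ := Nat.exists_eq_add_of_le' hn
    simpa [sub_eq_zero] using (hqt n).2.1
  have ht : ∀ n : ℕ, 1 ≤ n → t ^ n ≠ 1 := fun n hn => by
    obtain ⟨n, rfl⟩ := Nat.exists_eq_add_of_le' hn
    simpa [sub_eq_zero] using (hqt n).2.2
  obtain ⟨h2, h3, h4⟩ := lamRS_finite_free_hilbRS hcard ht (fun n => hp1' n q t (hqt n).1.1)
    (fun n => hp2' n q t (hqt n).1.2) rfl
  refine ⟨hq, ht, h2, h3, ?_⟩
  rw [h4]
  exact symSeries_mul_dSeries_mul r s
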